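/- arXiv:2508.06918 — 2 statements merged into one kernel-verified Lean document; each statement's English description precedes it below -/
import Mathlib

section
/- Let C be a clone on {0,1,2} containing a Mal'cev operation. Then there is a permutation σ of {0,1,2} such that, writing C^σ for the conjugate clone {σ ∘ f ∘ (σ⁻¹ applied to each argument) : f ∈ C}, one of the following holds: (1) no nontrivial equivalence relation on {0,1,2} is invariant under C^σ, and C^σ = Pol(Γ₁), where Γ₁ consists of all C^σ-invariant subsets of {0,1,2} together with those relations among φ, ψ₂, ψ₀', ψ₁', ψ₂', φ₀', φ₁', φ₂', φ₃', φ₄', φ₅', T, T₀', T₁', T₂' that are invariant under C^σ; or (2) the equivalence relation μ₂ is invariant under C^σ, and C^σ = Pol(Γ₂), where Γ₂ consists of all C^σ-invariant subsets of {0,1,2} together with those relations among μ₂, ρ₂, τ₀, τ₁, ψ₂, ψ₂', T₂, T₂', T^{μ₂}, S₀₁ that are invariant under C^σ. In particular, every Mal'cev clone on a three-element set has an at most 4-ary relational basis. -/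
/-- `f` preserves the `k`-ary relation `R`. -/
def Preserves {A : Type} {n k : ℕ} (f : (Fin n → A) → A) (R : Set (Fin k → A)) : Prop :=
  ∀ r : Fin n → Fin k → A, (∀ i, r i ∈ R) → (fun j => f fun i => r i j) ∈ R

/-- A family of operations on `A`, indexed so that `C n` are the `(n+1)`-ary operations. -/
abbrev Ops (A : Type) := ∀ n : ℕ, Set ((Fin (n + 1) → A) → A)

/-- `C` is a clone: it contains all projections and is closed under composition. -/
structure IsClone {A : Type} (C : Ops A) : Prop where
  proj : ∀ (n : ℕ) (i : Fin (n + 1)), (fun x => x i) ∈ C n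
  comp : ∀ (n m : ℕ) (f : (Fin (n + 1) → A) → A) (g : Fin (n + 1) → (Fin (m + 1) → A) → A),
      f ∈ C n → (∀ i, g i ∈ C m) → (fun x => f fun i => g i x) ∈ C m

/-- A subset of `A` viewed as a unary relation. -/
def unRel {A : Type} (s : Set A) : Set (Fin 1 → A) := {t | t 0 ∈ s}

def psi2 : Set (Fin 2 → Fin 3) :=
  {t | (t 0, t 1) ∈ ({(0, 1), (1, 0), (2, 2)} : Set (Fin 3 × Fin 3))}

def psi2' : Set (Fin 2 → Fin 3) :=
  {t | (t 0, t 1) ∈ ({(0, 1), (1, 0)} : Set (Fin 3 × Fin 3))}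

def phi : Set (Fin 2 → Fin 3) :=
  {t | (t 0, t 1) ∈ ({(0, 1), (1, 2), (2, 0)} : Set (Fin 3 × Fin 3))}

def mu2 : Set (Fin 2 → Fin 3) :=
  {t | (t 0, t 1) ∈ ({(0, 0), (1, 1), (2, 2), (0, 1), (1, 0)} : Set (Fin 3 × Fin 3))}

def rho2 : Set (Fin 2 → Fin 3) :=
  {t | (t 0, t 1) ∈ ({(0, 2), (1, 2), (2, 0), (2, 1)} : Set (Fin 3 × Fin 3))}

/-- The minority value of `x, y, z` when at most two distinct values occur
(and `x` if all three are distinct). -/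
def mino {A : Type} [DecidableEq A] (x y z : A) : A :=
  if x = y then z else if x = z then y else x

/-- The relation `T_i' = {(x,y,z,min(x,y,z)) : x,y,z ≠ i}`. -/
def Tprime (i : Fin 3) : Set (Fin 4 → Fin 3) :=
  {t | t 0 ≠ i ∧ t 1 ≠ i ∧ t 2 ≠ i ∧ t 3 = mino (t 0) (t 1) (t 2)}

/-- The relation `T₂ = T₂' ∪ {(2,2,2,2)}`. -/
def T2rel : Set (Fin 4 → Fin 3) := insert (fun _ => 2) (Tprime 2)

/-- The relation `T = {(x,y,z,x-y+z mod 3)}`. -/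
def Trel : Set (Fin 4 → Fin 3) := {t | t 3 = t 0 - t 1 + t 2}

def psi0' : Set (Fin 2 → Fin 3) :=
  {t | (t 0, t 1) ∈ ({(1, 2), (2, 1)} : Set (Fin 3 × Fin 3))}

def psi1' : Set (Fin 2 → Fin 3) :=
  {t | (t 0, t 1) ∈ ({(0, 2), (2, 0)} : Set (Fin 3 × Fin 3))}

def phi0' : Set (Fin 2 → Fin 3) :=
  {t | (t 0, t 1) ∈ ({(1, 2), (2, 0)} : Set (Fin 3 × Fin 3))}

def phi1' : Set (Fin 2 → Fin 3) :=
  {t | (t 0, t 1) ∈ ({(0, 1), (2, 0)} : Set (Fin 3 × Fin 3))}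

def phi2' : Set (Fin 2 → Fin 3) :=
  {t | (t 0, t 1) ∈ ({(0, 1), (1, 2)} : Set (Fin 3 × Fin 3))}

def phi3' : Set (Fin 2 → Fin 3) :=
  {t | (t 0, t 1) ∈ ({(1, 2), (0, 0)} : Set (Fin 3 × Fin 3))}

def phi4' : Set (Fin 2 → Fin 3) :=
  {t | (t 0, t 1) ∈ ({(0, 2), (1, 1)} : Set (Fin 3 × Fin 3))}

def phi5' : Set (Fin 2 → Fin 3) :=
  {t | (t 0, t 1) ∈ ({(0, 1), (2, 2)} : Set (Fin 3 × Fin 3))}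

def tau0 : Set (Fin 2 → Fin 3) :=
  {t | (t 0, t 1) ∈ ({(0, 0), (1, 0), (2, 1)} : Set (Fin 3 × Fin 3))}

def tau1 : Set (Fin 2 → Fin 3) :=
  {t | (t 0, t 1) ∈ ({(0, 1), (1, 1), (2, 0)} : Set (Fin 3 × Fin 3))}

/-- The quotient map `{0,1,2} → {0,1}` collapsing the `μ₂`-class `{0,1}` to `0`. -/
def qmap : Fin 3 → Fin 2 := fun x => if x = 2 then 1 else 0

/-- The relation `T^{μ₂}`: the `μ₂`-class of `t 3` is the Boolean minority of the
`μ₂`-classes of `t 0, t 1, t 2` (Boolean minority being `x+y+z mod 2`). -/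
def Tmu2 : Set (Fin 4 → Fin 3) :=
  {t | qmap (t 3) = qmap (t 0) + qmap (t 1) + qmap (t 2)}

/-- The ternary relation `S₀₁`. -/
def S01 : Set (Fin 3 → Fin 3) :=
  {t | (t 0, t 1, t 2) ∈
    ({(0, 0, 0), (0, 0, 1), (1, 1, 0), (1, 1, 1), (0, 1, 2), (1, 0, 2)} :
      Set (Fin 3 × Fin 3 × Fin 3))}

/-- The conjugate clone `C^σ = {σ ∘ f ∘ (σ⁻¹ applied to each argument) : f ∈ C}`. -/
def conjClone (σ : Equiv.Perm (Fin 3)) (C : Ops (Fin 3)) : Ops (Fin 3) :=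
  fun n => (fun f => fun x => σ (f fun i => σ.symm (x i))) '' C n

/-- The relation `R` is invariant under every operation of `C`. -/
def InvariantUnder {A : Type} {k : ℕ} (C : Ops A) (R : Set (Fin k → A)) : Prop :=
  ∀ n f, f ∈ C n → Preserves f R

/-- The binary standard relations for the simple case. -/
def binList1 : Set (Set (Fin 2 → Fin 3)) :=
  {phi, psi2, psi0', psi1', psi2', phi0', phi1', phi2', phi3', phi4', phi5'}

/-- The 4-ary standard relations for the simple case. -/
def quatList1 : Set (Set (Fin 4 → Fin 3)) := {Trel, Tprime 0, Tprime 1, Tprime 2}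

/-- The binary standard relations for the case of monolith `μ₂`. -/
def binList2 : Set (Set (Fin 2 → Fin 3)) := {mu2, rho2, tau0, tau1, psi2, psi2'}

/-- The 4-ary standard relations for the case of monolith `μ₂`. -/
def quatList2 : Set (Set (Fin 4 → Fin 3)) := {T2rel, Tprime 2, Tmu2}

open Function
set_option linter.unusedSectionVars false

/-! ## Linear algebra: affine hyperplanes over `ZMod p` -/

lemma aff_hyper {p : ℕ} [Fact p.Prime] {ι : Type} [Fintype ι] [DecidableEq ι]
    (W : Set (ι → ZMod p)) (hW : ∀ x ∈ W, ∀ y ∈ W, ∀ z ∈ W, x - y + z ∈ W)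
    (h0 : (0 : ι → ZMod p) ∉ W) (h1 : ∀ i, Pi.single i 1 ∈ W) (i0 : ι) (x : ι → ZMod p) :
    x ∈ W ↔ ∑ i, x i = 1 := by
  set e : ι → ZMod p := Pi.single i0 1 with he
  let H : AddSubgroup (ι → ZMod p) :=
    { carrier := {h | h + e ∈ W}
      zero_mem' := by simpa using h1 i0
      add_mem' := by
        intro a b ha hb
        have := hW _ ha _ (h1 i0) _ hb
        have h2 : a + b + e = a + e - Pi.single i0 1 + (b + e) := by rw [← he]; abel
        simpa only [Set.mem_ofPred_eq, h2] using this
      neg_mem' := by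
        intro a ha
        have := hW _ (h1 i0) _ ha _ (h1 i0)
        have h2 : -a + e = Pi.single i0 1 - (a + e) + Pi.single i0 1 := by rw [← he]; abel
        simpa only [Set.mem_ofPred_eq, h2] using this }
  have memH : ∀ h, h ∈ H ↔ h + e ∈ W := fun h => Iff.rfl
  have smulH : ∀ (c : ZMod p) (h), h ∈ H → c • h ∈ H := by
    intro c h hh
    have h2 : c • h = c.val • h := by
      ext i
      simp [ZMod.natCast_val]
    rw [h2]
    exact H.nsmul_mem hh _
  have sume : ∑ i, e i = 1 := by simp [he]
  have kerH : ∀ y : ι → ZMod p, ∑ i, y i = 0 → y ∈ H := by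
    intro y hy
    have h2 : y = ∑ i, y i • ((Pi.single i 1 : ι → ZMod p) - e) := by
      simp only [smul_sub, Finset.sum_sub_distrib]
      rw [← Finset.sum_smul, hy, zero_smul, sub_zero]
      ext j
      simp [Finset.sum_apply, Pi.single_apply]
    rw [h2]
    refine H.sum_mem fun i _ => smulH _ _ ?_
    rw [memH]
    simpa using h1 i
  constructor
  · intro hx
    by_contra hs
    apply h0
    have hxH : x - e ∈ H := by rw [memH]; simpa using hx
    have hne : (∑ i, x i) - 1 ≠ 0 := sub_ne_zero.mpr hs
    set s := ∑ i, x i with hsdef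
    have hk : -e + (s - 1)⁻¹ • (x - e) ∈ H := by
      apply kerH
      simp only [Pi.add_apply, Pi.neg_apply, Pi.smul_apply, Pi.sub_apply, smul_eq_mul,
        Finset.sum_add_distrib, Finset.sum_neg_distrib, ← Finset.mul_sum, Finset.sum_sub_distrib,
        sume, ← hsdef]
      rw [inv_mul_cancel₀ hne]; ring
    have := H.sub_mem hk (smulH (s - 1)⁻¹ _ hxH)
    rw [add_sub_cancel_right, memH] at this
    simpa using this
  · intro hx
    have : x - e ∈ H := by
      apply kerH
      simp only [Pi.sub_apply, Finset.sum_sub_distrib, sume, hx, sub_self]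
    rw [memH] at this
    simpa using this

/-- `h` preserves the linking relation between coordinates `i` and `j`. -/
def PresL {p n : ℕ} {ι : Type} (P : ι → Fin 3 → Prop) (δ : ι → Fin 3 → ZMod p)
    (h : (Fin n → Fin 3) → Fin 3) (i j : ι) : Prop :=
  ∀ x y z w : Fin n → Fin 3, (∀ l, P i (x l)) → (∀ l, P i (y l)) → (∀ l, P j (z l)) →
    (∀ l, P j (w l)) → (∀ l, δ i (x l) - δ i (y l) + δ j (z l) - δ j (w l) = 0) →
    δ i (h x) - δ i (h y) + δ j (h z) - δ j (h w) = 0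

lemma presL_of_ne {p n : ℕ} {ι : Type} [Fintype ι] [DecidableEq ι]
    {P : ι → Fin 3 → Prop} {δ : ι → Fin 3 → ZMod p} {R : Set (ι → Fin 3)}
    (hR : ∀ r, r ∈ R ↔ (∀ i, P i (r i)) ∧ ∑ i, δ i (r i) = 1)
    (rep : ∀ i c, ∃ x, P i x ∧ δ i x = c)
    (h : (Fin n → Fin 3) → Fin 3)
    (hh : ∀ r : Fin n → ι → Fin 3, (∀ l, r l ∈ R) → (fun i => h fun l => r l i) ∈ R)
    {i j k : ι} (hij : i ≠ j) (hik : i ≠ k) (hjk : j ≠ k) : PresL P δ h i j := by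
  intro x y z w hx hy hz hw hs
  choose ρ hρP hρ using rep
  let κ : Fin n → Fin 3 := fun l =>
    ρ k (1 - δ i (x l) - δ j (z l) - ∑ q ∈ ((Finset.univ.erase i).erase j).erase k, δ q (ρ q 0))
  let mk : Fin 3 → Fin 3 → Fin 3 → ι → Fin 3 := fun u v c q =>
    if q = i then u else if q = j then v else if q = k then c else ρ q 0
  have hsum : ∀ (F : ι → ZMod p), ∑ q, F q = F i + (F j + (F k +
      ∑ q ∈ ((Finset.univ.erase i).erase j).erase k, F q)) := by
    intro F
    rw [← Finset.add_sum_erase _ _ (Finset.mem_univ i),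
      ← Finset.add_sum_erase (Finset.univ.erase i) _ (a := j) (by simp [hij.symm]),
      ← Finset.add_sum_erase ((Finset.univ.erase i).erase j) _ (a := k)
        (by simp [hik.symm, hjk.symm])]
  have mki : ∀ u v c, mk u v c i = u := by intro u v c; simp [mk]
  have mkj : ∀ u v c, mk u v c j = v := by intro u v c; simp [mk, hij.symm]
  have mkk : ∀ u v c, mk u v c k = c := by intro u v c; simp [mk, hik.symm, hjk.symm]
  have mko : ∀ u v c q, q ∈ ((Finset.univ.erase i).erase j).erase k → mk u v c q = ρ q 0 := by
    intro u v c q hq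
    simp only [Finset.mem_erase, Finset.mem_univ, and_true] at hq
    simp [mk, hq]
  have mkP : ∀ u v l, P i u → P j v → ∀ q, P q (mk u v (κ l) q) := by
    intro u v l hu hv q
    by_cases h1 : q = i
    · subst h1; rw [mki]; exact hu
    by_cases h2 : q = j
    · subst h2; rw [mkj]; exact hv
    by_cases h3 : q = k
    · subst h3; rw [mkk]; exact hρP _ _
    · simp [mk, h1, h2, h3, hρP]
  have mem : ∀ u v l, P i u → P j v → δ i u + δ j v = δ i (x l) + δ j (z l) →
      mk u v (κ l) ∈ R := by
    intro u v l hu hv huv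
    rw [hR]
    refine ⟨mkP u v l hu hv, ?_⟩
    have hc : ∑ q ∈ ((Finset.univ.erase i).erase j).erase k, δ q (mk u v (κ l) q) =
        ∑ q ∈ ((Finset.univ.erase i).erase j).erase k, δ q (ρ q 0) :=
      Finset.sum_congr rfl (fun q hq => by rw [mko _ _ _ q hq])
    rw [hsum, mki, mkj, mkk, hρ, hc]
    linear_combination huv
  have r1 := hh (fun l => mk (x l) (z l) (κ l)) (fun l => mem _ _ l (hx l) (hz l) rfl)
  have r2 := hh (fun l => mk (y l) (w l) (κ l)) (fun l => mem _ _ l (hy l) (hw l)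
    (by linear_combination -hs l))
  have s1 := ((hR _).1 r1).2
  have s2 := ((hR _).1 r2).2
  rw [hsum] at s1 s2
  simp only [mki, mkj, mkk] at s1 s2
  have hc : ∀ u v : Fin n → Fin 3,
      ∑ q ∈ ((Finset.univ.erase i).erase j).erase k, δ q (h fun l => mk (u l) (v l) (κ l) q) =
        ∑ q ∈ ((Finset.univ.erase i).erase j).erase k, δ q (h fun _ => ρ q 0) := by
    intro u v
    refine Finset.sum_congr rfl (fun q hq => ?_)
    simp only [mko _ _ _ q hq]
  rw [hc] at s1 s2
  linear_combination s1 - s2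

lemma presL_all {p n : ℕ} {ι : Type} [Fintype ι] [DecidableEq ι]
    {P : ι → Fin 3 → Prop} {δ : ι → Fin 3 → ZMod p} {R : Set (ι → Fin 3)}
    (hR : ∀ r, r ∈ R ↔ (∀ i, P i (r i)) ∧ ∑ i, δ i (r i) = 1)
    (rep : ∀ i c, ∃ x, P i x ∧ δ i x = c)
    (h3 : ∀ i j : ι, ∃ k, i ≠ k ∧ j ≠ k)
    (h : (Fin n → Fin 3) → Fin 3)
    (hh : ∀ r : Fin n → ι → Fin 3, (∀ l, r l ∈ R) → (fun i => h fun l => r l i) ∈ R)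
    (i j : ι) : PresL P δ h i j := by
  by_cases hij : i = j
  · subst hij
    obtain ⟨j, hj, -⟩ := h3 i i
    obtain ⟨k, hk, hk'⟩ := h3 i j
    have L := presL_of_ne hR rep h hh hj hk hk'
    intro x y z w hx hy hz hw hs
    choose ρ hρP hρ using rep
    have e1 := L x y (fun _ => ρ j 0) (fun l => ρ j (δ i (x l) - δ i (y l))) hx hy
      (fun _ => hρP _ _) (fun _ => hρP _ _) (fun l => by rw [hρ, hρ]; ring)
    have e2 := L w z (fun _ => ρ j 0) (fun l => ρ j (δ i (x l) - δ i (y l))) hw hz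
      (fun _ => hρP _ _) (fun _ => hρP _ _) (fun l => by
        rw [hρ, hρ]; linear_combination -hs l)
    linear_combination e1 - e2
  · obtain ⟨k, hk, hk'⟩ := h3 i j
    exact presL_of_ne hR rep h hh hij hk hk'

lemma final_sum {p n : ℕ} {ι : Type} [Fintype ι] [DecidableEq ι]
    {P : ι → Fin 3 → Prop} {δ : ι → Fin 3 → ZMod p}
    (rep : ∀ i c, ∃ x, P i x ∧ δ i x = c)
    (h : (Fin n → Fin 3) → Fin 3) (hL : ∀ i j, PresL P δ h i j) (i0 : ι)
    (col : ι → Fin n → Fin 3) (hcol : ∀ i l, P i (col i l))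
    (hsum : ∀ l, ∑ i, δ i (col i l) = 1)
    (r : ι → Fin 3) (hr : ∀ i, P i (r i)) (hrs : ∑ i, δ i (r i) = 1) :
    ∑ i, δ i (h (col i)) = ∑ i, δ i (h fun _ => r i) := by
  choose ρ hρP hρ using rep
  let G : (Fin n → ZMod p) →+ ZMod p := AddMonoidHom.mk'
    (fun e => δ i0 (h fun l => ρ i0 (e l)) - δ i0 (h fun _ => ρ i0 0)) (by
      intro e e'
      have := hL i0 i0 (fun l => ρ i0 (e l + e' l)) (fun l => ρ i0 (e l)) (fun _ => ρ i0 0)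
        (fun l => ρ i0 (e' l)) (fun _ => hρP _ _) (fun _ => hρP _ _) (fun _ => hρP _ _)
        (fun _ => hρP _ _) (fun l => by simp only [hρ]; ring)
      simp only [Pi.add_apply]
      linear_combination this)
  have hD : ∀ i, δ i (h (col i)) - δ i (h fun _ => r i) =
      G (fun l => δ i (col i l) - δ i (r i)) := by
    intro i
    have := hL i i0 (col i) (fun _ => r i) (fun _ => ρ i0 0)
      (fun l => ρ i0 (δ i (col i l) - δ i (r i))) (hcol i) (fun _ => hr i) (fun _ => hρP _ _)
        (fun _ => hρP _ _) (fun l => by simp only [hρ]; ring)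
    change _ = δ i0 (h fun l => ρ i0 (δ i (col i l) - δ i (r i))) - δ i0 (h fun _ => ρ i0 0)
    linear_combination this
  rw [← sub_eq_zero, ← Finset.sum_sub_distrib, Finset.sum_congr rfl (fun i _ => hD i), ← map_sum]
  convert map_zero G
  ext l
  simp [Finset.sum_apply, hsum, hrs]

/-! ## Mal'cev-closed relations -/

def IsMal (M : Fin 3 → Fin 3 → Fin 3 → Fin 3) : Prop :=
  ∀ x y, M y x x = y ∧ M x x y = y

def MCl {ι : Type} (M : Fin 3 → Fin 3 → Fin 3 → Fin 3) (R : Set (ι → Fin 3)) : Prop :=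
  ∀ r ∈ R, ∀ s ∈ R, ∀ u ∈ R, (fun i => M (r i) (s i) (u i)) ∈ R

/-- The projection of `R` to coordinate `i`. -/
def PI {ι : Type} (R : Set (ι → Fin 3)) (i : ι) (x : Fin 3) : Prop := ∃ r ∈ R, r i = x

/-- The kernel congruence of `R` at coordinate `i`. -/
def Th {ι : Type} [DecidableEq ι] (R : Set (ι → Fin 3)) (i : ι) (x y : Fin 3) : Prop :=
  ∃ r ∈ R, r i = x ∧ update r i y ∈ R

section
variable {ι : Type} [DecidableEq ι] {M : Fin 3 → Fin 3 → Fin 3 → Fin 3} {R : Set (ι → Fin 3)}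

lemma Th.sat (hM : IsMal M) (hR : MCl M R) {i : ι} {x y : Fin 3} (h : Th R i x y)
    {s : ι → Fin 3} (hs : s ∈ R) (hx : s i = x) : update s i y ∈ R := by
  obtain ⟨r, hr, hrx, hry⟩ := h
  convert hR s hs r hr _ hry using 1
  ext q
  by_cases hq : q = i
  · subst hq; simp [hx, hrx, (hM _ _).2]
  · simp [hq, (hM _ _).1]

/-- Two members of `R` that agree off `i` witness `Th`. -/
lemma Th.mk2 {i : ι} {r s : ι → Fin 3} (hr : r ∈ R) (hs : s ∈ R)
    (h : ∀ q, q ≠ i → r q = s q) : Th R i (r i) (s i) := by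
  refine ⟨r, hr, rfl, ?_⟩
  convert hs using 1
  ext q
  by_cases hq : q = i
  · subst hq; simp
  · simp [hq, h q hq]

lemma Th.refl {i : ι} {x : Fin 3} (h : PI R i x) : Th R i x x := by
  obtain ⟨r, hr, rfl⟩ := h
  exact Th.mk2 hr hr fun _ _ => rfl

lemma Th.symm {i : ι} {x y : Fin 3} (h : Th R i x y) : Th R i y x := by
  obtain ⟨r, hr, rfl, h2⟩ := h
  have := Th.mk2 (i := i) h2 hr (fun q hq => by simp [hq])
  simpa using this

lemma Th.left {i : ι} {x y : Fin 3} (h : Th R i x y) : PI R i x := by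
  obtain ⟨r, hr, rfl, h2⟩ := h
  exact ⟨r, hr, rfl⟩

lemma Th.right {i : ι} {x y : Fin 3} (h : Th R i x y) : PI R i y := h.symm.left

lemma Th.trans (hM : IsMal M) (hR : MCl M R) {i : ι} {x y z : Fin 3} (h : Th R i x y)
    (h' : Th R i y z) : Th R i x z := by
  obtain ⟨r, hr, rfl, h2⟩ := h
  have := h'.sat hM hR h2 (by simp)
  refine ⟨r, hr, rfl, by simpa using this⟩

lemma Th.mal (hR : MCl M R) {i : ι} {x y z x' y' z' : Fin 3} (h1 : Th R i x x')
    (h2 : Th R i y y') (h3 : Th R i z z') : Th R i (M x y z) (M x' y' z') := by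
  obtain ⟨r, hr, rfl, h1⟩ := h1
  obtain ⟨s, hs, rfl, h2⟩ := h2
  obtain ⟨u, hu, rfl, h3⟩ := h3
  have := Th.mk2 (i := i) (hR _ hr _ hs _ hu) (hR _ h1 _ h2 _ h3) (fun q hq => by simp [hq])
  simpa using this

lemma PI.mal (hR : MCl M R) {i : ι} {x y z : Fin 3} (h1 : PI R i x)
    (h2 : PI R i y) (h3 : PI R i z) : PI R i (M x y z) := by
  obtain ⟨r, hr, rfl⟩ := h1
  obtain ⟨s, hs, rfl⟩ := h2
  obtain ⟨u, hu, rfl⟩ := h3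
  exact ⟨_, hR _ hr _ hs _ hu, rfl⟩

variable {t a : ι → Fin 3}

lemma not_th (hM : IsMal M) (hR : MCl M R) (ht : t ∉ R) (ha : ∀ i, update t i (a i) ∈ R) (i : ι) :
    ¬ Th R i (t i) (a i) := by
  intro h
  have := h.symm.sat hM hR (ha i) (by simp)
  simp at this
  exact ht this

lemma PI_a (ha : ∀ i, update t i (a i) ∈ R) (i : ι) : PI R i (a i) := ⟨_, ha i, by simp⟩

lemma PI_t (ha : ∀ i, update t i (a i) ∈ R) {i j : ι} (hij : i ≠ j) : PI R i (t i) :=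
  ⟨_, ha j, by simp [hij]⟩

/-- Two coordinates cannot be switched at once. -/
lemma no_pair (hM : IsMal M) (hR : MCl M R) (ht : t ∉ R) (ha : ∀ i, update t i (a i) ∈ R)
    {j k : ι} (hjk : j ≠ k) : update (update t j (a j)) k (a k) ∉ R := by
  intro h
  apply ht
  convert hR _ (ha j) _ h _ (ha k) using 1
  ext q
  by_cases hq : q = k
  · subst hq; simp [hjk.symm, (hM _ _).1]
  by_cases hq' : q = j
  · subst hq'; simp [hjk, (hM _ _).2]
  · simp [hq, hq', (hM _ _).1]

lemma not_th_tat (hM : IsMal M) (hR : MCl M R) (ht : t ∉ R) (ha : ∀ i, update t i (a i) ∈ R)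
    {i j k : ι} (hij : i ≠ j) (hik : i ≠ k) (hjk : j ≠ k) :
    ¬ Th R i (M (t i) (a i) (t i)) (t i) := by
  intro h
  apply no_pair hM hR ht ha hjk
  have h1 := hR _ (ha j) _ (ha i) _ (ha k)
  have h2 := h.sat hM hR h1 (by simp [hij, hik])
  convert h2 using 1
  ext q
  by_cases hq : q = k
  · subst hq; simp [hjk.symm, hik.symm, (hM _ _).2]
  by_cases hq' : q = j
  · subst hq'; simp [hjk, hij.symm, (hM _ _).1]
  by_cases hq2 : q = i
  · subst hq2; simp [hij, hik]
  · simp [hq, hq', hq2, (hM _ _).1]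

lemma not_th_ata (hM : IsMal M) (hR : MCl M R) (ht : t ∉ R) (ha : ∀ i, update t i (a i) ∈ R)
    {i j k : ι} (hij : i ≠ j) (hik : i ≠ k) (hjk : j ≠ k)
    (hat : Th R i (M (t i) (a i) (t i)) (a i)) :
    ¬ Th R i (M (a i) (t i) (a i)) (a i) := by
  intro h
  have h1 := hR _ (ha j) _ (ha i) _ (ha k)
  have h2 := hat.sat hM hR h1 (by simp [hij, hik])
  have h3 := hR _ h2 _ (ha j) _ (ha i)
  have h4 := h.sat hM hR h3 (by simp [hij])
  apply no_pair hM hR ht ha hik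
  convert h4 using 1
  ext q
  by_cases hq : q = k
  · subst hq; simp [hjk.symm, hik.symm, (hM _ _).1, (hM _ _).2]
  by_cases hq' : q = j
  · subst hq'; simp [hjk, hij.symm, (hM _ _).1, (hM _ _).2]
  by_cases hq2 : q = i
  · subst hq2; simp [hik]
  · simp [hq, hq', hq2, (hM _ _).1]

variable [Fintype ι]

/-- Saturation in all coordinates at once. -/
lemma sat_all {p : ℕ} {P : ι → Fin 3 → Prop} {δ : ι → Fin 3 → ZMod p}
    (sat : ∀ r ∈ R, ∀ i x, P i x → δ i x = δ i (r i) → update r i x ∈ R)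
    {r s : ι → Fin 3} (hr : r ∈ R) (hs : ∀ i, P i (s i)) (h : ∀ i, δ i (s i) = δ i (r i)) :
    s ∈ R := by
  have key : ∀ S : Finset ι, (fun i => if i ∈ S then s i else r i) ∈ R := by
    intro S
    induction S using Finset.induction_on with
    | empty => simpa using hr
    | insert i S hi ih =>
      have := sat _ ih i (s i) (hs i) (by simp [hi, h])
      convert this using 1
      ext q
      by_cases hq : q = i
      · subst hq; simp
      · simp [hq]
  simpa using key Finset.univ

/-- A critical relation whose coordinates are affine over `ZMod p` is an affine hyperplane. -/
lemma structure_lemma {p : ℕ} [Fact p.Prime] {P : ι → Fin 3 → Prop} {δ : ι → Fin 3 → ZMod p}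
    (hR : MCl M R) (ht : t ∉ R) (ha : ∀ i, update t i (a i) ∈ R)
    (hMδ : ∀ i x y z, P i x → P i y → P i z → δ i (M x y z) = δ i x - δ i y + δ i z)
    (hRP : ∀ r ∈ R, ∀ i, P i (r i)) (hPt : ∀ i, P i (t i))
    (sat : ∀ r ∈ R, ∀ i x, P i x → δ i x = δ i (r i) → update r i x ∈ R)
    (δt : ∀ i, δ i (t i) = 0) (δa : ∀ i, δ i (a i) = 1) (i0 : ι) (r : ι → Fin 3) :
    r ∈ R ↔ (∀ i, P i (r i)) ∧ ∑ i, δ i (r i) = 1 := by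
  let W : Set (ι → ZMod p) := {w | ∃ r ∈ R, w = fun i => δ i (r i)}
  have hW : ∀ w, w ∈ W ↔ ∑ i, w i = 1 := by
    refine aff_hyper W ?_ ?_ ?_ i0
    · rintro _ ⟨r, hr, rfl⟩ _ ⟨s, hs, rfl⟩ _ ⟨u, hu, rfl⟩
      refine ⟨_, hR r hr s hs u hu, ?_⟩
      ext i
      simp [hMδ i _ _ _ (hRP r hr i) (hRP s hs i) (hRP u hu i)]
    · rintro ⟨r, hr, h⟩
      refine ht (sat_all sat hr hPt fun i => ?_)
      rw [δt, ← congrFun h i]; rfl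
    · intro i
      refine ⟨_, ha i, ?_⟩
      ext q
      by_cases hq : q = i
      · subst hq; simp [δa]
      · simp [hq, δt]
  constructor
  · intro hr
    exact ⟨hRP r hr, (hW _).1 ⟨r, hr, rfl⟩⟩
  · rintro ⟨h1, h2⟩
    obtain ⟨s, hs, h⟩ := (hW (fun i => δ i (r i))).2 h2
    exact sat_all sat hs h1 fun i => congrFun h i

lemma zmod2_cases : ∀ x : ZMod 2, x = 0 ∨ x = 1 := by decide

/-- The two-class case. -/
lemma structure2 {δ : ι → Fin 3 → ZMod 2} (hM : IsMal M)
    (hR : MCl M R) (ht : t ∉ R) (ha : ∀ i, update t i (a i) ∈ R)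
    (h3 : ∀ i j : ι, ∃ k, i ≠ k ∧ j ≠ k)
    (hδ : ∀ i x y, PI R i x → PI R i y → (Th R i x y ↔ δ i x = δ i y))
    (δt : ∀ i, δ i (t i) = 0) (δa : ∀ i, δ i (a i) = 1) (i0 : ι) (r : ι → Fin 3) :
    r ∈ R ↔ (∀ i, PI R i (r i)) ∧ ∑ i, δ i (r i) = 1 := by
  have hPt : ∀ i, PI R i (t i) := fun i => by
    obtain ⟨j, hj, -⟩ := h3 i i
    exact PI_t ha hj
  have hPa : ∀ i, PI R i (a i) := PI_a ha
  refine structure_lemma hR ht ha ?_ (fun r hr i => ⟨r, hr, rfl⟩) hPt ?_ δt δa i0 r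
  · intro i
    obtain ⟨j, hj, -⟩ := h3 i i
    obtain ⟨k, hk, hk'⟩ := h3 i j
    have n1 := not_th_tat hM hR ht ha hj hk hk'
    have P1 := PI.mal hR (hPt i) (hPa i) (hPt i)
    have d1 : δ i (M (t i) (a i) (t i)) = 1 := by
      rw [hδ i _ _ P1 (hPt i), δt] at n1
      exact (zmod2_cases _).resolve_left n1
    have n2 := not_th_ata hM hR ht ha hj hk hk' ((hδ i _ _ P1 (hPa i)).2 (by rw [d1, δa]))
    have P2 := PI.mal hR (hPa i) (hPt i) (hPa i)
    have d2 : δ i (M (a i) (t i) (a i)) = 0 := by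
      rw [hδ i _ _ P2 (hPa i), δa] at n2
      exact (zmod2_cases _).resolve_right n2
    have cls : ∀ x, PI R i x → (Th R i x (t i) ∧ δ i x = 0) ∨ (Th R i x (a i) ∧ δ i x = 1) := by
      intro x hx
      rcases zmod2_cases (δ i x) with h | h
      · exact Or.inl ⟨(hδ i _ _ hx (hPt i)).2 (by rw [h, δt]), h⟩
      · exact Or.inr ⟨(hδ i _ _ hx (hPa i)).2 (by rw [h, δa]), h⟩
    intro x y z hx hy hz
    have tr : ∀ x' y' z', Th R i x x' → Th R i y y' → Th R i z z' →
        δ i (M x y z) = δ i (M x' y' z') := by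
      intro x' y' z' h1 h2 h3
      exact (hδ i _ _ (PI.mal hR hx hy hz) (PI.mal hR h1.right h2.right h3.right)).1
        (Th.mal hR h1 h2 h3)
    rcases cls x hx with ⟨h1, e1⟩ | ⟨h1, e1⟩ <;> rcases cls y hy with ⟨h2, e2⟩ | ⟨h2, e2⟩ <;>
      rcases cls z hz with ⟨h3, e3⟩ | ⟨h3, e3⟩ <;>
      rw [tr _ _ _ h1 h2 h3, e1, e2, e3] <;>
      simp [(hM _ _).1, (hM _ _).2, d1, d2, δt, δa] <;> decide
  · intro r hr i x hx h
    exact ((hδ i _ _ ⟨r, hr, rfl⟩ hx).2 h.symm).sat hM hR hr rfl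

end

/-! ## Invariant relations with arbitrary index types -/

def InvG {ι : Type} (C : Ops (Fin 3)) (R : Set (ι → Fin 3)) : Prop :=
  ∀ n, ∀ g ∈ C n, ∀ r : Fin (n + 1) → ι → Fin 3, (∀ l, r l ∈ R) →
    (fun i => g fun l => r l i) ∈ R

lemma InvG.mcl {ι : Type} {C : Ops (Fin 3)} {R : Set (ι → Fin 3)} (h : InvG C R)
    {m : (Fin 3 → Fin 3) → Fin 3} (hm : m ∈ C 2) : MCl (fun x y z => m ![x, y, z]) R := by
  intro r hr s hs u hu
  have := h 2 m hm ![r, s, u] (by intro l; fin_cases l <;> simpa)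
  have e : ∀ i, (fun l => ![r, s, u] l i) = ![r i, s i, u i] := by
    intro i
    funext l
    fin_cases l <;> rfl
  simpa only [e] using this

/-- `i`-values of pairs of members of `R` that agree off `{i, j}`. -/
def Lam {ι : Type} (R : Set (ι → Fin 3)) (i j : ι) (x y : Fin 3) : Prop :=
  ∃ r ∈ R, ∃ s ∈ R, r i = x ∧ s i = y ∧ ∀ q, q ≠ i → q ≠ j → r q = s q

/-- `i`-values of parallelograms in `R` with sides in directions `j` and `k`. -/
def Quad {ι : Type} (R : Set (ι → Fin 3)) (i j k : ι) (x y z w : Fin 3) : Prop :=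
  ∃ r0 ∈ R, ∃ r1 ∈ R, ∃ r2 ∈ R, ∃ r3 ∈ R, r0 i = x ∧ r1 i = y ∧ r2 i = z ∧ r3 i = w ∧
    (∀ q, q ≠ i → q ≠ j → r0 q = r1 q) ∧ (∀ q, q ≠ i → q ≠ k → r1 q = r2 q) ∧
    (∀ q, q ≠ i → q ≠ j → r2 q = r3 q) ∧ (∀ q, q ≠ i → q ≠ k → r0 q = r3 q)

section
variable {ι : Type} {C : Ops (Fin 3)} {R : Set (ι → Fin 3)}

lemma InvG.pi (h : InvG C R) (i : ι) : InvG C {v : Fin 1 → Fin 3 | PI R i (v 0)} := by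
  intro n g hg v hv
  choose r hr hri using hv
  refine ⟨_, h n g hg r hr, ?_⟩
  simp only [hri]

lemma InvG.lam (h : InvG C R) (i j : ι) : InvG C {v : Fin 2 → Fin 3 | Lam R i j (v 0) (v 1)} := by
  intro n g hg v hv
  choose r hr s hs hri hsi hq using hv
  refine ⟨_, h n g hg r hr, _, h n g hg s hs, ?_, ?_, ?_⟩
  · simp only [hri]
  · simp only [hsi]
  · intro q h1 h2
    simp only [hq _ q h1 h2]

lemma InvG.quad (h : InvG C R) (i j k : ι) :
    InvG C {v : Fin 4 → Fin 3 | Quad R i j k (v 0) (v 1) (v 2) (v 3)} := by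
  intro n g hg v hv
  choose r0 h0 r1 h1 r2 h2 r3 h3 e0 e1 e2 e3 q0 q1 q2 q3 using hv
  refine ⟨_, h n g hg r0 h0, _, h n g hg r1 h1, _, h n g hg r2 h2, _, h n g hg r3 h3,
    ?_, ?_, ?_, ?_, ?_, ?_, ?_, ?_⟩
  · simp only [e0]
  · simp only [e1]
  · simp only [e2]
  · simp only [e3]
  · intro q a b
    simp only [q0 _ q a b]
  · intro q a b
    simp only [q1 _ q a b]
  · intro q a b
    simp only [q2 _ q a b]
  · intro q a b
    simp only [q3 _ q a b]

variable [DecidableEq ι]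

lemma InvG.th (h : InvG C R) (i : ι) : InvG C {v : Fin 2 → Fin 3 | Th R i (v 0) (v 1)} := by
  intro n g hg v hv
  choose r hr hri hs using hv
  have := Th.mk2 (i := i) (h n g hg r hr) (h n g hg _ hs) (fun q hq => by simp [hq])
  simpa [hri] using this

variable {M : Fin 3 → Fin 3 → Fin 3 → Fin 3}

lemma Lam.symm {i j : ι} {x y : Fin 3} (h : Lam R i j x y) : Lam R i j y x := by
  obtain ⟨r, hr, s, hs, h1, h2, h3⟩ := h
  exact ⟨s, hs, r, hr, h2, h1, fun q a b => (h3 q a b).symm⟩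

lemma Lam.trans (hM : IsMal M) (hR : MCl M R) {i j : ι} {x y z : Fin 3} (h : Lam R i j x y)
    (h' : Lam R i j y z) : Lam R i j x z := by
  obtain ⟨r, hr, s, hs, h1, h2, h3⟩ := h
  obtain ⟨r', hr', s', hs', h1', h2', h3'⟩ := h'
  refine ⟨r, hr, _, hR s hs r' hr' s' hs', h1, ?_, ?_⟩
  · simp [h2, h1', h2', (hM _ _).2]
  · intro q a b
    simp [h3 q a b, h3' q a b, (hM _ _).1]

lemma Lam.refl {i j : ι} {x : Fin 3} (h : PI R i x) : Lam R i j x x := by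
  obtain ⟨r, hr, h1⟩ := h
  exact ⟨r, hr, r, hr, h1, h1, fun _ _ _ => rfl⟩

lemma Lam.ta {t a : ι → Fin 3} (ha : ∀ i, update t i (a i) ∈ R) {i j : ι} (hij : i ≠ j) :
    Lam R i j (t i) (a i) :=
  ⟨_, ha j, _, ha i, by simp [hij], by simp, fun q h1 h2 => by simp [h1, h2]⟩

/-- Parallelograms from two sides. -/
lemma Quad.mk2 (hM : IsMal M) (hR : MCl M R) {i j k : ι} {x y w : Fin 3}
    (h : Lam R i j y x) (h' : Lam R i k x w) : Quad R i j k y x w (M y x w) := by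
  obtain ⟨r', hr', r, hr, h1, h2, h3⟩ := h
  obtain ⟨s, hs, s', hs', h1', h2', h3'⟩ := h'
  refine ⟨r', hr', r, hr, _, hR r hr s hs s' hs', _, hR r' hr' s hs s' hs', h1, h2, ?_, ?_, h3,
    ?_, ?_, ?_⟩
  · simp [h2, h1', h2', (hM _ _).2]
  · simp [h1, h1', h2']
  · intro q a b
    simp [h3' q a b, (hM _ _).1]
  · intro q a b
    simp [h3 q a b]
  · intro q a b
    simp [h3' q a b, (hM _ _).1]

lemma Quad.flip {i j k : ι} {x y z w : Fin 3} (h : Quad R i j k x y z w) :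
    Quad R i k j z y x w := by
  obtain ⟨r0, h0, r1, h1, r2, h2, r3, h3, e0, e1, e2, e3, q0, q1, q2, q3⟩ := h
  exact ⟨r2, h2, r1, h1, r0, h0, r3, h3, e2, e1, e0, e3, fun q a b => (q1 q a b).symm,
    fun q a b => (q0 q a b).symm, q3, q2⟩

lemma Quad.swap {i j k : ι} {x y z w : Fin 3} (h : Quad R i j k x y z w) :
    Quad R i j k y x w z := by
  obtain ⟨r0, h0, r1, h1, r2, h2, r3, h3, e0, e1, e2, e3, q0, q1, q2, q3⟩ := h
  exact ⟨r1, h1, r0, h0, r3, h3, r2, h2, e1, e0, e3, e2, fun q a b => (q0 q a b).symm,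
    q3, fun q a b => (q2 q a b).symm, q1⟩

lemma Quad.th (hM : IsMal M) (hR : MCl M R) {i j k : ι} (hij : i ≠ j) (hik : i ≠ k)
    (hjk : j ≠ k) {x z w : Fin 3} (h : Quad R i j k x x z w) : Th R i z w := by
  obtain ⟨r0, h0, r1, h1, r2, h2, r3, h3, e0, e1, e2, e3, q0, q1, q2, q3⟩ := h
  have hj : Th R j (r1 j) (r0 j) := Th.mk2 h1 h0 (fun q hq => by
    by_cases hqi : q = i
    · subst hqi; rw [e0, e1]
    · exact (q0 q hqi hq).symm)
  have h4 := hj.sat hM hR h2 (q1 j hij.symm hjk).symm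
  have := Th.mk2 (i := i) h4 h3 (fun q hq => by
    by_cases hqj : q = j
    · subst hqj; simp [q3 q hq hjk]
    · simp [hqj, q2 q hq hqj])
  simpa [hij, e2, e3] using this

end

/-! ## Critical relations separating `f` from the clone -/

structure Crit {n : ℕ} (C : Ops (Fin 3)) (f : (Fin (n + 1) → Fin 3) → Fin 3)
    (ι : Type) [Fintype ι] [DecidableEq ι] (R : Set (ι → Fin 3))
    (col : ι → Fin (n + 1) → Fin 3) (t a : ι → Fin 3) : Prop where
  inv : InvG C R
  ht : t ∉ R
  hf : ∀ i, f (col i) = t i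
  ha : ∀ i, update t i (a i) ∈ R
  hcol : ∀ l, (fun i => col i l) ∈ R
  max : ∀ R', InvG C R' → R ⊆ R' → t ∉ R' → R' ⊆ R
  two : 3 ≤ Fintype.card ι → ∀ x y, ∃ g ∈ C n, g x = f x ∧ g y = f y

lemma exists_crit {n : ℕ} {C : Ops (Fin 3)} (hC : IsClone C)
    {f : (Fin (n + 1) → Fin 3) → Fin 3} (hf : f ∉ C n) :
    ∃ (Y : Finset (Fin (n + 1) → Fin 3)) (R : Set (Y → Fin 3)) (a : Y → Fin 3),
      Crit C f Y R (fun i => i.1) (fun i => f i.1) a := by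
  classical
  let I : Finset (Fin (n + 1) → Fin 3) → Prop := fun Y => ∃ g ∈ C n, ∀ y ∈ Y, g y = f y
  have hI : ¬ I Finset.univ := by
    rintro ⟨g, hg, h⟩
    have : g = f := funext fun y => h y (Finset.mem_univ _)
    exact hf (this ▸ hg)
  obtain ⟨Y, hY, hmin⟩ := Finset.exists_min_image
    (Finset.univ.filter fun Y => ¬ I Y) Finset.card ⟨Finset.univ, by simp [hI]⟩
  simp only [Finset.mem_filter, Finset.mem_univ, true_and] at hY hmin
  have hlt : ∀ Z : Finset (Fin (n + 1) → Fin 3), Z.card < Y.card → I Z := by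
    intro Z hZ
    by_contra h
    exact absurd (hmin Z h) (by omega)
  let R0 : Set (Y → Fin 3) := {r | ∃ g ∈ C n, ∀ i, r i = g i.1}
  have hR0 : InvG C R0 := by
    intro k g hg r hr
    choose u hu hru using hr
    exact ⟨_, hC.comp k n g u hg hu, fun i => by simp only [hru]⟩
  have ht0 : (fun i : Y => f i.1) ∉ R0 := by
    rintro ⟨g, hg, h⟩
    exact hY ⟨g, hg, fun y hy => (h ⟨y, hy⟩).symm⟩
  have ha0 : ∀ i : Y, ∃ b, update (fun i : Y => f i.1) i b ∈ R0 := by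
    intro i
    obtain ⟨g, hg, h⟩ := hlt (Y.erase i.1) (Finset.card_erase_lt_of_mem i.2)
    refine ⟨g i.1, g, hg, fun j => ?_⟩
    by_cases hj : j = i
    · subst hj; simp
    · rw [update_of_ne hj]
      exact (h j.1 (Finset.mem_erase.2 ⟨fun e => hj (Subtype.ext e), j.2⟩)).symm
  choose a ha using ha0
  obtain ⟨R, hRge, hRmax⟩ := Finite.exists_le_maximal
    (p := fun R : Set (Y → Fin 3) => InvG C R ∧ (fun i : Y => f i.1) ∉ R) (a := R0) ⟨hR0, ht0⟩
  refine ⟨Y, R, a, ?_⟩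
  refine ⟨hRmax.prop.1, hRmax.prop.2, fun _ => rfl, fun i => hRge (ha i), fun l => hRge ?_, ?_, ?_⟩
  · exact ⟨_, hC.proj n l, fun i => rfl⟩
  · intro R' h1 h2 h3
    exact hRmax.le_of_ge ⟨h1, h3⟩ h2
  · intro h3 x y
    rw [Fintype.card_coe] at h3
    obtain ⟨g, hg, h⟩ := hlt {x, y} (lt_of_le_of_lt Finset.card_le_two h3)
    exact ⟨g, hg, h x (by simp), h y (by simp)⟩

lemma InvG.preserves_iff {k : ℕ} {C : Ops (Fin 3)} {R : Set (Fin k → Fin 3)} :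
    InvG C R ↔ InvariantUnder C R := Iff.rfl

/-- The projection of `R` to two coordinates. -/
def Bin {ι : Type} (R : Set (ι → Fin 3)) (i j : ι) : Set (Fin 2 → Fin 3) :=
  {v | ∃ r ∈ R, r i = v 0 ∧ r j = v 1}

lemma InvG.bin {ι : Type} {C : Ops (Fin 3)} {R : Set (ι → Fin 3)} (h : InvG C R) (i j : ι) :
    InvG C (Bin R i j) := by
  intro n g hg v hv
  choose r hr h1 h2 using hv
  exact ⟨_, h n g hg r hr, by simp only [h1], by simp only [h2]⟩

namespace Crit
variable {n : ℕ} {C : Ops (Fin 3)} {f : (Fin (n + 1) → Fin 3) → Fin 3}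
    {ι : Type} [Fintype ι] [DecidableEq ι] {R : Set (ι → Fin 3)}
    {col : ι → Fin (n + 1) → Fin 3} {t a : ι → Fin 3}

lemma card_ne_zero (h : Crit C f ι R col t a) : Fintype.card ι ≠ 0 := by
  intro h0
  have := Fintype.card_eq_zero_iff.1 h0
  apply h.ht
  convert h.hcol 0

/-- Unary relations: if `f` preserves them then there are at least two coordinates. -/
lemma card_ne_one (h : Crit C f ι R col t a)
    (hu : ∀ S : Set (Fin 1 → Fin 3), InvG C S → Preserves f S) : Fintype.card ι ≠ 1 := by
  intro h1
  obtain ⟨i, hi⟩ := Fintype.card_eq_one_iff.1 h1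
  have := hu _ (h.inv.pi i) (fun l _ => col i l) (fun l => ⟨_, h.hcol l, rfl⟩)
  obtain ⟨r, hr, hri⟩ := this
  apply h.ht
  convert hr
  funext j
  rw [hi j, hri, h.hf]

lemma bin_false (h : Crit C f ι R col t a) (h2 : Fintype.card ι = 2) {i j : ι} (hij : i ≠ j)
    (hB : Preserves f (Bin R i j)) : False := by
  have hall : ∀ q, q = i ∨ q = j := by
    intro q
    have : ({i, j} : Finset ι) = Finset.univ := by
      rw [← Finset.card_eq_iff_eq_univ, h2, Finset.card_pair hij]
    have hq := Finset.mem_univ q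
    rw [← this] at hq
    simpa using hq
  obtain ⟨r, hr, h0, h1⟩ := hB (fun l => ![col i l, col j l]) (fun l => ⟨_, h.hcol l, rfl, rfl⟩)
  apply h.ht
  convert hr
  funext q
  rcases hall q with rfl | rfl
  · rw [h0, ← h.hf]; rfl
  · rw [h1, ← h.hf]; rfl

lemma three (h3 : 3 ≤ Fintype.card ι) (i j : ι) : ∃ k, i ≠ k ∧ j ≠ k := by
  by_contra hk
  push Not at hk
  have : (Finset.univ : Finset ι) ⊆ {i, j} := by
    intro k _
    by_cases hik : i = k
    · simp [hik]
    · simp [hk k hik]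
  have := (Finset.card_le_card this).trans Finset.card_le_two
  rw [Finset.card_univ] at this
  omega

/-- Every invariant binary relation is preserved when there are three or more coordinates. -/
lemma unary (h : Crit C f ι R col t a) (h3 : 3 ≤ Fintype.card ι) (S : Fin 3 → Prop)
    (hS : InvG C {v : Fin 1 → Fin 3 | S (v 0)}) (x : Fin (n + 1) → Fin 3) (hx : ∀ l, S (x l)) :
    S (f x) := by
  obtain ⟨g, hg, e, -⟩ := h.two h3 x x
  rw [← e]
  exact hS n g hg (fun l _ => x l) hx

lemma binary (h : Crit C f ι R col t a) (h3 : 3 ≤ Fintype.card ι) (S : Fin 3 → Fin 3 → Prop)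
    (hS : InvG C {v : Fin 2 → Fin 3 | S (v 0) (v 1)}) (x y : Fin (n + 1) → Fin 3)
    (hx : ∀ l, S (x l) (y l)) : S (f x) (f y) := by
  obtain ⟨g, hg, e, e'⟩ := h.two h3 x y
  rw [← e, ← e']
  exact hS n g hg (fun l => ![x l, y l]) hx

/-- If some two-valued tuple lies in `R`, its image under `f` does. -/
lemma two_val (h : Crit C f ι R col t a) (h3 : 3 ≤ Fintype.card ι)
    (x y : Fin (n + 1) → Fin 3) (rows : ι → Fin (n + 1) → Fin 3)
    (hxy : ∀ i, rows i = x ∨ rows i = y) (hr : ∀ l, (fun i => rows i l) ∈ R) :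
    (fun i => f (rows i)) ∈ R := by
  obtain ⟨g, hg, e, e'⟩ := h.two h3 x y
  have : (fun i => f (rows i)) = fun i => g (rows i) := by
    funext i
    rcases hxy i with hi | hi <;> simp [hi, e, e']
  rw [this]
  exact h.inv n g hg (fun l i => rows i l) hr

lemma ne_ta (h : Crit C f ι R col t a) (i : ι) :
    t i ≠ a i := by
  intro e
  apply h.ht
  have := h.ha i
  rwa [← e, update_eq_self] at this

end Crit

/-! ## Common endgame -/

section
variable {n : ℕ} {C : Ops (Fin 3)} {f : (Fin (n + 1) → Fin 3) → Fin 3}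
    {ι : Type} [Fintype ι] [DecidableEq ι] {R : Set (ι → Fin 3)}
    {col : ι → Fin (n + 1) → Fin 3} {t a : ι → Fin 3}

lemma adjust {p : ℕ} {P : ι → Fin 3 → Prop} {δ : ι → Fin 3 → ZMod p}
    (hR : ∀ r, r ∈ R ↔ (∀ i, P i (r i)) ∧ ∑ i, δ i (r i) = 1)
    (rep : ∀ i c, ∃ x, P i x ∧ δ i x = c) (i0 : ι) (c : ι → Fin 3) (hc : ∀ i, P i (c i)) :
    ∃ x, P i0 x ∧ update c i0 x ∈ R := by
  obtain ⟨x, hx, hxc⟩ := rep i0 (1 - ∑ q ∈ Finset.univ.erase i0, δ q (c q))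
  refine ⟨x, hx, (hR _).2 ⟨?_, ?_⟩⟩
  · intro i
    by_cases hi : i = i0
    · subst hi; simpa using hx
    · simpa [hi] using hc i
  · rw [← Finset.add_sum_erase Finset.univ _ (Finset.mem_univ i0)]
    have : ∑ q ∈ Finset.univ.erase i0, δ q (update c i0 x q) =
        ∑ q ∈ Finset.univ.erase i0, δ q (c q) :=
      Finset.sum_congr rfl fun q hq => by rw [update_of_ne (Finset.ne_of_mem_erase hq)]
    rw [this, update_self, hxc]
    ring

lemma Crit.finish {p : ℕ} [Fact p.Prime] (h : Crit C f ι R col t a) (h3 : 3 ≤ Fintype.card ι)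
    {P : ι → Fin 3 → Prop} {δ : ι → Fin 3 → ZMod p}
    (hR : ∀ r, r ∈ R ↔ (∀ i, P i (r i)) ∧ ∑ i, δ i (r i) = 1)
    (rep : ∀ i c, ∃ x, P i x ∧ δ i x = c) (δt : ∀ i, δ i (t i) = 0)
    (hL : ∀ i j, PresL P δ f i j) (i0 : ι) (r : ι → Fin 3) (hrR : r ∈ R)
    (u v : Fin 3) (hr : ∀ i, r i = u ∨ r i = v) : False := by
  have h1 := h.two_val h3 (fun _ => u) (fun _ => v) (fun i _ => r i)
    (fun i => by rcases hr i with e | e <;> simp [e]) (fun _ => hrR)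
  have h2 := final_sum rep f hL i0 col (fun i l => ((hR _).1 (h.hcol l)).1 i)
    (fun l => ((hR _).1 (h.hcol l)).2) r ((hR _).1 hrR).1 ((hR _).1 hrR).2
  rw [((hR _).1 h1).2] at h2
  simp [h.hf, δt] at h2

end

/-! ## The simple case -/

def Simp3 (C : Ops (Fin 3)) : Prop :=
  ∀ e : Fin 3 → Fin 3 → Prop, Equivalence e → InvG C {v : Fin 2 → Fin 3 | e (v 0) (v 1)} →
    (∀ x y, e x y ↔ x = y) ∨ (∀ x y, e x y)

lemma mal_val : ∀ y x w v : Fin 3, (y = x → v = w) → (x = w → v = y) →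
    (y ≠ x → x ≠ w → y ≠ w → v = x) → (y = w → y ≠ x → v ≠ y ∧ v ≠ x) → v = y - x + w := by
  decide

def dd (t s x : Fin 3) : ZMod 3 :=
  let v : Fin 3 := (x - t) * s
  v

lemma dd_self : ∀ t s, dd t s t = 0 := by decide

lemma dd_mal : ∀ t s x y z, dd t s (x - y + z) = dd t s x - dd t s y + dd t s z := by decide

lemma dd_diff : ∀ t s x y, dd t s x - dd t s y = dd 0 s (x - y) := by decide

lemma dd_L : ∀ s s' x y z w : Fin 3, s ≠ 0 → s' ≠ 0 →
    (dd 0 s (x - y) + dd 0 s' (z - w) = 0 ↔ if s = s' then w = x - y + z else z = x - y + w) := by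
  decide

lemma dd_one : ∀ t a : Fin 3, t ≠ a → dd t (a - t) a = 1 := by decide

lemma dd_rep : ∀ (t s : Fin 3) (c : ZMod 3), s ≠ 0 → ∃ x : Fin 3, dd t s x = c := by decide

lemma dd_inj : ∀ t s x y : Fin 3, s ≠ 0 → dd t s x = dd t s y → x = y := by decide

lemma three_cases : ∀ t a x : Fin 3, t ≠ a → x = t ∨ x = a ∨ x = t - a + t := by decide

lemma third : ∀ t a x y : Fin 3, t ≠ a → x ≠ y → (x = t ∨ x = a ∨ y = t ∨ y = a) := by decide

/-- Indicator of being different from `t`. -/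
def dl (t x : Fin 3) : ZMod 2 := if x = t then 0 else 1

lemma Tprime_iff : ∀ (t a x y z w : Fin 3), t ≠ a →
    ((x ≠ -t - a ∧ y ≠ -t - a ∧ z ≠ -t - a ∧ w = mino x y z) ↔
      ((x = t ∨ x = a) ∧ (y = t ∨ y = a) ∧ (z = t ∨ z = a) ∧ (w = t ∨ w = a) ∧
        dl t x - dl t y + dl t z - dl t w = 0)) := by
  decide

section
variable {n : ℕ} {C : Ops (Fin 3)} {f : (Fin (n + 1) → Fin 3) → Fin 3}
    {ι : Type} [Fintype ι] [DecidableEq ι] {R : Set (ι → Fin 3)}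
    {col : ι → Fin (n + 1) → Fin 3} {t a : ι → Fin 3} {M : Fin 3 → Fin 3 → Fin 3 → Fin 3}

/-- In the simple case all kernels are trivial. -/
lemma th_eq (hs : Simp3 C) (hM : IsMal M) (hR : MCl M R) (h : Crit C f ι R col t a)
    {i j : ι} (hij : i ≠ j) {x y : Fin 3} (hxy : Th R i x y) : x = y := by
  have nt := not_th hM hR h.ht h.ha i
  have hne := h.ne_ta i
  have Pt := PI_t h.ha hij
  have Pa := PI_a h.ha i
  by_cases hA : ∀ z, PI R i z
  · rcases hs (Th R i) ⟨fun z => Th.refl (hA z), Th.symm, fun h1 h2 => Th.trans hM hR h1 h2⟩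
      (h.inv.th i) with e | e
    · exact (e x y).1 hxy
    · exact absurd (e _ _) nt
  · by_contra hne'
    push Not at hA
    obtain ⟨z, hz⟩ := hA
    have hx : x ≠ z := fun e => hz (e ▸ hxy.left)
    have hy : y ≠ z := fun e => hz (e ▸ hxy.right)
    have ht : t i ≠ z := fun e => hz (e ▸ Pt)
    have ha : a i ≠ z := fun e => hz (e ▸ Pa)
    have : (x = t i ∧ y = a i) ∨ (x = a i ∧ y = t i) := by
      revert hne hne' hx hy ht ha
      generalize t i = p
      generalize a i = q
      clear hxy hz
      revert x y z p q
      decide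
    rcases this with ⟨rfl, rfl⟩ | ⟨rfl, rfl⟩
    · exact nt hxy
    · exact nt hxy.symm

lemma quad_facts (hM : IsMal M) {Q : Fin 3 → Fin 3 → Fin 3 → Fin 3 → Prop}
    (hQ : ∀ y x w, Q y x w (M y x w))
    (hcl : ∀ x y z w x' y' z' w' x'' y'' z'' w'', Q x y z w → Q x' y' z' w' → Q x'' y'' z'' w'' →
      Q (M x x' x'') (M y y' y'') (M z z' z'') (M w w' w''))
    (h1 : ∀ x z w, Q x x z w → z = w) (h2 : ∀ x y w, Q x y y w → x = w)
    (h3 : ∀ x y z, Q x y z z → x = y) (h4 : ∀ x y z, Q x y z x → y = z) :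
    (∀ x y z, M x y z = x - y + z) ∧ ∀ x y z w, Q x y z w ↔ w = x - y + z := by
  have F1 : ∀ y x w, y ≠ x → x ≠ w → y ≠ w → M y x w = x := by
    intro y x w h5 h6 h7
    have hq := hQ y x w
    have n1 : M y x w ≠ w := fun e => by rw [e] at hq; exact h5 (h3 _ _ _ hq)
    have n2 : M y x w ≠ y := fun e => by rw [e] at hq; exact h6 (h4 _ _ _ hq)
    revert n1 n2
    generalize M y x w = v
    clear hq
    revert y x w v
    decide
  have F2 : ∀ y x, y ≠ x → M y x y ≠ y ∧ M y x y ≠ x := by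
    intro y x h5
    have hq := hQ y x y
    refine ⟨fun e => ?_, fun e => ?_⟩
    · rw [e] at hq; exact h5 (h3 _ _ _ hq)
    · rw [e] at hq
      obtain ⟨z, hz1, hz2⟩ : ∃ z, z ≠ y ∧ z ≠ x := by
        clear hq e
        revert y x; decide
      have hq2 := hQ y x z
      rw [F1 y x z h5 hz2.symm hz1.symm] at hq2
      have hq3 := hQ z z z
      have := hcl _ _ _ _ _ _ _ _ _ _ _ _ hq hq2 hq3
      simp only [(hM _ _).1, (hM _ _).2] at this
      exact hz1 (h1 _ _ _ this).symm
  have hMv : ∀ x y z, M x y z = x - y + z := by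
    intro y x w
    refine mal_val y x w _ ?_ ?_ (F1 y x w) ?_
    · rintro rfl; exact (hM _ _).2
    · rintro rfl; exact (hM _ _).1
    · rintro rfl hyx; exact F2 y x hyx
  refine ⟨hMv, fun x y z w => ⟨fun hq => ?_, ?_⟩⟩
  · have := hcl _ _ _ _ _ _ _ _ _ _ _ _ hq (hQ x y z) (hQ 0 0 0)
    simp only [(hM _ _).1, (hM _ _).2] at this
    have e := h1 _ _ _ this
    rw [hMv, hMv] at e
    clear hq this
    revert e
    revert x y z w
    decide
  · rintro rfl
    have := hQ x y z
    rwa [hMv] at this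

/-- Simple case, some coordinate projection is everything. -/
lemma caseA (hs : Simp3 C) (hM : IsMal M) (hMC : ∀ {κ : Type} (S : Set (κ → Fin 3)),
      InvG C S → MCl M S) (h : Crit C f ι R col t a) (h3 : 3 ≤ Fintype.card ι)
    (hT : InvG C Trel → Preserves f Trel) (i : ι) (hA : ∀ z, PI R i z) : False := by
  have hR := hMC R h.inv
  obtain ⟨j, hij, -⟩ := Crit.three h3 i i
  obtain ⟨k, hik, hjk⟩ := Crit.three h3 i j
  have lam : ∀ j, i ≠ j → ∀ x y, Lam R i j x y := by
    intro j hij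
    rcases hs (Lam R i j) ⟨fun z => Lam.refl (hA z), Lam.symm,
      fun h1 h2 => Lam.trans hM hR h1 h2⟩ (h.inv.lam i j) with e | e
    · exact absurd ((e _ _).1 (Lam.ta h.ha hij)) (h.ne_ta i)
    · exact e
  have hcl : ∀ x y z w x' y' z' w' x'' y'' z'' w'', Quad R i j k x y z w →
      Quad R i j k x' y' z' w' → Quad R i j k x'' y'' z'' w'' →
      Quad R i j k (M x x' x'') (M y y' y'') (M z z' z'') (M w w' w'') := by
    intro x y z w x' y' z' w' x'' y'' z'' w'' q q' q''
    exact hMC _ (h.inv.quad i j k) ![x, y, z, w] q ![x', y', z', w'] q' ![x'', y'', z'', w''] q''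
  have q1 : ∀ x z w, Quad R i j k x x z w → z = w := fun x z w hq =>
    th_eq hs hM hR h hij (hq.th hM hR hij hik hjk)
  have q1' : ∀ x z w, Quad R i k j x x z w → z = w := fun x z w hq =>
    th_eq hs hM hR h hij (hq.th hM hR hik hij hjk.symm)
  obtain ⟨hMv, hQ⟩ := quad_facts hM (Q := Quad R i j k)
    (fun y x w => Quad.mk2 hM hR (lam j hij _ _) (lam k hik _ _)) hcl q1
    (fun x y w hq => q1' _ _ _ hq.flip) (fun x y z hq => (q1 _ _ _ hq.flip.swap.flip).symm)
    (fun x y z hq => q1' _ _ _ hq.swap.flip)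
  have hTinv : InvG C Trel := by
    have := h.inv.quad i j k
    simp only [hQ] at this
    exact this
  have fT := hT hTinv
  have fT' : ∀ x y z w : Fin (n + 1) → Fin 3, (∀ l, w l = x l - y l + z l) →
      f w = f x - f y + f z := by
    intro x y z w hw
    exact fT (fun l => ![x l, y l, z l, w l]) hw
  have hPI : ∀ q x, PI R q x := by
    intro q x
    obtain ⟨q', hq', -⟩ := Crit.three h3 q q
    have p1 := PI_t h.ha hq'
    have p2 := PI_a h.ha q
    rcases three_cases (t q) (a q) x (h.ne_ta q) with e | e | e
    · rwa [e]
    · rwa [e]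
    · rw [e, ← hMv]; exact PI.mal hR p1 p2 p1
  have hs0 : ∀ q, (a q - t q) ≠ 0 := fun q e => h.ne_ta q (sub_eq_zero.1 e).symm
  have hRs := structure_lemma (p := 3) (P := fun _ _ => True)
    (δ := fun q x => dd (t q) (a q - t q) x) hR h.ht h.ha
    (by
      intro q x y z _ _ _
      rw [hMv]
      exact dd_mal _ _ _ _ _)
    (fun _ _ _ => trivial) (fun _ => trivial)
    (by
      intro r hr q x _ e
      rw [dd_inj _ _ _ _ (hs0 q) e]
      simpa using hr)
    (fun q => dd_self _ _) (fun q => dd_one _ _ (h.ne_ta q)) i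
  have rep : ∀ (q : ι) (c : ZMod 3), ∃ x : Fin 3, True ∧ dd (t q) (a q - t q) x = c := by
    intro q c
    obtain ⟨x, hx⟩ := dd_rep (t q) (a q - t q) c (hs0 q)
    exact ⟨x, trivial, hx⟩
  obtain ⟨x, -, hx⟩ := adjust hRs rep i (fun _ => 0) (fun _ => trivial)
  refine h.finish h3 hRs rep (fun q => dd_self _ _) ?_ i _ hx 0 x ?_
  · intro q q' x y z w _ _ _ _ hl
    have eq1 : ∀ x y z w : Fin 3, dd (t q) (a q - t q) x - dd (t q) (a q - t q) y
        + dd (t q') (a q' - t q') z - dd (t q') (a q' - t q') w =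
        dd 0 (a q - t q) (x - y) + dd 0 (a q' - t q') (z - w) := by
      intro x y z w
      rw [← dd_diff (t q), ← dd_diff (t q')]; ring
    simp only [eq1] at hl ⊢
    have hl' := fun l => (dd_L _ _ _ _ _ _ (hs0 q) (hs0 q')).1 (hl l)
    refine (dd_L _ _ _ _ _ _ (hs0 q) (hs0 q')).2 ?_
    split_ifs at hl' ⊢ with hc
    · exact fT' _ _ _ _ hl'
    · exact fT' _ _ _ _ hl'
  · intro q
    by_cases hq : q = i
    · subst hq; simp
    · simp [hq]

end

/-! ## The simple case, all projections of size two -/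

lemma dl_self : ∀ t, dl t t = 0 := by decide

lemma dl_ne : ∀ t a : Fin 3, t ≠ a → dl t a = 1 := by decide

lemma dl_inj : ∀ t a x y : Fin 3, (x = t ∨ x = a) → (y = t ∨ y = a) → dl t x = dl t y → x = y := by
  decide

lemma dl_same : ∀ t a t' a' x y : Fin 3, t ≠ a → t' ≠ a' → (t' = t ∨ t' = a) →
    (a' = t ∨ a' = a) → (x = t ∨ x = a) → (y = t ∨ y = a) →
    dl t' x - dl t' y = dl t x - dl t y := by
  decide

lemma two_sets : ∀ t a t' a' : Fin 3, t ≠ a → t' ≠ a' →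
    ((t' = t ∨ t' = a) ∧ (a' = t ∨ a' = a)) ∨
    ∃ c, ∀ x, ((x = t ∨ x = a) ∧ (x = t' ∨ x = a')) ↔ x = c := by
  decide

lemma mod2_aux : ∀ x y u v c c' u' v' : ZMod 2, u - c + u' - c' = 0 → v - c + v' - c' = 0 →
    x - y + u' - v' = 0 → x - y + u - v = 0 := by decide

lemma mod2_aux' : ∀ x y u v c c' u' v' : ZMod 2, u - c + u' - c' = 0 → v - c + v' - c' = 0 →
    x - y + u - v = 0 → x - y + u' - v' = 0 := by decide

lemma two_meet : ∀ t a t' a' : Fin 3, t ≠ a → t' ≠ a' →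
    ∃ x, (x = t ∨ x = a) ∧ (x = t' ∨ x = a') := by decide

lemma two_third : ∀ t a x z : Fin 3, t ≠ a → t ≠ z → a ≠ z → x ≠ z → (x = t ∨ x = a) := by decide

section
variable {n : ℕ} {C : Ops (Fin 3)} {f : (Fin (n + 1) → Fin 3) → Fin 3}
    {ι : Type} [Fintype ι] [DecidableEq ι] {R : Set (ι → Fin 3)}
    {col : ι → Fin (n + 1) → Fin 3} {t a : ι → Fin 3} {M : Fin 3 → Fin 3 → Fin 3 → Fin 3}

lemma caseB (hM : IsMal M) (hR : MCl M R) (h : Crit C f ι R col t a)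
    (h3 : 3 ≤ Fintype.card ι) (hth : ∀ i x y, Th R i x y → x = y)
    (hT : ∀ i, InvG C (Tprime i) → Preserves f (Tprime i))
    (hA : ∀ i, ¬ ∀ z, PI R i z) (i0 : ι) : False := by
  have hPI : ∀ i x, PI R i x ↔ x = t i ∨ x = a i := by
    intro i x
    obtain ⟨j, hij, -⟩ := Crit.three h3 i i
    have Pt := PI_t h.ha hij
    have Pa := PI_a h.ha i
    have hA := hA i
    push Not at hA
    obtain ⟨z, hz⟩ := hA
    refine ⟨fun hx => ?_, ?_⟩
    · exact two_third _ _ _ z (h.ne_ta i) (fun e => hz (e ▸ Pt)) (fun e => hz (e ▸ Pa))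
        (fun e => hz (e ▸ hx))
    · rintro (rfl | rfl) <;> assumption
  have hne := h.ne_ta
  have hRs := structure2 (δ := fun i => dl (t i)) hM hR h.ht h.ha (Crit.three h3)
    (by
      intro i x y hx hy
      refine ⟨fun e => by rw [hth i x y e], fun e => ?_⟩
      have := dl_inj _ _ _ _ ((hPI i x).1 hx) ((hPI i y).1 hy) e
      subst this
      exact Th.refl hx)
    (fun i => dl_self _) (fun i => dl_ne _ _ (hne i)) i0
  have rep : ∀ (i : ι) (c : ZMod 2), ∃ x, PI R i x ∧ dl (t i) x = c := by
    intro i c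
    rcases zmod2_cases c with rfl | rfl
    · exact ⟨t i, (hPI _ _).2 (Or.inl rfl), dl_self _⟩
    · exact ⟨a i, (hPI _ _).2 (Or.inr rfl), dl_ne _ _ (hne i)⟩
  have hCL : ∀ k, ∀ g ∈ C k, ∀ i j, PresL (PI R) (fun i => dl (t i)) g i j := fun k g hg =>
    presL_all hRs rep (Crit.three h3) g (h.inv k g hg)
  have gPI : ∀ k, ∀ g ∈ C k, ∀ i x, (∀ l, PI R i (x l)) → PI R i (g x) := fun k g hg i x hx =>
    h.inv.pi i k g hg (fun l _ => x l) hx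
  have fPI : ∀ i x, (∀ l, PI R i (x l)) → PI R i (f x) := fun i x hx =>
    h.unary h3 _ (h.inv.pi i) x hx
  -- the diagonal case
  have fii : ∀ i, PresL (PI R) (fun i => dl (t i)) f i i := by
    intro i
    have key : ∀ v : Fin 4 → Fin 3, v ∈ Tprime (-(t i) - a i) ↔ PI R i (v 0) ∧ PI R i (v 1) ∧
        PI R i (v 2) ∧ PI R i (v 3) ∧
        dl (t i) (v 0) - dl (t i) (v 1) + dl (t i) (v 2) - dl (t i) (v 3) = 0 := by
      intro v
      simp only [hPI]
      exact Tprime_iff (t i) (a i) (v 0) (v 1) (v 2) (v 3) (hne i)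
    have inv : InvG C (Tprime (-(t i) - a i)) := by
      intro k g hg v hv
      simp only [key] at hv ⊢
      refine ⟨gPI k g hg i _ fun l => (hv l).1, gPI k g hg i _ fun l => (hv l).2.1,
        gPI k g hg i _ fun l => (hv l).2.2.1, gPI k g hg i _ fun l => (hv l).2.2.2.1, ?_⟩
      exact hCL k g hg i i _ _ _ _ (fun l => (hv l).1) (fun l => (hv l).2.1)
        (fun l => (hv l).2.2.1) (fun l => (hv l).2.2.2.1) (fun l => (hv l).2.2.2.2)
    have hf := hT _ inv
    intro x y z w hx hy hz hw hs
    have := hf (fun l => ![x l, y l, z l, w l])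
      (fun l => (key _).2 ⟨hx l, hy l, hz l, hw l, hs l⟩)
    exact ((key _).1 this).2.2.2.2
  have hL : ∀ i j, PresL (PI R) (fun i => dl (t i)) f i j := by
    intro i j
    rcases two_sets (t i) (a i) (t j) (a j) (hne i) (hne j) with ⟨e1, e2⟩ | ⟨c, hc⟩
    · have hsame : ∀ x y, PI R j x → PI R j y →
          dl (t j) x - dl (t j) y = dl (t i) x - dl (t i) y ∧ PI R i x := by
        intro x y hx hy
        have aux : ∀ x, PI R j x → PI R i x := by
          intro x hx
          rcases (hPI _ _).1 hx with rfl | rfl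
          · exact (hPI _ _).2 e1
          · exact (hPI _ _).2 e2
        exact ⟨dl_same _ _ _ _ _ _ (hne i) (hne j) e1 e2 ((hPI _ _).1 (aux x hx))
          ((hPI _ _).1 (aux y hy)), aux x hx⟩
      intro x y z w hx hy hz hw hs
      have := fii i x y z w hx hy (fun l => (hsame _ _ (hz l) (hz l)).2)
        (fun l => (hsame _ _ (hw l) (hw l)).2) (fun l => by
          have := (hsame _ _ (hz l) (hw l)).1
          linear_combination hs l - this)
      have e := (hsame _ _ (fPI j z hz) (fPI j w hw)).1
      linear_combination this + e
    · have hcm := (hc c).2 rfl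
      have ci := (hPI i c).2 hcm.1
      have cj := (hPI j c).2 hcm.2
      have gc : ∀ k, ∀ g ∈ C k, g (fun _ => c) = c := by
        intro k g hg
        exact (hc _).1 ⟨(hPI _ _).1 (gPI k g hg i _ fun _ => ci),
          (hPI _ _).1 (gPI k g hg j _ fun _ => cj)⟩
      let S : Fin 3 → Fin 3 → Prop := fun x y => PI R i x ∧ PI R j y ∧
        dl (t i) x - dl (t i) c + dl (t j) y - dl (t j) c = 0
      have Sinv : InvG C {v : Fin 2 → Fin 3 | S (v 0) (v 1)} := by
        intro k g hg v hv
        refine ⟨gPI k g hg i _ fun l => (hv l).1, gPI k g hg j _ fun l => (hv l).2.1, ?_⟩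
        have := hCL k g hg i j _ (fun _ => c) _ (fun _ => c) (fun l => (hv l).1) (fun _ => ci)
          (fun l => (hv l).2.1) (fun _ => cj) (fun l => (hv l).2.2)
        simpa only [gc k g hg] using this
      have ex : ∀ y, PI R j y → ∃ x, S x y := by
        intro y hy
        obtain ⟨x, hx, hxe⟩ := rep i (dl (t i) c - dl (t j) y + dl (t j) c)
        exact ⟨x, hx, hy, by rw [hxe]; ring⟩
      intro x y z w hx hy hz hw hs
      choose z' hz' using fun l => ex (z l) (hz l)
      choose w' hw' using fun l => ex (w l) (hw l)
      have s1 := h.binary h3 S Sinv z' z hz'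
      have s2 := h.binary h3 S Sinv w' w hw'
      have := fii i x y z' w' hx hy (fun l => (hz' l).1) (fun l => (hw' l).1)
        (fun l => mod2_aux _ _ _ _ _ _ _ _ (hz' l).2.2 (hw' l).2.2 (hs l))
      exact mod2_aux' _ _ _ _ _ _ _ _ s1.2.2 s2.2.2 this
  choose c hc1 hc2 using fun j => two_meet (t i0) (a i0) (t j) (a j) (hne i0) (hne j)
  obtain ⟨x, hx, hxR⟩ := adjust hRs rep i0 c (fun j => (hPI _ _).2 (hc2 j))
  refine h.finish h3 hRs rep (fun i => dl_self _) hL i0 _ hxR (t i0) (a i0) ?_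
  intro q
  by_cases hq : q = i0
  · subst hq; simpa using (hPI _ _).1 hx
  · simpa [hq] using hc1 q

/-- Three or more coordinates are impossible in the simple case. -/
lemma simple_three (hs : Simp3 C) (hM : IsMal M) (hMC : ∀ {κ : Type} (S : Set (κ → Fin 3)),
      InvG C S → MCl M S) (h : Crit C f ι R col t a) (h3 : 3 ≤ Fintype.card ι)
    (hq : ∀ S ∈ quatList1, InvG C S → Preserves f S) : False := by
  have hc := h.card_ne_zero
  obtain ⟨i0⟩ : Nonempty ι := Fintype.card_pos_iff.1 (by omega)
  by_cases hA : ∃ i, ∀ z, PI R i z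
  · obtain ⟨i, hi⟩ := hA
    exact caseA hs hM hMC h h3 (hq _ (by simp [quatList1])) i hi
  · push Not at hA
    refine caseB hM (hMC R h.inv) h h3 ?_ ?_ (fun i => by push Not; exact hA i) i0
    · intro i x y hxy
      obtain ⟨j, hij, -⟩ := Crit.three h3 i i
      exact th_eq hs hM (hMC R h.inv) h hij hxy
    · intro i
      fin_cases i <;> exact hq _ (by simp [quatList1])

end

/-! ## Binary relations -/

def Pres2 {n : ℕ} (f : (Fin n → Fin 3) → Fin 3) (b : Fin 3 → Fin 3 → Prop) : Prop :=
  ∀ x y : Fin n → Fin 3, (∀ l, b (x l) (y l)) → b (f x) (f y)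

def Inv2 (C : Ops (Fin 3)) (b : Fin 3 → Fin 3 → Prop) : Prop :=
  ∀ n, ∀ g ∈ C n, Pres2 g b

lemma pres2_iff {n : ℕ} {f : (Fin n → Fin 3) → Fin 3} {b : Fin 3 → Fin 3 → Prop} :
    Preserves f {v : Fin 2 → Fin 3 | b (v 0) (v 1)} ↔ Pres2 f b := by
  constructor
  · intro h x y hxy
    exact h (fun l => ![x l, y l]) hxy
  · intro h r hr
    exact h _ _ hr

lemma inv2_iff {C : Ops (Fin 3)} {b : Fin 3 → Fin 3 → Prop} :
    InvG C {v : Fin 2 → Fin 3 | b (v 0) (v 1)} ↔ Inv2 C b := by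
  constructor
  · intro h n g hg
    exact pres2_iff.1 (h n g hg)
  · intro h n g hg
    exact pres2_iff.2 (h n g hg)

lemma Pres2.congr {n : ℕ} {f : (Fin n → Fin 3) → Fin 3} {b b' : Fin 3 → Fin 3 → Prop}
    (h : Pres2 f b) (e : ∀ x y, b x y ↔ b' x y) : Pres2 f b' := by
  have : b = b' := by
    funext x y; exact propext (e x y)
  rwa [← this]

lemma Inv2.congr {C : Ops (Fin 3)} {b b' : Fin 3 → Fin 3 → Prop}
    (h : Inv2 C b) (e : ∀ x y, b x y ↔ b' x y) : Inv2 C b' :=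
  fun n g hg => (h n g hg).congr e

lemma Pres2.flip {n : ℕ} {f : (Fin n → Fin 3) → Fin 3} {b : Fin 3 → Fin 3 → Prop}
    (h : Pres2 f b) : Pres2 f (fun x y => b y x) := fun x y hxy => h y x hxy

lemma Inv2.flip {C : Ops (Fin 3)} {b : Fin 3 → Fin 3 → Prop}
    (h : Inv2 C b) : Inv2 C (fun x y => b y x) := fun n g hg => (h n g hg).flip

lemma Pres2.comp {n : ℕ} {f : (Fin n → Fin 3) → Fin 3} {b b' : Fin 3 → Fin 3 → Prop}
    (h : Pres2 f b) (h' : Pres2 f b') : Pres2 f (fun x y => ∃ z, b x z ∧ b' z y) := by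
  intro x y hxy
  choose z h1 h2 using hxy
  exact ⟨f z, h x z h1, h' z y h2⟩

lemma Inv2.comp {C : Ops (Fin 3)} {b b' : Fin 3 → Fin 3 → Prop}
    (h : Inv2 C b) (h' : Inv2 C b') : Inv2 C (fun x y => ∃ z, b x z ∧ b' z y) :=
  fun n g hg => (h n g hg).comp (h' n g hg)

/-- The binary relations of the simple list. -/
def L1 : Fin 11 → List (Fin 3 × Fin 3) :=
  ![[(0, 1), (1, 2), (2, 0)], [(0, 1), (1, 0), (2, 2)], [(1, 2), (2, 1)], [(0, 2), (2, 0)],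
    [(0, 1), (1, 0)], [(1, 2), (2, 0)], [(0, 1), (2, 0)], [(0, 1), (1, 2)], [(1, 2), (0, 0)],
    [(0, 2), (1, 1)], [(0, 1), (2, 2)]]

lemma L1_mem : ∀ k, {v : Fin 2 → Fin 3 | (v 0, v 1) ∈ L1 k} ∈ binList1 := by
  intro k
  have e : {v : Fin 2 → Fin 3 | (v 0, v 1) ∈ L1 k} =
      ![phi, psi2, psi0', psi1', psi2', phi0', phi1', phi2', phi3', phi4', phi5'] k := by
    ext v
    fin_cases k <;> simp [L1, phi, psi2, psi0', psi1', psi2', phi0', phi1', phi2', phi3', phi4',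
      phi5']
  rw [e]
  fin_cases k <;> simp [binList1]

def ps0 : List (Fin 3 × Fin 3) := [(0, 0), (1, 2), (2, 1)]
def ps1 : List (Fin 3 × Fin 3) := [(1, 1), (0, 2), (2, 0)]

/-- A partial injection with two or three pairs. -/
def PInj (x1 y1 x2 y2 : Fin 3) (b : Bool) (x y : Fin 3) : Bool :=
  (x == x1 && y == y1) || (x == x2 && y == y2) || (b && x == - x1 - x2 && y == - y1 - y2)

set_option maxRecDepth 100000 in
set_option maxHeartbeats 0 in
set_option synthInstance.maxSize 2000 in
set_option synthInstance.maxHeartbeats 0 in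
lemma class1 : ∀ (x1 y1 x2 y2 : Fin 3) (b : Bool), x1 ≠ x2 → y1 ≠ y2 →
    (∃ k, ∀ x y, PInj x1 y1 x2 y2 b x y ↔ (x, y) ∈ L1 k) ∨
    (∃ k, ∀ x y, PInj x1 y1 x2 y2 b y x ↔ (x, y) ∈ L1 k) ∨
    (∀ x y, PInj x1 y1 x2 y2 b x y → x = y) ∨
    (∀ x y, PInj x1 y1 x2 y2 b x y ↔ (x, y) ∈ ps0) ∨
    (∀ x y, PInj x1 y1 x2 y2 b x y ↔ (x, y) ∈ ps1) := by
  decide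

lemma third_eq : ∀ x x1 x2 : Fin 3, x1 ≠ x2 → x ≠ x1 → x ≠ x2 → x = - x1 - x2 := by decide

lemma pinj_of {b : Fin 3 → Fin 3 → Prop} (h1 : ∀ x y y', b x y → b x y' → y = y')
    (h2 : ∀ x x' y, b x y → b x' y → x = x') {x1 y1 x2 y2 : Fin 3} (b1 : b x1 y1) (b2 : b x2 y2)
    (hx : x1 ≠ x2) (hy : y1 ≠ y2) : ∃ β, ∀ x y, b x y ↔ PInj x1 y1 x2 y2 β x y := by
  classical
  refine ⟨decide (b (-x1 - x2) (-y1 - y2)), fun x y => ?_⟩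
  simp only [PInj, Bool.or_eq_true, Bool.and_eq_true, beq_iff_eq, decide_eq_true_eq]
  constructor
  · intro hb
    by_cases e1 : x = x1
    · subst e1; exact Or.inl (Or.inl ⟨rfl, h1 _ _ _ hb b1⟩)
    by_cases e2 : x = x2
    · subst e2; exact Or.inl (Or.inr ⟨rfl, h1 _ _ _ hb b2⟩)
    have e3 := third_eq x x1 x2 hx e1 e2
    have e4 := third_eq y y1 y2 hy (fun e => e1 (h2 _ _ _ hb (e ▸ b1)))
      (fun e => e2 (h2 _ _ _ hb (e ▸ b2)))
    exact Or.inr ⟨⟨by rw [← e3, ← e4]; exact hb, e3⟩, e4⟩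
  · rintro ((⟨rfl, rfl⟩ | ⟨rfl, rfl⟩) | ⟨⟨hb, rfl⟩, rfl⟩) <;> assumption

section
variable {n : ℕ} {C : Ops (Fin 3)} {f : (Fin (n + 1) → Fin 3) → Fin 3}
    {ι : Type} [Fintype ι] [DecidableEq ι] {R : Set (ι → Fin 3)}
    {col : ι → Fin (n + 1) → Fin 3} {t a : ι → Fin 3} {M : Fin 3 → Fin 3 → Fin 3 → Fin 3}

lemma pinj_pres1 (hu : ∀ S : Set (Fin 1 → Fin 3), InvG C S → Preserves f S)
    (hb : ∀ S ∈ binList1, InvG C S → Preserves f S)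
    (hps : Inv2 C (fun x y => (x, y) ∈ ps0) ∨ Inv2 C (fun x y => (x, y) ∈ ps1) →
      Inv2 C (fun x y => (x, y) ∈ L1 1))
    {b : Fin 3 → Fin 3 → Prop} (hi : Inv2 C b) (h1 : ∀ x y y', b x y → b x y' → y = y')
    (h2 : ∀ x x' y, b x y → b x' y → x = x') {x1 y1 x2 y2 : Fin 3} (b1 : b x1 y1) (b2 : b x2 y2)
    (hx : x1 ≠ x2) (hy : y1 ≠ y2) : Pres2 f b := by
  have hk : ∀ k, Inv2 C (fun x y => (x, y) ∈ L1 k) → Pres2 f (fun x y => (x, y) ∈ L1 k) :=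
    fun k h => pres2_iff.1 (hb _ (L1_mem k) (inv2_iff.2 h))
  obtain ⟨β, hβ⟩ := pinj_of h1 h2 b1 b2 hx hy
  rcases class1 x1 y1 x2 y2 β hx hy with ⟨k, h⟩ | ⟨k, h⟩ | h | h | h
  · have e : ∀ x y, b x y ↔ (x, y) ∈ L1 k := fun x y => (hβ x y).trans (h x y)
    exact (hk k (hi.congr e)).congr fun x y => (e x y).symm
  · have e : ∀ x y, b y x ↔ (x, y) ∈ L1 k := fun x y => (hβ y x).trans (h x y)
    exact (hk k (hi.flip.congr e)).flip.congr fun x y => (e y x).symm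
  · have e : ∀ x y, b x y → x = y := fun x y hxy => h x y ((hβ x y).1 hxy)
    have hD : InvG C {v : Fin 1 → Fin 3 | b (v 0) (v 0)} := by
      intro k g hg v hv
      exact hi k g hg _ _ hv
    intro x y hxy
    have : x = y := funext fun l => e _ _ (hxy l)
    subst this
    exact hu _ hD (fun l _ => x l) hxy
  · have e : ∀ x y, b x y ↔ (x, y) ∈ ps0 := fun x y => (hβ x y).trans (h x y)
    have i0 := hi.congr e
    have i2 := hps (Or.inl i0)
    have i3 : Inv2 C (fun x y => (x, y) ∈ L1 0) := (i0.comp i2).congr (by decide)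
    exact ((hk 0 i3).comp (hk 1 i2)).congr fun x y => Iff.trans (by revert x y; decide) (e x y).symm
  · have e : ∀ x y, b x y ↔ (x, y) ∈ ps1 := fun x y => (hβ x y).trans (h x y)
    have i0 := hi.congr e
    have i2 := hps (Or.inr i0)
    have i3 : Inv2 C (fun x y => (x, y) ∈ L1 0) := (i2.comp i0).congr (by decide)
    exact ((hk 1 i2).comp (hk 0 i3)).congr fun x y => Iff.trans (by revert x y; decide) (e x y).symm

lemma Crit.pair (h2 : Fintype.card ι = 2) : ∃ i j : ι, i ≠ j ∧ ∀ q, q = i ∨ q = j := by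
  obtain ⟨i, j, hij, he⟩ := Finset.card_eq_two.1 (Finset.card_univ.trans h2)
  refine ⟨i, j, hij, fun q => ?_⟩
  have := Finset.mem_univ q
  rw [he] at this
  simpa using this

lemma simple_two (hs : Simp3 C) (hM : IsMal M) (hR : MCl M R) (h : Crit C f ι R col t a)
    (h2 : Fintype.card ι = 2) (hu : ∀ S : Set (Fin 1 → Fin 3), InvG C S → Preserves f S)
    (hb : ∀ S ∈ binList1, InvG C S → Preserves f S)
    (hps : Inv2 C (fun x y => (x, y) ∈ ps0) ∨ Inv2 C (fun x y => (x, y) ∈ ps1) →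
      Inv2 C (fun x y => (x, y) ∈ L1 1)) : False := by
  obtain ⟨i, j, hij, hall⟩ := Crit.pair h2
  refine h.bin_false h2 hij ?_
  let b : Fin 3 → Fin 3 → Prop := fun x y => ∃ r ∈ R, r i = x ∧ r j = y
  have hi : Inv2 C b := inv2_iff.1 (h.inv.bin i j)
  refine (pres2_iff (b := b)).2 (pinj_pres1 hu hb hps hi ?_ ?_ (x1 := a i) (y1 := t j) (x2 := t i)
    (y2 := a j) ⟨_, h.ha i, by simp, by simp [hij.symm]⟩ ⟨_, h.ha j, by simp [hij], by simp⟩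
    (h.ne_ta i).symm (h.ne_ta j))
  · rintro x y y' ⟨r, hr, r1, r2⟩ ⟨s, hs', s1, s2⟩
    have := Th.mk2 (i := j) hr hs' (fun q hq => by rw [(hall q).resolve_right hq, r1, s1])
    rw [r2, s2] at this
    exact th_eq hs hM hR h hij.symm this
  · rintro x x' y ⟨r, hr, r1, r2⟩ ⟨s, hs', s1, s2⟩
    have := Th.mk2 (i := i) hr hs' (fun q hq => by rw [(hall q).resolve_left hq, r2, s2])
    rw [r1, s1] at this
    exact th_eq hs hM hR h hij this

/-- The simple case. -/
lemma simple_main (hs : Simp3 C) (hM : IsMal M) (hMC : ∀ {κ : Type} (S : Set (κ → Fin 3)),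
      InvG C S → MCl M S) (h : Crit C f ι R col t a)
    (hu : ∀ S : Set (Fin 1 → Fin 3), InvG C S → Preserves f S)
    (hb : ∀ S ∈ binList1, InvG C S → Preserves f S)
    (hq : ∀ S ∈ quatList1, InvG C S → Preserves f S)
    (hps : Inv2 C (fun x y => (x, y) ∈ ps0) ∨ Inv2 C (fun x y => (x, y) ∈ ps1) →
      Inv2 C (fun x y => (x, y) ∈ L1 1)) : False := by
  have c0 := h.card_ne_zero
  have c1 := h.card_ne_one hu
  by_cases c2 : Fintype.card ι = 2
  · exact simple_two hs hM (hMC R h.inv) h c2 hu hb hps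
  · exact simple_three hs hM hMC h (by omega) hq

end

/-! ## The case of an invariant equivalence relation: two coordinates -/

lemma mu_iff : ∀ x y : Fin 3, (x, y) ∈ ({(0, 0), (1, 1), (2, 2), (0, 1), (1, 0)} :
    Set (Fin 3 × Fin 3)) ↔ qmap x = qmap y := by
  intro x y
  simp only [Set.mem_insert_iff, Set.mem_singleton_iff]
  revert x y
  decide

lemma mu2_eq : mu2 = {v : Fin 2 → Fin 3 | qmap (v 0) = qmap (v 1)} := by
  ext v
  exact mu_iff _ _

lemma qmap_two : ∀ x : Fin 3, qmap x = qmap 2 → x = 2 := by decide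

lemma q_not2 : ∀ x y : Fin 3, x ≠ 2 → y ≠ 2 → qmap x = qmap y := by decide

/-- `M` is compatible with `μ₂`. -/
def MMu (M : Fin 3 → Fin 3 → Fin 3 → Fin 3) : Prop :=
  ∀ x y z x' y' z', qmap x = qmap x' → qmap y = qmap y' → qmap z = qmap z' →
    qmap (M x y z) = qmap (M x' y' z')

section
variable {M : Fin 3 → Fin 3 → Fin 3 → Fin 3}

lemma MMu.left (hM : IsMal M) (h : MMu M) {x y : Fin 3} (hx : x ≠ 2) (hy : y ≠ 2) :
    M 2 x y = 2 :=
  qmap_two _ ((h 2 x y 2 y y rfl (q_not2 _ _ hx hy) rfl).trans (by rw [(hM _ _).1]))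

lemma MMu.right (hM : IsMal M) (h : MMu M) {x y : Fin 3} (hx : x ≠ 2) (hy : y ≠ 2) :
    M x y 2 = 2 :=
  qmap_two _ ((h x y 2 y y 2 (q_not2 _ _ hx hy) rfl rfl).trans (by rw [(hM _ _).2]))

lemma eqv_cases (hM : IsMal M) (h : MMu M) {e : Fin 3 → Fin 3 → Prop} (he : Equivalence e)
    (hc : ∀ x y z x' y' z', e x x' → e y y' → e z z' → e (M x y z) (M x' y' z')) :
    (∀ x y, e x y) ∨ (∀ x y, e x y ↔ qmap x = qmap y) ∨ (∀ x y, e x y ↔ x = y) := by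
  have key : ∀ x y, x ≠ 2 → y ≠ 2 → x ≠ y → e x 2 → e y 2 := by
    intro x y hx hy _ hxe
    have := hc y x 2 y x x (he.refl _) (he.refl _) (he.symm hxe)
    rw [h.right hM hy hx, (hM _ _).1] at this
    exact he.symm this
  have full : e 0 2 → e 1 2 → ∀ x y, e x y := by
    intro h0 h1
    have : ∀ x, e x 2 := by
      intro x; fin_cases x
      exacts [h0, h1, he.refl _]
    exact fun x y => he.trans (this x) (he.symm (this y))
  by_cases h0 : e 0 2
  · exact Or.inl (full h0 (key 0 1 (by decide) (by decide) (by decide) h0))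
  by_cases h1 : e 1 2
  · exact Or.inl (full (key 1 0 (by decide) (by decide) (by decide) h1) h1)
  have h0' : ¬ e 2 0 := fun e => h0 (he.symm e)
  have h1' : ¬ e 2 1 := fun e => h1 (he.symm e)
  by_cases h2 : e 0 1
  · right; left
    have h2' := he.symm h2
    intro x y
    fin_cases x <;> fin_cases y <;> simp [h0, h1, h2, h0', h1', h2', he.refl, qmap]
  · right; right
    have h2' : ¬ e 1 0 := fun e => h2 (he.symm e)
    intro x y
    fin_cases x <;> fin_cases y <;> simp [h0, h1, h2, h0', h1', h2', he.refl]

end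

section
variable {n : ℕ} {C : Ops (Fin 3)} {f : (Fin (n + 1) → Fin 3) → Fin 3}
    {ι : Type} [Fintype ι] [DecidableEq ι] {R : Set (ι → Fin 3)}
    {col : ι → Fin (n + 1) → Fin 3} {t a : ι → Fin 3} {M : Fin 3 → Fin 3 → Fin 3 → Fin 3}

lemma MMu_of (hMC : ∀ {κ : Type} (S : Set (κ → Fin 3)), InvG C S → MCl M S)
    (hmu : Inv2 C (fun x y => qmap x = qmap y)) : MMu M := by
  intro x y z x' y' z' h1 h2 h3
  exact hMC _ (inv2_iff.2 hmu) ![x, x'] h1 ![y, y'] h2 ![z, z'] h3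

lemma aux01 : ∀ t a x : Fin 3, t ≠ a → x ≠ 2 → (qmap x = qmap t ∨ qmap x = qmap a) := by decide

lemma aux_mu_eq : ∀ x y z : Fin 3, z ≠ 2 → x ≠ z → y ≠ z → qmap x = qmap y → x = y := by decide

/-- All projections contain `0` and `1`. -/
lemma PI01 (hmu : Inv2 C (fun x y => qmap x = qmap y)) (h : Crit C f ι R col t a)
    {i j : ι} (hij : i ≠ j) {x : Fin 3} (hx : x ≠ 2) : PI R i x := by
  by_contra hx'
  have Pt := PI_t h.ha hij
  have Pa := PI_a h.ha i
  let R' : Set (ι → Fin 3) := {r | ∃ s ∈ R, (∀ q, q ≠ i → r q = s q) ∧ qmap (r i) = qmap (s i)}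
  have inv : InvG C R' := by
    intro k g hg r hr
    choose s hs h1 h2 using hr
    refine ⟨_, h.inv k g hg s hs, fun q hq => ?_, hmu k g hg _ _ h2⟩
    simp only [h1 _ q hq]
  have sub := h.max R' inv (fun r hr => ⟨r, hr, fun _ _ => rfl, rfl⟩) (by
    rintro ⟨s, hs, h1, h2⟩
    have : t i = s i := aux_mu_eq _ _ x hx (fun e => hx' (e ▸ Pt))
      (fun e => hx' ⟨s, hs, e⟩) h2
    apply h.ht
    convert hs
    funext q
    by_cases hq : q = i
    · subst hq; exact this
    · exact h1 q hq)
  rcases aux01 (t i) (a i) x (h.ne_ta i) hx with e | e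
  · obtain ⟨r, hr, hri⟩ := Pt
    exact hx' ⟨_, sub (show update r i x ∈ R' from ⟨r, hr, fun q hq => by simp [hq],
      by simp [hri, e]⟩), by simp⟩
  · obtain ⟨r, hr, hri⟩ := Pa
    exact hx' ⟨_, sub (show update r i x ∈ R' from ⟨r, hr, fun q hq => by simp [hq],
      by simp [hri, e]⟩), by simp⟩

/-- The three types of coordinates. -/
lemma types (hM : IsMal M) (hmm : MMu M) (hmu : Inv2 C (fun x y => qmap x = qmap y))
    (hR : MCl M R) (h : Crit C f ι R col t a) {i j : ι} (hij : i ≠ j) :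
    ((∀ x, PI R i x ↔ x ≠ 2) ∧ ∀ x y, Th R i x y → x = y) ∨
    ((∀ x, PI R i x) ∧ ∀ x y, Th R i x y ↔ qmap x = qmap y) ∨
    ((∀ x, PI R i x) ∧ ∀ x y, Th R i x y ↔ x = y) := by
  have nt := not_th hM hR h.ht h.ha i
  have hne := h.ne_ta i
  have Pt := PI_t h.ha hij
  have Pa := PI_a h.ha i
  by_cases h2 : PI R i 2
  · right
    have hA : ∀ x, PI R i x := by
      intro x
      by_cases hx : x = 2
      · rwa [hx]
      · exact PI01 hmu h hij hx
    rcases eqv_cases hM hmm (e := Th R i) ⟨fun z => Th.refl (hA z), Th.symm,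
      fun h1 h2 => Th.trans hM hR h1 h2⟩ (fun x y z x' y' z' => Th.mal hR) with e | e | e
    · exact absurd (e _ _) nt
    · exact Or.inl ⟨hA, e⟩
    · exact Or.inr ⟨hA, e⟩
  · left
    have hP : ∀ x, PI R i x ↔ x ≠ 2 :=
      fun x => ⟨fun hx e => h2 (e ▸ hx), fun hx => PI01 hmu h hij hx⟩
    refine ⟨hP, fun x y hxy => ?_⟩
    by_contra hne'
    have hx := (hP _).1 hxy.left
    have hy := (hP _).1 hxy.right
    have ht := (hP _).1 Pt
    have ha := (hP _).1 Pa
    have : (x = t i ∧ y = a i) ∨ (x = a i ∧ y = t i) := by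
      revert hne hne' hx hy ht ha
      generalize t i = p
      generalize a i = q
      clear hxy hP
      revert x y p q
      decide
    rcases this with ⟨rfl, rfl⟩ | ⟨rfl, rfl⟩
    · exact nt hxy
    · exact nt hxy.symm

end

/-- The binary relations of the second list. -/
def L2 : Fin 6 → List (Fin 3 × Fin 3) :=
  ![[(0, 0), (1, 1), (2, 2), (0, 1), (1, 0)], [(0, 2), (1, 2), (2, 0), (2, 1)],
    [(0, 0), (1, 0), (2, 1)], [(0, 1), (1, 1), (2, 0)], [(0, 1), (1, 0), (2, 2)],
    [(0, 1), (1, 0)]]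

lemma L2_mem : ∀ k, {v : Fin 2 → Fin 3 | (v 0, v 1) ∈ L2 k} ∈ binList2 := by
  intro k
  have e : {v : Fin 2 → Fin 3 | (v 0, v 1) ∈ L2 k} =
      ![mu2, rho2, tau0, tau1, psi2, psi2'] k := by
    ext v
    fin_cases k <;> simp [L2, mu2, rho2, tau0, tau1, psi2, psi2']
  rw [e]
  fin_cases k <;> simp [binList2]

def mat (b00 b01 b02 b10 b11 b12 b20 b21 b22 : Bool) (x y : Fin 3) : Bool :=
  ![![b00, b01, b02], ![b10, b11, b12], ![b20, b21, b22]] x y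

/-- What we know about a critical binary relation. -/
abbrev Good2 (b : Fin 3 → Fin 3 → Bool) : Prop :=
  (∀ x y y', b x y → b x y' → qmap y = qmap y' ∧ ((∀ z, ¬ b z 2) → y = y')) ∧
  (∀ x x' y, b x y → b x' y → qmap x = qmap x' ∧ ((∀ z, ¬ b 2 z) → x = x')) ∧
  (∀ x, x ≠ 2 → ∃ y, b x y) ∧ (∀ y, y ≠ 2 → ∃ x, b x y) ∧
  (∀ x y x' y', b x y → b x' y → b x' y' → b x y') ∧
  (∀ q s, b 0 2 → b 1 q → b 2 s → q ≠ 2 → s ≠ 2 → b 2 2) ∧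
  (∀ q s, b 1 2 → b 0 q → b 2 s → q ≠ 2 → s ≠ 2 → b 2 2)

set_option maxRecDepth 100000 in
set_option maxHeartbeats 0 in
set_option synthInstance.maxSize 2000 in
set_option synthInstance.maxHeartbeats 0 in
lemma class2 : ∀ b00 b01 b02 b10 b11 b12 b20 b21 b22 : Bool,
    Good2 (mat b00 b01 b02 b10 b11 b12 b20 b21 b22) →
    (∃ k, ∀ x y, mat b00 b01 b02 b10 b11 b12 b20 b21 b22 x y ↔ (x, y) ∈ L2 k) ∨
    (∃ k, ∀ x y, mat b00 b01 b02 b10 b11 b12 b20 b21 b22 y x ↔ (x, y) ∈ L2 k) ∨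
    (∀ x y, mat b00 b01 b02 b10 b11 b12 b20 b21 b22 x y → x = y) := by
  decide

section
variable {n : ℕ} {C : Ops (Fin 3)} {f : (Fin (n + 1) → Fin 3) → Fin 3}
    {ι : Type} [Fintype ι] [DecidableEq ι] {R : Set (ι → Fin 3)}
    {col : ι → Fin (n + 1) → Fin 3} {t a : ι → Fin 3} {M : Fin 3 → Fin 3 → Fin 3 → Fin 3}

lemma mat_self (b : Fin 3 → Fin 3 → Bool) :
    mat (b 0 0) (b 0 1) (b 0 2) (b 1 0) (b 1 1) (b 1 2) (b 2 0) (b 2 1) (b 2 2) = b := by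
  funext x y
  fin_cases x <;> fin_cases y <;> rfl

lemma good2_pres (hu : ∀ S : Set (Fin 1 → Fin 3), InvG C S → Preserves f S)
    (hb : ∀ S ∈ binList2, InvG C S → Preserves f S)
    {b : Fin 3 → Fin 3 → Bool} (hi : Inv2 C (fun x y => b x y)) (hg : Good2 b) :
    Pres2 f (fun x y => b x y) := by
  have hk : ∀ k, Inv2 C (fun x y => (x, y) ∈ L2 k) → Pres2 f (fun x y => (x, y) ∈ L2 k) :=
    fun k h => pres2_iff.1 (hb _ (L2_mem k) (inv2_iff.2 h))
  have hcl := class2 (b 0 0) (b 0 1) (b 0 2) (b 1 0) (b 1 1) (b 1 2) (b 2 0) (b 2 1) (b 2 2)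
  rw [mat_self] at hcl
  rcases hcl hg with ⟨k, e⟩ | ⟨k, e⟩ | e
  · exact (hk k (hi.congr e)).congr fun x y => (e x y).symm
  · exact (hk k (hi.flip.congr e)).flip.congr fun x y => (e y x).symm
  · have hD : InvG C {v : Fin 1 → Fin 3 | b (v 0) (v 0)} := by
      intro k g hg v hv
      exact hi k g hg _ _ hv
    intro x y hxy
    have : x = y := funext fun l => e _ _ (hxy l)
    subst this
    exact hu _ hD (fun l _ => x l) hxy

lemma mu_two (hM : IsMal M) (hmm : MMu M) (hmu : Inv2 C (fun x y => qmap x = qmap y))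
    (hR : MCl M R) (h : Crit C f ι R col t a)
    (h2 : Fintype.card ι = 2) (hu : ∀ S : Set (Fin 1 → Fin 3), InvG C S → Preserves f S)
    (hb : ∀ S ∈ binList2, InvG C S → Preserves f S) : False := by
  classical
  obtain ⟨i, j, hij, hall⟩ := Crit.pair h2
  refine h.bin_false h2 hij ?_
  let b : Fin 3 → Fin 3 → Prop := fun x y => ∃ r ∈ R, r i = x ∧ r j = y
  have hi : Inv2 C b := inv2_iff.1 (h.inv.bin i j)
  let bb : Fin 3 → Fin 3 → Bool := fun x y => decide (b x y)
  have hbb : ∀ x y, bb x y ↔ b x y := fun x y => by simp [bb]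
  have thi : ∀ {i j : ι}, i ≠ j → ∀ x y, Th R i x y → qmap x = qmap y ∧ (¬ PI R i 2 → x = y) := by
    intro i j hij x y hxy
    rcases types hM hmm hmu hR h hij with ⟨_, e⟩ | ⟨e1, e⟩ | ⟨_, e⟩
    · have := e _ _ hxy; exact ⟨by rw [this], fun _ => this⟩
    · exact ⟨(e _ _).1 hxy, fun e' => absurd (e1 2) e'⟩
    · have := (e _ _).1 hxy; exact ⟨by rw [this], fun _ => this⟩
  refine (pres2_iff (b := b)).2 ((good2_pres hu hb (b := bb) (hi.congr fun x y => (hbb x y).symm)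
    ?_).congr hbb)
  unfold Good2
  simp only [hbb]
  have bM : ∀ {x y x' y' x'' y''}, b x y → b x' y' → b x'' y'' →
      b (M x x' x'') (M y y' y'') := by
    rintro x y x' y' x'' y'' ⟨r, hr, rfl, rfl⟩ ⟨s, hs, rfl, rfl⟩ ⟨u, hu, rfl, rfl⟩
    exact ⟨_, hR r hr s hs u hu, rfl, rfl⟩
  refine ⟨?_, ?_, ?_, ?_, ?_, ?_, ?_⟩
  · rintro x y y' ⟨r, hr, r1, r2⟩ ⟨s, hs', s1, s2⟩
    have := Th.mk2 (i := j) hr hs' (fun q hq => by rw [(hall q).resolve_right hq, r1, s1])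
    rw [r2, s2] at this
    obtain ⟨e1, e2⟩ := thi hij.symm _ _ this
    refine ⟨e1, fun hz => e2 ?_⟩
    rintro ⟨r, hr, e⟩
    exact hz (r i) ⟨r, hr, rfl, e⟩
  · rintro x x' y ⟨r, hr, r1, r2⟩ ⟨s, hs', s1, s2⟩
    have := Th.mk2 (i := i) hr hs' (fun q hq => by rw [(hall q).resolve_left hq, r2, s2])
    rw [r1, s1] at this
    obtain ⟨e1, e2⟩ := thi hij _ _ this
    refine ⟨e1, fun hz => e2 ?_⟩
    rintro ⟨r, hr, e⟩
    exact hz (r j) ⟨r, hr, e, rfl⟩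
  · intro x hx
    obtain ⟨r, hr, e⟩ := PI01 hmu h hij hx
    exact ⟨r j, r, hr, e, rfl⟩
  · intro x hx
    obtain ⟨r, hr, e⟩ := PI01 hmu h hij.symm hx
    exact ⟨r i, r, hr, rfl, e⟩
  · intro x y x' y' h1 h2 h3
    have := bM h1 h2 h3
    rwa [(hM _ _).1, (hM _ _).2] at this
  · intro q s h1 h2 h3 hq hs
    have := bM h1 h2 h3
    rwa [hmm.right hM (by decide) (by decide), hmm.left hM hq hs] at this
  · intro q s h1 h2 h3 hq hs
    have := bM h1 h2 h3
    rwa [hmm.right hM (by decide) (by decide), hmm.left hM hq hs] at this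

end

/-! ## The case of an invariant equivalence relation: two-class coordinates -/

def dq (t x : Fin 3) : ZMod 2 := if qmap x = qmap t then 0 else 1

lemma dq_self : ∀ t, dq t t = 0 := by decide
lemma dq_one : ∀ t a, qmap t ≠ qmap a → dq t a = 1 := by decide
lemma dq_eq : ∀ t x y, dq t x = dq t y ↔ qmap x = qmap y := by decide
lemma dq_diff : ∀ t x y, dq t x - dq t y = dq 0 x - dq 0 y := by decide
lemma dl_diff : ∀ t x y : Fin 3, t ≠ 2 → x ≠ 2 → y ≠ 2 → dl t x - dl t y = dl 0 x - dl 0 y := by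
  decide
lemma dl_inj2 : ∀ t x y : Fin 3, t ≠ 2 → x ≠ 2 → y ≠ 2 → dl t x = dl t y → x = y := by decide
lemma dq_zero : ∀ x : Fin 3, x ≠ 2 → dq 0 x = 0 := by decide

lemma Tprime2_iff : ∀ x y z w : Fin 3, (x ≠ 2 ∧ y ≠ 2 ∧ z ≠ 2 ∧ w = mino x y z) ↔
    (x ≠ 2 ∧ y ≠ 2 ∧ z ≠ 2 ∧ w ≠ 2 ∧ dl 0 x - dl 0 y + dl 0 z - dl 0 w = 0) := by decide

lemma Tmu2_iff : ∀ x y z w : Fin 3, (qmap w = qmap x + qmap y + qmap z) ↔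
    dq 0 x - dq 0 y + dq 0 z - dq 0 w = 0 := by decide

lemma S01_iff : ∀ v : Fin 3 → Fin 3, v ∈ S01 ↔
    (v 0 ≠ 2 ∧ v 1 ≠ 2 ∧ dl 0 (v 0) - dl 0 (v 1) + dq 0 (v 2) = 0) := by
  intro v
  simp only [S01, Set.mem_insert_iff, Set.mem_singleton_iff, Set.mem_ofPred_eq]
  generalize v 0 = x
  generalize v 1 = y
  generalize v 2 = z
  revert x y z
  decide

lemma mod2_S : ∀ x y z w u : ZMod 2, x - y + z - w = 0 → x - y + u = 0 → z - w + u - 0 = 0 := by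
  decide

lemma mod2_S' : ∀ x y z w u : ZMod 2, x - y + u = 0 → z - w + u - 0 = 0 → x - y + z - w = 0 := by
  decide

section
variable {n : ℕ} {C : Ops (Fin 3)} {f : (Fin (n + 1) → Fin 3) → Fin 3}
    {ι : Type} [Fintype ι] [DecidableEq ι] {R : Set (ι → Fin 3)}
    {col : ι → Fin (n + 1) → Fin 3} {t a : ι → Fin 3} {M : Fin 3 → Fin 3 → Fin 3 → Fin 3}

lemma caseAC (hM : IsMal M) (hR : MCl M R) (h : Crit C f ι R col t a)
    (h3 : 3 ≤ Fintype.card ι)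
    (ty : ∀ i, ((∀ x, PI R i x ↔ x ≠ 2) ∧ ∀ x y, Th R i x y → x = y) ∨
      ((∀ x, PI R i x) ∧ ∀ x y, Th R i x y ↔ qmap x = qmap y))
    (hT : InvG C (Tprime 2) → Preserves f (Tprime 2))
    (hTmu : InvG C Tmu2 → Preserves f Tmu2)
    (hS : InvG C S01 → Preserves f S01) (i0 : ι) : False := by
  classical
  have hne := h.ne_ta
  have Pt : ∀ i, PI R i (t i) := fun i => by
    obtain ⟨j, hij, -⟩ := Crit.three h3 i i
    exact PI_t h.ha hij
  have Pa := PI_a h.ha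
  let δ : ι → Fin 3 → ZMod 2 := fun i => if PI R i 2 then dq (t i) else dl (t i)
  have δc : ∀ i, PI R i 2 → δ i = dq (t i) := fun i hi => if_pos hi
  have δa : ∀ i, ¬ PI R i 2 → δ i = dl (t i) := fun i hi => if_neg hi
  have tc : ∀ i, PI R i 2 → (∀ x, PI R i x) ∧ ∀ x y, Th R i x y ↔ qmap x = qmap y := by
    intro i hi
    rcases ty i with h | h
    · exact absurd rfl ((h.1 2).1 hi)
    · exact h
  have ta : ∀ i, ¬ PI R i 2 → (∀ x, PI R i x ↔ x ≠ 2) ∧ ∀ x y, Th R i x y → x = y := by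
    intro i hi
    rcases ty i with h | h
    · exact h
    · exact absurd (h.1 2) hi
  have δt : ∀ i, δ i (t i) = 0 := by
    intro i
    by_cases hi : PI R i 2
    · rw [δc i hi]; exact dq_self _
    · rw [δa i hi]; exact dl_self _
  have δa1 : ∀ i, δ i (a i) = 1 := by
    intro i
    by_cases hi : PI R i 2
    · rw [δc i hi]
      exact dq_one _ _ fun e => not_th hM hR h.ht h.ha i (((tc i hi).2 _ _).2 e)
    · rw [δa i hi]; exact dl_ne _ _ (hne i)
  have hRs := structure2 (δ := δ) hM hR h.ht h.ha (Crit.three h3)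
    (by
      intro i x y hx hy
      by_cases hi : PI R i 2
      · rw [δc i hi, dq_eq]; exact (tc i hi).2 x y
      · rw [δa i hi]
        have hP := (ta i hi).1
        refine ⟨fun e => by rw [(ta i hi).2 x y e], fun e => ?_⟩
        have := dl_inj2 _ _ _ ((hP _).1 (Pt i)) ((hP _).1 hx) ((hP _).1 hy) e
        subst this
        exact Th.refl hx)
    δt δa1 i0
  have rep : ∀ (i : ι) (c : ZMod 2), ∃ x, PI R i x ∧ δ i x = c := by
    intro i c
    rcases zmod2_cases c with rfl | rfl
    · exact ⟨t i, Pt i, δt i⟩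
    · exact ⟨a i, Pa i, δa1 i⟩
  have hCL : ∀ k, ∀ g ∈ C k, ∀ i j, PresL (PI R) δ g i j := fun k g hg =>
    presL_all hRs rep (Crit.three h3) g (h.inv k g hg)
  have gPI : ∀ k, ∀ g ∈ C k, ∀ i x, (∀ l, PI R i (x l)) → PI R i (g x) := fun k g hg i x hx =>
    h.inv.pi i k g hg (fun l _ => x l) hx
  have fPI : ∀ i x, (∀ l, PI R i (x l)) → PI R i (f x) := fun i x hx =>
    h.unary h3 _ (h.inv.pi i) x hx
  -- differences do not depend on the base point
  have dfc : ∀ i, PI R i 2 → ∀ x y, δ i x - δ i y = dq 0 x - dq 0 y := by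
    intro i hi x y
    rw [δc i hi]; exact dq_diff _ _ _
  have dfa : ∀ i, ¬ PI R i 2 → ∀ x y, PI R i x → PI R i y → δ i x - δ i y = dl 0 x - dl 0 y := by
    intro i hi x y hx hy
    have hP := (ta i hi).1
    rw [δa i hi]; exact dl_diff _ _ _ ((hP _).1 (Pt i)) ((hP _).1 hx) ((hP _).1 hy)
  have swap : ∀ i j, PresL (PI R) δ f i j → PresL (PI R) δ f j i := by
    intro i j hL x y z w hx hy hz hw hs
    have := hL z w x y hz hw hx hy (fun l => by linear_combination hs l)
    linear_combination this
  -- consequences of invariance of `Tprime 2`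
  have faa : ∀ i j, ¬ PI R i 2 → ¬ PI R j 2 → PresL (PI R) δ f i j := by
    intro i j hi hj
    have hPi := (ta i hi).1
    have hPj := (ta j hj).1
    have inv : InvG C (Tprime 2) := by
      intro k g hg v hv
      have hv' := fun l => (Tprime2_iff _ _ _ _).1 (hv l)
      have q0 := fun l => (hPi _).2 (hv' l).1
      have q1 := fun l => (hPi _).2 (hv' l).2.1
      have q2 := fun l => (hPi _).2 (hv' l).2.2.1
      have q3 := fun l => (hPi _).2 (hv' l).2.2.2.1
      have g0 := gPI k g hg i _ q0
      have g1 := gPI k g hg i _ q1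
      have g2 := gPI k g hg i _ q2
      have g3 := gPI k g hg i _ q3
      refine (Tprime2_iff _ _ _ _).2 ⟨(hPi _).1 g0, (hPi _).1 g1, (hPi _).1 g2, (hPi _).1 g3, ?_⟩
      have := hCL k g hg i i _ _ _ _ q0 q1 q2 q3 (fun l => by
        have e1 := dfa i hi _ _ (q0 l) (q1 l)
        have e2 := dfa i hi _ _ (q2 l) (q3 l)
        linear_combination (hv' l).2.2.2.2 + e1 + e2)
      have e1 := dfa i hi _ _ g0 g1
      have e2 := dfa i hi _ _ g2 g3
      linear_combination this - e1 - e2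
    intro x y z w hx hy hz hw hs
    have := hT inv (fun l => ![x l, y l, z l, w l]) (fun l => (Tprime2_iff _ _ _ _).2
      ⟨(hPi _).1 (hx l), (hPi _).1 (hy l), (hPj _).1 (hz l), (hPj _).1 (hw l), by
        have e1 := dfa i hi _ _ (hx l) (hy l)
        have e2 := dfa j hj _ _ (hz l) (hw l)
        simp
        linear_combination hs l - e1 - e2⟩)
    have := ((Tprime2_iff _ _ _ _).1 this).2.2.2.2
    have e1 := dfa i hi _ _ (fPI i x hx) (fPI i y hy)
    have e2 := dfa j hj _ _ (fPI j z hz) (fPI j w hw)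
    simp at this
    linear_combination this + e1 + e2
  have fmu : ∀ i, PI R i 2 → ∀ x y z w : Fin (n + 1) → Fin 3,
      (∀ l, dq 0 (x l) - dq 0 (y l) + dq 0 (z l) - dq 0 (w l) = 0) →
      dq 0 (f x) - dq 0 (f y) + dq 0 (f z) - dq 0 (f w) = 0 := by
    intro i hi
    have hP := (tc i hi).1
    have inv : InvG C Tmu2 := by
      intro k g hg v hv
      have hv' := fun l => (Tmu2_iff _ _ _ _).1 (hv l)
      refine (Tmu2_iff _ _ _ _).2 ?_
      have := hCL k g hg i i (fun l => v l 0) (fun l => v l 1) (fun l => v l 2) (fun l => v l 3)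
        (fun _ => hP _) (fun _ => hP _) (fun _ => hP _) (fun _ => hP _) (fun l => by
        have e1 := dfc i hi (v l 0) (v l 1)
        have e2 := dfc i hi (v l 2) (v l 3)
        linear_combination hv' l + e1 + e2)
      have e1 := dfc i hi (g fun l => v l 0) (g fun l => v l 1)
      have e2 := dfc i hi (g fun l => v l 2) (g fun l => v l 3)
      linear_combination this - e1 - e2
    intro x y z w hs
    have := hTmu inv (fun l => ![x l, y l, z l, w l]) (fun l => (Tmu2_iff _ _ _ _).2 (hs l))
    exact (Tmu2_iff _ _ _ _).1 this
  have fcc : ∀ i j, PI R i 2 → PI R j 2 → PresL (PI R) δ f i j := by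
    intro i j hi hj x y z w hx hy hz hw hs
    have := fmu i hi x y z w (fun l => by
      have e1 := dfc i hi (x l) (y l)
      have e2 := dfc j hj (z l) (w l)
      linear_combination hs l - e1 - e2)
    have e1 := dfc i hi (f x) (f y)
    have e2 := dfc j hj (f z) (f w)
    linear_combination this + e1 + e2
  have fac : ∀ i j, ¬ PI R i 2 → PI R j 2 → PresL (PI R) δ f i j := by
    intro i j hi hj
    have hPi := (ta i hi).1
    have hPj := (tc j hj).1
    have hz0 : PI R i 0 := (hPi 0).2 (by decide)
    have inv : InvG C S01 := by
      intro k g hg v hv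
      simp only [S01_iff] at hv ⊢
      have q0 := fun l => (hPi _).2 (hv l).1
      have q1 := fun l => (hPi _).2 (hv l).2.1
      have g0 := gPI k g hg i _ q0
      have g1 := gPI k g hg i _ q1
      refine ⟨(hPi _).1 g0, (hPi _).1 g1, ?_⟩
      have gz := dq_zero _ ((hPi _).1 (gPI k g hg i (fun _ => 0) (fun _ => hz0)))
      have d0 : dq 0 0 = 0 := dq_zero _ (by decide)
      have := hCL k g hg i j _ _ (fun l => v l 2) (fun _ => 0) q0 q1 (fun _ => hPj _)
        (fun _ => hPj _) (fun l => by
        have e1 := dfa i hi _ _ (q0 l) (q1 l)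
        have e2 := dfc j hj (v l 2) 0
        linear_combination (hv l).2.2 + e1 + e2 - d0)
      have e1 := dfa i hi _ _ g0 g1
      have e2 := dfc j hj (g fun l => v l 2) (g fun _ => 0)
      linear_combination this - e1 - e2 + gz
    intro x y z w hx hy hz hw hs
    have hs' : ∀ l, dl 0 (x l) - dl 0 (y l) + dq 0 (z l) - dq 0 (w l) = 0 := fun l => by
      have e1 := dfa i hi _ _ (hx l) (hy l)
      have e2 := dfc j hj (z l) (w l)
      linear_combination hs l - e1 - e2
    let u : Fin (n + 1) → Fin 3 := fun l => if x l = y l then 0 else 2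
    have hu : ∀ l, dl 0 (x l) - dl 0 (y l) + dq 0 (u l) = 0 := by
      intro l
      have h1 := (hPi _).1 (hx l)
      have h2 := (hPi _).1 (hy l)
      simp only [u]
      generalize x l = p at *
      generalize y l = q at *
      revert h1 h2
      clear * -
      revert p q
      decide
    have s1 := hS inv (fun l => ![x l, y l, u l]) (fun l => (S01_iff _).2
      ⟨(hPi _).1 (hx l), (hPi _).1 (hy l), hu l⟩)
    have s1 := ((S01_iff _).1 s1).2.2
    have d0 : dq 0 0 = 0 := dq_zero _ (by decide)
    have s2 := fmu j hj z w u (fun _ => 0) (fun l => by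
      rw [d0]; exact mod2_S _ _ _ _ _ (hs' l) (hu l))
    rw [dq_zero _ ((hPi _).1 (fPI i (fun _ => 0) (fun _ => hz0)))] at s2
    have := mod2_S' _ _ _ _ _ s1 s2
    have e1 := dfa i hi _ _ (fPI i x hx) (fPI i y hy)
    have e2 := dfc j hj (f z) (f w)
    simp at this
    linear_combination this + e1 + e2
  have hL : ∀ i j, PresL (PI R) δ f i j := by
    intro i j
    by_cases hi : PI R i 2 <;> by_cases hj : PI R j 2
    · exact fcc i j hi hj
    · exact swap _ _ (fac j i hj hi)
    · exact fac i j hi hj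
    · exact faa i j hi hj
  have P0 : ∀ i, PI R i 0 := by
    intro i
    by_cases hi : PI R i 2
    · exact (tc i hi).1 0
    · exact ((ta i hi).1 0).2 (by decide)
  obtain ⟨x, hx, hxR⟩ := adjust hRs rep i0 (fun _ => 0) P0
  refine h.finish h3 hRs rep δt hL i0 _ hxR 0 x ?_
  intro q
  by_cases hq : q = i0
  · subst hq; simp
  · simp [hq]

end

/-! ## The case of an invariant equivalence relation: the remaining coordinates -/

lemma T2rel_iff (v : Fin 4 → Fin 3) : v ∈ T2rel ↔ (∀ j, v j = 2) ∨
    (v 0 ≠ 2 ∧ v 1 ≠ 2 ∧ v 2 ≠ 2 ∧ v 3 ≠ 2 ∧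
      dl 0 (v 0) - dl 0 (v 1) + dl 0 (v 2) - dl 0 (v 3) = 0) := by
  rw [← Tprime2_iff]
  constructor
  · rintro (h | h)
    · left; intro j; rw [h]
    · exact Or.inr h
  · rintro (h | h)
    · left; funext j; exact h j
    · exact Or.inr h

def msk {n : ℕ} (s x : Fin n → Fin 3) : Fin n → Fin 3 := fun l => if s l = 2 then 2 else x l

lemma ta_not2 : ∀ t a : Fin 3, t ≠ a → qmap t = qmap a → t ≠ 2 ∧ a ≠ 2 := by decide
lemma ta_cases : ∀ t a x : Fin 3, t ≠ a → t ≠ 2 → a ≠ 2 → x ≠ 2 → x = t ∨ x = a := by decide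
lemma qta_cases : ∀ t a x : Fin 3, qmap t ≠ qmap a → qmap x = qmap t ∨ qmap x = qmap a := by decide
lemma q_ne2 : ∀ x y : Fin 3, qmap x = qmap y → y ≠ 2 → x ≠ 2 := by decide

section
variable {n : ℕ} {C : Ops (Fin 3)} {f : (Fin (n + 1) → Fin 3) → Fin 3}
    {ι : Type} [Fintype ι] [DecidableEq ι] {R : Set (ι → Fin 3)}
    {col : ι → Fin (n + 1) → Fin 3} {t a : ι → Fin 3} {M : Fin 3 → Fin 3 → Fin 3 → Fin 3}

lemma typeD_ta (hM : IsMal M) (hmm : MMu M)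
    (hMC : ∀ {κ : Type} (S : Set (κ → Fin 3)), InvG C S → MCl M S)
    (h : Crit C f ι R col t a) (h3 : 3 ≤ Fintype.card ι) (i : ι)
    (hd : (∀ x, PI R i x) ∧ ∀ x y, Th R i x y ↔ x = y) : t i ≠ 2 ∧ a i ≠ 2 := by
  have hR := hMC R h.inv
  obtain ⟨j, hij, -⟩ := Crit.three h3 i i
  obtain ⟨k, hik, hjk⟩ := Crit.three h3 i j
  have cases : ∀ j, i ≠ j → (∀ x y, Lam R i j x y) ∨ (∀ x y, Lam R i j x y ↔ qmap x = qmap y) := by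
    intro j hij
    have hl := hMC _ (h.inv.lam i j)
    rcases eqv_cases hM hmm (e := Lam R i j) ⟨fun z => Lam.refl (hd.1 z), Lam.symm,
      fun h1 h2 => Lam.trans hM hR h1 h2⟩
      (fun x y z x' y' z' h1 h2 h3 => hl ![x, x'] h1 ![y, y'] h2 ![z, z'] h3) with e | e | e
    · exact Or.inl e
    · exact Or.inr e
    · exact absurd ((e _ _).1 (Lam.ta h.ha hij)) (h.ne_ta i)
  have l01 : ∀ j, i ≠ j → Lam R i j 0 1 := by
    intro j hij
    rcases cases j hij with e | e
    · exact e _ _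
    · exact (e _ _).2 (by decide)
  rcases cases j hij with e | e
  · have q := Quad.mk2 hM hR (e 2 0) (l01 k hik)
    rw [hmm.left hM (by decide) (by decide)] at q
    have := Quad.th hM hR hik hij hjk.symm q.swap.flip
    exact absurd ((hd.2 _ _).1 this) (by decide)
  · exact ta_not2 _ _ (h.ne_ta i) ((e _ _).1 (Lam.ta h.ha hij))

lemma typeD_all (hM : IsMal M) (hmm : MMu M) (hmu : Inv2 C (fun x y => qmap x = qmap y))
    (hMC : ∀ {κ : Type} (S : Set (κ → Fin 3)), InvG C S → MCl M S)
    (h : Crit C f ι R col t a) (h3 : 3 ≤ Fintype.card ι) (i : ι)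
    (hd : (∀ x, PI R i x) ∧ ∀ x y, Th R i x y ↔ x = y) (j : ι) (r : ι → Fin 3) (hr : r ∈ R)
    (hri : r i = 2) : ((∀ x, PI R j x) ∧ ∀ x y, Th R j x y ↔ x = y) ∧ r j = 2 := by
  by_cases hij : i = j
  · subst hij; exact ⟨hd, hri⟩
  have hR := hMC R h.inv
  obtain ⟨hti, hai⟩ := typeD_ta hM hmm hMC h h3 i hd
  obtain ⟨k, hik, hjk⟩ := Crit.three h3 i j
  have th : Th R j (r j) (M (t j) (a j) (r j)) := by
    have := Th.mk2 (i := j) hr (hR _ (h.ha i) _ (h.ha j) _ hr) (fun q hq => by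
      by_cases hqi : q = i
      · subst hqi; simp [hq, hri, hmm.right hM hai hti]
      · simp [hq, hqi, (hM _ _).2])
    simpa [Ne.symm hij] using this
  have Pt : PI R j (t j) := PI_t h.ha hjk
  have Pa := PI_a h.ha j
  have n1 : ¬ Th R j (r j) (t j) := by
    intro e
    have e2 := Th.mal hR (Th.refl Pt) (Th.refl Pa) e
    exact not_th_tat hM hR h.ht h.ha (Ne.symm hij) hjk hik
      (((e.symm.trans hM hR th).trans hM hR e2).symm)
  have n2 : ¬ Th R j (r j) (a j) := by
    intro e
    have e2 := Th.mal hR (Th.refl Pt) (Th.refl Pa) e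
    rw [(hM _ _).1] at e2
    exact not_th hM hR h.ht h.ha j ((e.symm.trans hM hR th).trans hM hR e2).symm
  have hne := h.ne_ta j
  rcases types hM hmm hmu hR h (Ne.symm hij) with ⟨e1, e2⟩ | ⟨e1, e2⟩ | e
  · rcases ta_cases _ _ (r j) hne ((e1 _).1 Pt) ((e1 _).1 Pa) ((e1 _).1 ⟨r, hr, rfl⟩) with e | e
    · exact absurd (e ▸ Th.refl ⟨r, hr, rfl⟩) n1
    · exact absurd (e ▸ Th.refl ⟨r, hr, rfl⟩) n2
  · rcases qta_cases (t j) (a j) (r j) (fun e => not_th hM hR h.ht h.ha j ((e2 _ _).2 e)) with e | e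
    · exact absurd ((e2 _ _).2 e) n1
    · exact absurd ((e2 _ _).2 e) n2
  · refine ⟨e, ?_⟩
    obtain ⟨htj, haj⟩ := typeD_ta hM hmm hMC h h3 j e
    by_contra h2
    rcases ta_cases _ _ (r j) hne htj haj h2 with e' | e'
    · exact n1 ((e.2 _ _).2 e')
    · exact n2 ((e.2 _ _).2 e')

lemma caseD (hM : IsMal M) (hmm : MMu M) (hmu : Inv2 C (fun x y => qmap x = qmap y))
    (hMC : ∀ {κ : Type} (S : Set (κ → Fin 3)), InvG C S → MCl M S)
    (h : Crit C f ι R col t a) (h3 : 3 ≤ Fintype.card ι)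
    (hT2 : InvG C T2rel → Preserves f T2rel) (i0 : ι)
    (hd0 : (∀ x, PI R i0 x) ∧ ∀ x y, Th R i0 x y ↔ x = y) : False := by
  classical
  have hR := hMC R h.inv
  have hd : ∀ j, (∀ x, PI R j x) ∧ ∀ x y, Th R j x y ↔ x = y := by
    intro j
    obtain ⟨r, hr, hr2⟩ := hd0.1 2
    exact (typeD_all hM hmm hmu hMC h h3 i0 hd0 j r hr hr2).1
  have h22 : ∀ r ∈ R, ∀ i j, r i = 2 → r j = 2 := fun r hr i j hri =>
    (typeD_all hM hmm hmu hMC h h3 i (hd i) j r hr hri).2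
  have ht2 := fun i => (typeD_ta hM hmm hMC h h3 i (hd i)).1
  have ha2 := fun i => (typeD_ta hM hmm hMC h h3 i (hd i)).2
  have hne := h.ne_ta
  have two : (fun _ => 2) ∈ R := by
    obtain ⟨r, hr, hr2⟩ := hd0.1 2
    convert hr
    exact (h22 r hr _ _ hr2).symm
  let R' : Set (ι → Fin 3) := {r | r ∈ R ∧ ∀ i, r i ≠ 2}
  have hR' : MCl M R' := by
    intro r hr s hs u hu
    refine ⟨hR r hr.1 s hs.1 u hu.1, fun i => ?_⟩
    refine q_ne2 _ (s i) ?_ (hs.2 i)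
    rw [hmm _ _ _ (s i) (s i) (s i) (q_not2 _ _ (hr.2 i) (hs.2 i)) rfl
      (q_not2 _ _ (hu.2 i) (hs.2 i)), (hM _ _).1]
  have haR' : ∀ i, update t i (a i) ∈ R' := by
    intro i
    refine ⟨h.ha i, fun q => ?_⟩
    by_cases hq : q = i
    · subst hq; simpa using ha2 q
    · simpa [hq] using ht2 q
  have hPI : ∀ i x, PI R' i x ↔ x ≠ 2 := by
    intro i x
    constructor
    · rintro ⟨r, hr, rfl⟩; exact hr.2 i
    · intro hx
      obtain ⟨j, hij, -⟩ := Crit.three h3 i i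
      rcases ta_cases _ _ x (hne i) (ht2 i) (ha2 i) hx with rfl | rfl
      · exact PI_t haR' hij
      · exact PI_a haR' i
  let δ : ι → Fin 3 → ZMod 2 := fun i => dl (t i)
  let P : ι → Fin 3 → Prop := fun _ x => x ≠ 2
  have hRs : ∀ r, r ∈ R' ↔ (∀ i, P i (r i)) ∧ ∑ i, δ i (r i) = 1 := by
    intro r
    have := structure2 (δ := δ) hM hR' (fun e => h.ht e.1) haR' (Crit.three h3)
      (by
        intro i x y hx hy
        constructor
        · rintro ⟨r, hr, e1, e2⟩
          rw [((hd i).2 x y).1 ⟨r, hr.1, e1, e2.1⟩]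
        · intro e
          have := dl_inj2 _ _ _ (ht2 i) ((hPI _ _).1 hx) ((hPI _ _).1 hy) e
          subst this
          exact Th.refl hx)
      (fun i => dl_self _) (fun i => dl_ne _ _ (hne i)) i0 r
    simpa only [hPI] using this
  have rep : ∀ i (c : ZMod 2), ∃ x, P i x ∧ δ i x = c := by
    intro i c
    rcases zmod2_cases c with rfl | rfl
    · exact ⟨t i, ht2 i, dl_self _⟩
    · exact ⟨a i, ha2 i, dl_ne _ _ (hne i)⟩
  have df : ∀ i x y, x ≠ 2 → y ≠ 2 → δ i x - δ i y = dl 0 x - dl 0 y :=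
    fun i x y hx hy => dl_diff _ _ _ (ht2 i) hx hy
  have mskR : ∀ (k : ℕ) (s : Fin k → Fin 3) (r : Fin k → ι → Fin 3), (∀ l, r l ∈ R) →
      ∀ l, (fun i => msk s (fun l => r l i) l) ∈ R := by
    intro k s r hr l
    by_cases hs : s l = 2
    · simpa [msk, hs] using two
    · simpa [msk, hs] using hr l
  have mskq : ∀ (k : ℕ) (s x y : Fin k → Fin 3), (∀ l, x l ≠ 2) → (∀ l, y l ≠ 2) →
      ∀ l, qmap (msk s x l) = qmap (msk s y l) := by
    intro k s x y hx hy l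
    by_cases hs : s l = 2
    · simp [msk, hs]
    · simpa [msk, hs] using q_not2 _ _ (hx l) (hy l)
  have inv : InvG C T2rel := by
    intro k g hg v hv
    simp only [T2rel_iff] at hv
    let s : Fin (k + 1) → Fin 3 := fun l => v l 0
    let x : Fin 4 → Fin (k + 1) → Fin 3 := fun j l => if s l = 2 then 0 else v l j
    have hs2 : ∀ l, s l = 2 → ∀ j, v l j = 2 := by
      intro l hl
      rcases hv l with e | e
      · exact e
      · exact absurd hl e.1
    have hs3 : ∀ l, s l ≠ 2 → _ := fun l hl => (hv l).resolve_left (fun e => hl (e 0))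
    have hx2 : ∀ j l, x j l ≠ 2 := by
      intro j l
      by_cases hl : s l = 2
      · simp [x, hl]
      · simp only [x, if_neg hl]
        have := hs3 l hl
        fin_cases j
        exacts [this.1, this.2.1, this.2.2.1, this.2.2.2.1]
    have hxs : ∀ j, (fun l => v l j) = msk s (x j) := by
      intro j
      funext l
      by_cases hl : s l = 2
      · simp [msk, hl, hs2 l hl]
      · simp [msk, x, hl]
    let g' : (Fin (k + 1) → Fin 3) → Fin 3 := fun y => g (msk s y)
    have gq : ∀ y z : Fin (k + 1) → Fin 3, (∀ l, y l ≠ 2) → (∀ l, z l ≠ 2) →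
      qmap (g' y) = qmap (g' z) := fun y z hy hz => hmu k g hg _ _ (mskq _ s y z hy hz)
    rw [T2rel_iff]
    simp only [hxs]
    by_cases h0 : g' (x 0) = 2
    · left
      intro j
      have := gq (x j) (x 0) (hx2 j) (hx2 0)
      rw [h0] at this
      exact qmap_two _ this
    · right
      have hg2 : ∀ y : Fin (k + 1) → Fin 3, (∀ l, y l ≠ 2) → g' y ≠ 2 := fun y hy =>
        q_ne2 _ _ (gq y (x 0) hy (hx2 0)) h0
      have hL := presL_all hRs rep (Crit.three h3) g' (by
        intro r hr
        exact ⟨h.inv k g hg _ (mskR _ s r fun l => (hr l).1), fun i => hg2 _ fun l => (hr l).2 i⟩)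
        i0 i0
      have := hL (x 0) (x 1) (x 2) (x 3) (hx2 0) (hx2 1) (hx2 2) (hx2 3) (fun l => by
        have e1 := df i0 _ _ (hx2 0 l) (hx2 1 l)
        have e2 := df i0 _ _ (hx2 2 l) (hx2 3 l)
        by_cases hl : s l = 2
        · simp [x, hl]
        · have e3 := (hs3 l hl).2.2.2.2
          simp only [x, if_neg hl] at e1 e2 ⊢
          linear_combination e1 + e2 + e3)
      have p0 := hg2 _ (hx2 0)
      have p1 := hg2 _ (hx2 1)
      have p2 := hg2 _ (hx2 2)
      have p3 := hg2 _ (hx2 3)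
      refine ⟨p0, p1, p2, p3, ?_⟩
      have e1 := df i0 _ _ p0 p1
      have e2 := df i0 _ _ p2 p3
      change dl 0 (g' (x 0)) - dl 0 (g' (x 1)) + dl 0 (g' (x 2)) - dl 0 (g' (x 3)) = 0
      linear_combination this - e1 - e2
  have pres := hT2 inv
  let s : Fin (n + 1) → Fin 3 := col i0
  let f' : (Fin (n + 1) → Fin 3) → Fin 3 := fun y => f (msk s y)
  have scol : ∀ l i, s l = 2 → col i l = 2 := fun l i hl => h22 _ (h.hcol l) i0 i hl
  have scol' : ∀ l i, s l ≠ 2 → col i l ≠ 2 := fun l i hl e => hl (h22 _ (h.hcol l) i i0 e)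
  have hx : ∃ r ∈ R', ∃ x, ∀ i, r i = 0 ∨ r i = x := by
    obtain ⟨x, hx, hxR⟩ := adjust hRs rep i0 (fun _ => 0) (fun i => by simp [P])
    refine ⟨_, hxR, x, fun q => ?_⟩
    by_cases hq : q = i0
    · subst hq; simp
    · simp [hq]
  obtain ⟨r, hr, x, hrx⟩ := hx
  let col' : ι → Fin (n + 1) → Fin 3 := fun i l => if s l = 2 then r i else col i l
  have hcol2 : ∀ i l, col' i l ≠ 2 := by
    intro i l
    by_cases hl : s l = 2
    · simpa [col', hl] using hr.2 i
    · simpa [col', hl] using scol' l i hl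
  have hcm : ∀ i, msk s (col' i) = col i := by
    intro i
    funext l
    by_cases hl : s l = 2
    · simp [msk, hl, scol l i hl]
    · simp [msk, col', hl]
  have f2 : ∀ y : Fin (n + 1) → Fin 3, (∀ l, y l ≠ 2) → f' y ≠ 2 := by
    intro y hy
    refine q_ne2 _ (f' (col' i0)) ?_ ?_
    · exact h.binary h3 _ (inv2_iff.2 hmu) _ _ (mskq _ s y _ hy (hcol2 i0))
    · simp only [f', hcm, h.hf]
      exact ht2 i0
  have hL : ∀ i j, PresL P δ f' i j := by
    intro i j x y z w hx hy hz hw hs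
    have := pres (fun l => ![msk s x l, msk s y l, msk s z l, msk s w l]) (fun l => by
      rw [T2rel_iff]
      by_cases hl : s l = 2
      · left; intro j; fin_cases j <;> simp [msk, hl]
      · right
        have e1 := df i _ _ (hx l) (hy l)
        have e2 := df j _ _ (hz l) (hw l)
        simp only [msk, if_neg hl]
        refine ⟨hx l, hy l, hz l, hw l, ?_⟩
        change dl 0 (x l) - dl 0 (y l) + dl 0 (z l) - dl 0 (w l) = 0
        linear_combination hs l - e1 - e2)
    rw [T2rel_iff] at this
    rcases this with e | e
    · exact absurd (e 0) (f2 x hx)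
    · have e3 : dl 0 (f' x) - dl 0 (f' y) + dl 0 (f' z) - dl 0 (f' w) = 0 := e.2.2.2.2
      have e1 := df i _ _ (f2 x hx) (f2 y hy)
      have e2 := df j _ _ (f2 z hz) (f2 w hw)
      linear_combination e3 + e1 + e2
  have hfin := final_sum rep f' hL i0 col' hcol2 (fun l => by
      refine ((hRs (fun i => col' i l)).1 ?_).2
      by_cases hl : s l = 2
      · simpa [col', hl] using hr
      · simp only [col', if_neg hl]
        exact ⟨h.hcol l, fun i => scol' l i hl⟩) r hr.2 ((hRs r).1 hr).2
  have h1 := h.two_val h3 (msk s fun _ => 0) (msk s fun _ => x) (fun i => msk s fun _ => r i)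
    (fun i => by rcases hrx i with e | e <;> simp [e]) (mskR _ s (fun _ => r) (fun _ => hr.1))
  have h2 := ((hRs (fun i => f' fun _ => r i)).1 ⟨h1, fun i => f2 _ fun _ => hr.2 i⟩).2
  rw [h2] at hfin
  simp [f', hcm, h.hf, δ, dl_self] at hfin

/-- The case of an invariant equivalence relation. -/
lemma mu_main (hM : IsMal M) (hmu : Inv2 C (fun x y => qmap x = qmap y))
    (hMC : ∀ {κ : Type} (S : Set (κ → Fin 3)), InvG C S → MCl M S)
    (h : Crit C f ι R col t a)
    (hu : ∀ S : Set (Fin 1 → Fin 3), InvG C S → Preserves f S)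
    (hb : ∀ S ∈ binList2, InvG C S → Preserves f S)
    (hS : InvG C S01 → Preserves f S01)
    (hq : ∀ S ∈ quatList2, InvG C S → Preserves f S) : False := by
  have hmm := MMu_of hMC hmu
  have hR := hMC R h.inv
  have c0 := h.card_ne_zero
  have c1 := h.card_ne_one hu
  by_cases h2 : Fintype.card ι = 2
  · exact mu_two hM hmm hmu hR h h2 hu hb
  have h3 : 3 ≤ Fintype.card ι := by omega
  have ty := fun i => types hM hmm hmu hR h (Crit.three h3 i i).choose_spec.1
  by_cases hd : ∃ i, (∀ x, PI R i x) ∧ ∀ x y, Th R i x y ↔ x = y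
  · obtain ⟨i, hi⟩ := hd
    exact caseD hM hmm hmu hMC h h3 (hq _ (by simp [quatList2])) i hi
  · have : Nonempty ι := Fintype.card_pos_iff.1 (by omega)
    obtain ⟨i0⟩ := this
    refine caseAC hM hR h h3 (fun i => ?_) (hq _ (by simp [quatList2]))
      (hq _ (by simp [quatList2])) hS i0
    rcases ty i with e | e | e
    · exact Or.inl e
    · exact Or.inr e
    · exact absurd ⟨i, e⟩ hd

end

/-! ## Conjugation and the main theorem -/

lemma conj_inv2 {C : Ops (Fin 3)} {σ : Equiv.Perm (Fin 3)} {b : Fin 3 → Fin 3 → Prop} :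
    Inv2 (conjClone σ C) b ↔ Inv2 C (fun x y => b (σ x) (σ y)) := by
  constructor
  · intro h n g hg x y hxy
    have := h n _ ⟨g, hg, rfl⟩ (fun l => σ (x l)) (fun l => σ (y l)) hxy
    simpa using this
  · rintro h n _ ⟨g, hg, rfl⟩ x y hxy
    exact h n g hg (fun l => σ.symm (x l)) (fun l => σ.symm (y l)) (fun l => by simpa using hxy l)

lemma conj_clone {C : Ops (Fin 3)} (hC : IsClone C) (σ : Equiv.Perm (Fin 3)) :
    IsClone (conjClone σ C) := by
  constructor
  · intro n i
    exact ⟨_, hC.proj n i, by funext x; simp⟩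
  · rintro n m _ g ⟨f, hf, rfl⟩ hg
    choose u hu hug using hg
    refine ⟨_, hC.comp n m f u hf hu, ?_⟩
    funext x
    simp [← hug]

lemma conj_mal {C : Ops (Fin 3)} (σ : Equiv.Perm (Fin 3))
    (hM : ∃ m ∈ C 2, ∀ x y : Fin 3, m ![y, x, x] = y ∧ m ![x, x, y] = y) :
    ∃ m ∈ conjClone σ C 2, ∀ x y : Fin 3, m ![y, x, x] = y ∧ m ![x, x, y] = y := by
  obtain ⟨m, hm, h⟩ := hM
  refine ⟨_, ⟨m, hm, rfl⟩, fun x y => ?_⟩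
  have e : ∀ a b c : Fin 3, (fun i => σ.symm (![a, b, c] i)) = ![σ.symm a, σ.symm b, σ.symm c] := by
    intro a b c
    funext i
    fin_cases i <;> rfl
  simp [e, (h _ _).1, (h _ _).2]

lemma pqc : ∀ p q c x : Fin 3, p ≠ q → c ≠ p → c ≠ q → x ≠ c → x = p ∨ x = q := by decide

lemma swap_q : ∀ c x y : Fin 3, qmap (Equiv.swap c 2 x) = qmap (Equiv.swap c 2 y) ↔
    (x = c ↔ y = c) := by decide

/-- A nontrivial equivalence relation is conjugate to `μ₂`. -/
lemma eqv_conj {e : Fin 3 → Fin 3 → Prop} (he : Equivalence e) (h1 : ¬ ∀ x y, e x y ↔ x = y)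
    (h2 : ¬ ∀ x y, e x y) :
    ∃ σ : Equiv.Perm (Fin 3), ∀ x y, e x y ↔ qmap (σ x) = qmap (σ y) := by
  have hp : ∃ p q, p ≠ q ∧ e p q := by
    by_contra hc
    push Not at hc
    refine h1 fun x y => ⟨fun hxy => ?_, fun hxy => hxy ▸ he.refl x⟩
    by_contra hne
    exact hc x y hne hxy
  obtain ⟨p, q, hpq, hepq⟩ := hp
  have hc : ∃ c, ¬ e p c := by
    by_contra hc
    push Not at hc
    exact h2 fun x y => he.trans (he.symm (hc x)) (hc y)
  obtain ⟨c, hc⟩ := hc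
  have hcp : c ≠ p := fun h => hc (h ▸ he.refl _)
  have hcq : c ≠ q := fun h => hc (h ▸ hepq)
  have hx : ∀ x, x ≠ c → e p x := by
    intro x hx
    rcases pqc p q c x hpq hcp hcq hx with rfl | rfl
    · exact he.refl _
    · exact hepq
  refine ⟨Equiv.swap c 2, fun x y => ?_⟩
  rw [swap_q]
  constructor
  · intro h
    constructor
    · rintro rfl
      by_contra hy
      exact hc (he.trans (hx y hy) (he.symm h))
    · rintro rfl
      by_contra hy
      exact hc (he.trans (hx x hy) h)
  · intro h
    by_cases hxc : x = c
    · rw [hxc, h.1 hxc]; exact he.refl _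
    · exact he.trans (he.symm (hx x hxc)) (hx y fun e => hxc (h.2 e))

lemma ps0_conj : ∀ x y : Fin 3, (x, y) ∈ ps0 ↔
    (Equiv.swap (0 : Fin 3) 2 x, Equiv.swap (0 : Fin 3) 2 y) ∈ L1 1 := by decide

lemma ps1_conj : ∀ x y : Fin 3, (x, y) ∈ ps1 ↔
    (Equiv.swap (1 : Fin 3) 2 x, Equiv.swap (1 : Fin 3) 2 y) ∈ L1 1 := by decide

lemma exists_psi (C : Ops (Fin 3)) : ∃ σ : Equiv.Perm (Fin 3),
    Inv2 (conjClone σ C) (fun x y => (x, y) ∈ ps0) ∨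
      Inv2 (conjClone σ C) (fun x y => (x, y) ∈ ps1) →
      Inv2 (conjClone σ C) (fun x y => (x, y) ∈ L1 1) := by
  by_cases h : ∃ σ : Equiv.Perm (Fin 3), Inv2 (conjClone σ C) (fun x y => (x, y) ∈ L1 1)
  · obtain ⟨σ, h⟩ := h
    exact ⟨σ, fun _ => h⟩
  · refine ⟨1, fun h' => absurd ?_ h⟩
    rcases h' with h' | h'
    · refine ⟨Equiv.swap 0 2, ?_⟩
      rw [conj_inv2] at h' ⊢
      simp only [ps0_conj] at h'
      exact h'
    · refine ⟨Equiv.swap 1 2, ?_⟩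
      rw [conj_inv2] at h' ⊢
      simp only [ps1_conj] at h'
      exact h'

lemma main1 {C : Ops (Fin 3)} (hC : IsClone C)
    (hM : ∃ m ∈ C 2, ∀ x y : Fin 3, m ![y, x, x] = y ∧ m ![x, x, y] = y) (hs : Simp3 C)
    (hps : Inv2 C (fun x y => (x, y) ∈ ps0) ∨ Inv2 C (fun x y => (x, y) ∈ ps1) →
      Inv2 C (fun x y => (x, y) ∈ L1 1)) (n : ℕ) :
    C n = {f | (∀ S : Set (Fin 1 → Fin 3), InvariantUnder C S → Preserves f S) ∧
              (∀ R ∈ binList1, InvariantUnder C R → Preserves f R) ∧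
              (∀ R ∈ quatList1, InvariantUnder C R → Preserves f R)} := by
  obtain ⟨m, hm, hmal⟩ := hM
  ext f
  constructor
  · intro hf
    exact ⟨fun S hS => hS n f hf, fun S _ hS => hS n f hf, fun S _ hS => hS n f hf⟩
  · rintro ⟨hu, hb, hq⟩
    by_contra hf
    obtain ⟨Y, R, a, h⟩ := exists_crit hC hf
    exact simple_main (M := fun x y z => m ![x, y, z]) hs hmal (fun S hS => hS.mcl hm) h hu hb hq
      hps

lemma main2 {C : Ops (Fin 3)} (hC : IsClone C)
    (hM : ∃ m ∈ C 2, ∀ x y : Fin 3, m ![y, x, x] = y ∧ m ![x, x, y] = y)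
    (hmu : Inv2 C (fun x y => qmap x = qmap y)) (n : ℕ) :
    C n = {f | (∀ S : Set (Fin 1 → Fin 3), InvariantUnder C S → Preserves f S) ∧
              (∀ R ∈ binList2, InvariantUnder C R → Preserves f R) ∧
              (InvariantUnder C S01 → Preserves f S01) ∧
              (∀ R ∈ quatList2, InvariantUnder C R → Preserves f R)} := by
  obtain ⟨m, hm, hmal⟩ := hM
  ext f
  constructor
  · intro hf
    exact ⟨fun S hS => hS n f hf, fun S _ hS => hS n f hf, fun hS => hS n f hf,
      fun S _ hS => hS n f hf⟩
  · rintro ⟨hu, hb, hS, hq⟩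
    by_contra hf
    obtain ⟨Y, R, a, h⟩ := exists_crit hC hf
    exact mu_main (M := fun x y z => m ![x, y, z]) hmal hmu (fun S hS => hS.mcl hm) h hu hb hS hq

/-- Every Mal'cev clone on `{0,1,2}` is, after conjugating by a suitable permutation σ,
determined by its invariant subsets together with the invariant standard relations of
arity at most 4 (either the list for simple algebras, or the one for monolith `μ₂`).
In particular, every Mal'cev clone on a three-element set has an at most 4-ary
relational basis. -/
theorem stmt1 (C : Ops (Fin 3)) (hC : IsClone C)
    (hM : ∃ m ∈ C 2, ∀ x y : Fin 3, m ![y, x, x] = y ∧ m ![x, x, y] = y) :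
    ∃ σ : Equiv.Perm (Fin 3),
      ((∀ e : Fin 3 → Fin 3 → Prop, Equivalence e →
          InvariantUnder (conjClone σ C) {t : Fin 2 → Fin 3 | e (t 0) (t 1)} →
          (∀ x y, e x y ↔ x = y) ∨ (∀ x y, e x y)) ∧
        ∀ n, conjClone σ C n =
          {f | (∀ S : Set (Fin 1 → Fin 3),
                  InvariantUnder (conjClone σ C) S → Preserves f S) ∧
              (∀ R ∈ binList1, InvariantUnder (conjClone σ C) R → Preserves f R) ∧
              (∀ R ∈ quatList1, InvariantUnder (conjClone σ C) R → Preserves f R)}) ∨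
      (InvariantUnder (conjClone σ C) mu2 ∧
        ∀ n, conjClone σ C n =
          {f | (∀ S : Set (Fin 1 → Fin 3),
                  InvariantUnder (conjClone σ C) S → Preserves f S) ∧
              (∀ R ∈ binList2, InvariantUnder (conjClone σ C) R → Preserves f R) ∧
              (InvariantUnder (conjClone σ C) S01 → Preserves f S01) ∧
              (∀ R ∈ quatList2, InvariantUnder (conjClone σ C) R → Preserves f R)}) := by
  by_cases hs : Simp3 C
  · obtain ⟨σ, hσ⟩ := exists_psi C
    have hs' : Simp3 (conjClone σ C) := by
      intro e he hinv
      have h1 := inv2_iff.2 (conj_inv2.1 (inv2_iff.1 hinv))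
      rcases hs (fun x y => e (σ x) (σ y))
        ⟨fun x => he.refl _, fun h => he.symm h, fun h h' => he.trans h h'⟩ h1 with h | h
      · left
        intro x y
        have := h (σ.symm x) (σ.symm y)
        simpa using this
      · right
        intro x y
        have := h (σ.symm x) (σ.symm y)
        simpa using this
    exact ⟨σ, Or.inl ⟨hs', main1 (conj_clone hC σ) (conj_mal σ hM) hs' hσ⟩⟩
  · unfold Simp3 at hs
    push Not at hs
    obtain ⟨e, he, hinv, h1, h2⟩ := hs
    obtain ⟨σ, hσ⟩ := eqv_conj he (by push Not; exact h1) (by push Not; exact h2)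
    have hmu : Inv2 (conjClone σ C) (fun x y => qmap x = qmap y) := by
      rw [conj_inv2]
      exact (inv2_iff.1 hinv).congr hσ
    refine ⟨σ, Or.inr ⟨?_, main2 (conj_clone hC σ) (conj_mal σ hM) hmu⟩⟩
    rw [mu2_eq]
    exact inv2_iff.2 hmu
end

section
/- Let C be a clone on {0,1,2} such that every operation in C is idempotent, C contains a Mal'cev operation, C contains a majority operation, and every operation in C preserves μ₂. Then: (1) if some operation in C does not preserve ψ₂, then C is minor-equivalent to 𝒞₂ or to ℐ₂; (2) if every operation in C preserves ψ₂ but some operation in C does not preserve ρ₂, then C is minor-equivalent to ℳ₁ = Pol(ψ₂,μ₂,{0},{1},{2}); (3) if every operation in C preserves both ψ₂ and ρ₂, then C is minor-equivalent to ℳ₀ = Pol(ψ₂,ρ₂,{0,1},{0},{1},{2}). Moreover, there are minion homomorphisms ℳ₀ → ℳ₁ → 𝒞₂ → ℐ₂, and ℳ₀, ℳ₁, 𝒞₂, ℐ₂ are pairwise not minor-equivalent. -/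
/-- The minor of `f` along `σ`. -/
def Minor {A : Type} {n r : ℕ} (f : (Fin n → A) → A) (σ : Fin n → Fin r) :
    (Fin r → A) → A := fun x => f (x ∘ σ)

/-- `ξ` is a minion homomorphism from `C` to `D`: it maps members of `C` to members of `D`
and commutes with taking minors (on members of `C`). -/
def IsMinionHom {A B : Type} (C : Ops A) (D : Ops B)
    (ξ : ∀ n : ℕ, ((Fin (n + 1) → A) → A) → ((Fin (n + 1) → B) → B)) : Prop :=
  (∀ n f, f ∈ C n → ξ n f ∈ D n) ∧
    ∀ (n r : ℕ) (f : (Fin (n + 1) → A) → A) (σ : Fin (n + 1) → Fin (r + 1)),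
      f ∈ C n → ξ r (Minor f σ) = Minor (ξ n f) σ

/-- There exists a minion homomorphism from `C` to `D`. -/
def MinorLE {A B : Type} (C : Ops A) (D : Ops B) : Prop := ∃ ξ, IsMinionHom C D ξ

/-- `C` and `D` are minor-equivalent. -/
def MinorEquiv {A B : Type} (C : Ops A) (D : Ops B) : Prop := MinorLE C D ∧ MinorLE D C

def neqRel : Set (Fin 2 → Fin 2) := {t | t 0 ≠ t 1}

/-- The relation `{(x,y,z,w) ∈ {0,1}⁴ : w = x+y+z mod 2}`. -/
def Z2rel : Set (Fin 4 → Fin 2) := {t | t 3 = t 0 + t 1 + t 2}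

/-- `ℐ₂ = Pol({0},{1})` on `{0,1}`. -/
def CloneI2 : Ops (Fin 2) := fun _ =>
  {f | Preserves f (unRel {0}) ∧ Preserves f (unRel {1})}

/-- `𝒞₂ = Pol(≠,{0},{1})` on `{0,1}`. -/
def CloneC2 : Ops (Fin 2) := fun _ =>
  {f | Preserves f neqRel ∧ Preserves f (unRel {0}) ∧ Preserves f (unRel {1})}

/-- `𝒵₂ = Pol({(x,y,z,w) : w = x+y+z mod 2},{0},{1})` on `{0,1}`. -/
def CloneZ2 : Ops (Fin 2) := fun _ =>
  {f | Preserves f Z2rel ∧ Preserves f (unRel {0}) ∧ Preserves f (unRel {1})}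

/-- `ℳ₁ = Pol(ψ₂,μ₂,{0},{1},{2})`. -/
def CloneM1 : Ops (Fin 3) := fun _ =>
  {f | Preserves f psi2 ∧ Preserves f mu2 ∧ ∀ c : Fin 3, Preserves f (unRel {c})}

/-- `ℳ₀ = Pol(ψ₂,ρ₂,{0,1},{0},{1},{2})`. -/
def CloneM0 : Ops (Fin 3) := fun _ =>
  {f | Preserves f psi2 ∧ Preserves f rho2 ∧ Preserves f (unRel {0, 1}) ∧
    ∀ c : Fin 3, Preserves f (unRel {c})}

/-! ### Boolean-valued binary relations on `{0,1,2}` -/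

abbrev BR := Fin 3 → Fin 3 → Bool

def PresB {n : ℕ} (f : (Fin n → Fin 3) → Fin 3) (P : BR) : Prop :=
  ∀ x y : Fin n → Fin 3, (∀ i, P (x i) (y i) = true) → P (f x) (f y) = true

def InvB (C : Ops (Fin 3)) (P : BR) : Prop := ∀ n f, f ∈ C n → PresB f P

def compB (P Q : BR) : BR := fun a c =>
  (P a 0 && Q 0 c) || (P a 1 && Q 1 c) || (P a 2 && Q 2 c)

def revB (P : BR) : BR := fun a b => P b a

def bfull : BR := fun _ _ => true
def beqq : BR := fun a b => a == b
def bmu : BR := fun a b => (a == 2) == (b == 2)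
def brho : BR := fun a b => (a == 2) != (b == 2)
def bpsi' : BR := fun a b => (a == 0 && b == 1) || (a == 1 && b == 0)
def bpsi : BR := fun a b => bpsi' a b || (a == 2 && b == 2)
def biso : BR := fun a b => (a == 0 && b != 2) || (a == 1 && b == 2)
def bflip : BR := fun a b => (a == 0 && b == 2) || (a == 1 && b != 2)
def domB (P : BR) : Fin 3 → Bool := fun a => P a 0 || P a 1 || P a 2
def ranB (P : BR) : Fin 3 → Bool := fun b => P 0 b || P 1 b || P 2 b
def cutB (P K : BR) : BR := fun a b => domB P a && ranB P b && K a b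

def eqB (P Q : BR) : Bool :=
  (P 0 0 == Q 0 0) && (P 0 1 == Q 0 1) && (P 0 2 == Q 0 2) &&
  (P 1 0 == Q 1 0) && (P 1 1 == Q 1 1) && (P 1 2 == Q 1 2) &&
  (P 2 0 == Q 2 0) && (P 2 1 == Q 2 1) && (P 2 2 == Q 2 2)

theorem eqB_eq {P Q : BR} (h : eqB P Q = true) : P = Q := by
  simp only [eqB, Bool.and_eq_true, beq_iff_eq] at h
  funext a b
  fin_cases a <;> fin_cases b <;> simp_all

/-- the forced part of the table of a Mal'cev operation preserving `μ₂` -/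
def pm (a b c : Fin 3) : Option (Fin 3) :=
  if b == c then some a else if a == b then some c
  else if a != 2 && b != 2 && c == 2 then some 2
  else if a == 2 && b != 2 && c != 2 then some 2 else none

def okB (P : BR) : Option (Fin 3) → Option (Fin 3) → Bool
  | some a, some b => P a b
  | _, _ => true

def l3 : List (Fin 3) := [0, 1, 2]

def closedB (P : BR) : Bool :=
  l3.all fun a => l3.all fun a' => !P a a' || (l3.all fun b => l3.all fun b' => !P b b' ||
    (l3.all fun c => l3.all fun c' => !P c c' || okB P (pm a b c) (pm a' b' c')))

def candB : List BR :=
  [bmu, beqq, brho, bpsi, bpsi', biso, bflip, revB biso, revB bflip]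

/-- the relations obtained from `P` by composing with `μ₂` -/
def derB (P : BR) : List BR := [P, compB bmu P, compB P bmu, compB bmu (compB P bmu)]

def goodB (P : BR) : Bool :=
  eqB P (cutB P bfull) || eqB P (cutB P bmu) || eqB P (cutB P beqq) ||
  (derB P).any fun K => candB.any (fun K' => eqB K' K) && eqB P (cutB P K)

def tabB (p0 p1 p2 p3 p4 p5 p6 p7 p8 : Bool) : BR := fun a b =>
  bif a == 0 then (bif b == 0 then p0 else bif b == 1 then p1 else p2)
  else bif a == 1 then (bif b == 0 then p3 else bif b == 1 then p4 else p5)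
  else (bif b == 0 then p6 else bif b == 1 then p7 else p8)

set_option maxRecDepth 100000 in
theorem class_tab : ∀ p0 p1 p2 p3 p4 p5 p6 p7 p8 : Bool,
    (!closedB (tabB p0 p1 p2 p3 p4 p5 p6 p7 p8) ||
      goodB (tabB p0 p1 p2 p3 p4 p5 p6 p7 p8)) = true := by
  decide +kernel

theorem class_B (P : BR) (h : closedB P = true) : goodB P = true := by
  have e : P = tabB (P 0 0) (P 0 1) (P 0 2) (P 1 0) (P 1 1) (P 1 2) (P 2 0) (P 2 1) (P 2 2) := by
    funext a b
    fin_cases a <;> fin_cases b <;> rfl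
  have := class_tab (P 0 0) (P 0 1) (P 0 2) (P 1 0) (P 1 1) (P 1 2) (P 2 0) (P 2 1) (P 2 2)
  rw [← e, h] at this
  simpa using this

/-! ### Invariance is closed under relational operations -/

theorem PresB.comp {n : ℕ} {f : (Fin n → Fin 3) → Fin 3} {P Q : BR}
    (hP : PresB f P) (hQ : PresB f Q) : PresB f (compB P Q) := by
  have key : ∀ (P Q : BR) a c, compB P Q a c = true ↔ ∃ b, P a b = true ∧ Q b c = true := by
    intro P Q a c
    simp [compB, Fin.exists_fin_succ, or_assoc]
  intro x z h
  simp only [key] at h ⊢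
  choose y hy using h
  exact ⟨f y, hP x y fun i => (hy i).1, hQ y z fun i => (hy i).2⟩

theorem PresB.rev {n : ℕ} {f : (Fin n → Fin 3) → Fin 3} {P : BR}
    (hP : PresB f P) : PresB f (revB P) := fun x y h => hP y x h

theorem InvB.comp {C : Ops (Fin 3)} {P Q : BR} (hP : InvB C P) (hQ : InvB C Q) :
    InvB C (compB P Q) := fun n f hf => (hP n f hf).comp (hQ n f hf)

theorem InvB.rev {C : Ops (Fin 3)} {P : BR} (hP : InvB C P) : InvB C (revB P) :=
  fun n f hf => (hP n f hf).rev

theorem pres_iff {n : ℕ} (f : (Fin n → Fin 3) → Fin 3) (R : Set (Fin 2 → Fin 3)) (P : BR)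
    (h : ∀ a b, (![a, b] ∈ R ↔ P a b = true)) : Preserves f R ↔ PresB f P := by
  have h' : ∀ t : Fin 2 → Fin 3, t ∈ R ↔ P (t 0) (t 1) = true := by
    intro t
    rw [← h]
    have : t = ![t 0, t 1] := by
      funext i; fin_cases i <;> rfl
    rw [← this]
  constructor
  · intro hf x y hxy
    have := hf (fun i => ![x i, y i]) (fun i => (h _ _).2 (hxy i))
    rw [h'] at this
    exact this
  · intro hf r hr
    rw [h']
    exact hf _ _ fun i => (h' _).1 (hr i)

theorem pres_psi {n : ℕ} (f : (Fin n → Fin 3) → Fin 3) : Preserves f psi2 ↔ PresB f bpsi :=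
  pres_iff f _ _ (by intro a b; fin_cases a <;> fin_cases b <;> simp [psi2, bpsi, bpsi'])

theorem pres_mu {n : ℕ} (f : (Fin n → Fin 3) → Fin 3) : Preserves f mu2 ↔ PresB f bmu :=
  pres_iff f _ _ (by intro a b; fin_cases a <;> fin_cases b <;> simp [mu2, bmu])

theorem pres_rho {n : ℕ} (f : (Fin n → Fin 3) → Fin 3) : Preserves f rho2 ↔ PresB f brho :=
  pres_iff f _ _ (by intro a b; fin_cases a <;> fin_cases b <;> simp [rho2, brho])

theorem pres_un {A : Type} {n : ℕ} (f : (Fin n → A) → A) (s : Set A) :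
    Preserves f (unRel s) ↔ ∀ x : Fin n → A, (∀ i, x i ∈ s) → f x ∈ s := by
  constructor
  · intro h x hx
    exact h (fun i _ => x i) hx
  · intro h r hr
    exact h (fun i => r i 0) hr

theorem pres_single {A : Type} {n : ℕ} (f : (Fin n → A) → A) (c : A) :
    Preserves f (unRel {c}) ↔ f (fun _ => c) = c := by
  rw [pres_un]
  constructor
  · intro h
    exact h _ (fun _ => rfl)
  · intro h x hx
    have : x = fun _ => c := funext hx
    rw [this]; exact h

/-! ### Baker–Pixley -/

theorem baker_pixley (C : Ops (Fin 3)) (hC : IsClone C)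
    (hmaj : ∃ m ∈ C 2, ∀ x y : Fin 3,
      m ![x, x, y] = x ∧ m ![x, y, x] = x ∧ m ![y, x, x] = x)
    (n : ℕ) (f : (Fin (n + 1) → Fin 3) → Fin 3)
    (h : ∀ x y, ∃ g ∈ C n, g x = f x ∧ g y = f y) : f ∈ C n := by
  obtain ⟨m, hm, hmm⟩ := hmaj
  have key : ∀ (k : ℕ) (S : Finset (Fin (n + 1) → Fin 3)), S.card ≤ k →
      ∃ g ∈ C n, ∀ x ∈ S, g x = f x := by
    intro k
    induction k with
    | zero =>
      intro S hS
      refine ⟨_, hC.proj n 0, ?_⟩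
      have : S = ∅ := by simpa using hS
      simp [this]
    | succ k ih =>
      intro S hS
      by_cases h3 : 2 < S.card
      · obtain ⟨a, b, c, ha, hb, hc, hab, hac, hbc⟩ := Finset.two_lt_card_iff.1 h3
        have er : ∀ a ∈ S, (S.erase a).card ≤ k := by
          intro a ha
          rw [Finset.card_erase_of_mem ha]; omega
        obtain ⟨g1, hg1, e1⟩ := ih _ (er a ha)
        obtain ⟨g2, hg2, e2⟩ := ih _ (er b hb)
        obtain ⟨g3, hg3, e3⟩ := ih _ (er c hc)
        have := hC.comp 2 n m ![g1, g2, g3] hm (by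
          intro i; fin_cases i
          exacts [hg1, hg2, hg3])
        refine ⟨_, this, ?_⟩
        intro x hx
        have ev : (fun i => (![g1, g2, g3] : Fin 3 → _) i x) = ![g1 x, g2 x, g3 x] := by
          funext i; fin_cases i <;> rfl
        simp only [ev]
        by_cases xa : x = a
        · rw [e2 x (by simp [ha, xa, hab]), e3 x (by simp [ha, xa, hac])]
          exact (hmm _ _).2.2
        · rw [e1 x (by simp [hx, xa])]
          by_cases xb : x = b
          · rw [e3 x (by simp [hb, xb, hbc])]
            exact (hmm _ _).2.1
          · rw [e2 x (by simp [hx, xb])]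
            exact (hmm _ _).1
      · have : ∃ x y, S ⊆ {x, y} := by
          rcases S.eq_empty_or_nonempty with rfl | ⟨x, hx⟩
          · exact ⟨fun _ => 0, fun _ => 0, by simp⟩
          · have h1 : (S.erase x).card ≤ 1 := by
              rw [Finset.card_erase_of_mem hx]; omega
            rw [Finset.card_le_one_iff_subset_singleton] at h1
            obtain ⟨y, hy⟩ := h1
            refine ⟨x, y, ?_⟩
            intro z hz
            by_cases hzx : z = x
            · simp [hzx]
            · have := hy (Finset.mem_erase.2 ⟨hzx, hz⟩)
              simp at this
              simp [this]
        obtain ⟨x, y, hS⟩ := this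
        obtain ⟨g, hg, hx, hy⟩ := h x y
        refine ⟨g, hg, ?_⟩
        intro z hz
        have := hS hz
        simp only [Finset.mem_insert, Finset.mem_singleton] at this
        rcases this with rfl | rfl <;> assumption
  obtain ⟨g, hg, e⟩ := key _ Finset.univ le_rfl
  have : f = g := funext fun x => (e x (Finset.mem_univ x)).symm
  rw [this]; exact hg

/-! ### The membership criterion -/

theorem closed_of_inv (C : Ops (Fin 3))
    (hmal : ∃ m ∈ C 2, ∀ x y : Fin 3, m ![y, x, x] = y ∧ m ![x, x, y] = y)
    (hmu : InvB C bmu) (P : BR) (hP : InvB C P) : closedB P = true := by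
  obtain ⟨m, hm, hmm⟩ := hmal
  have hmu' : ∀ a b c a' b' c' : Fin 3, bmu a a' = true → bmu b b' = true → bmu c c' = true →
      bmu (m ![a, b, c]) (m ![a', b', c']) = true := by
    intro a b c a' b' c' h1 h2 h3
    refine hmu 2 m hm _ _ ?_
    intro i; fin_cases i
    exacts [h1, h2, h3]
  have hP' : ∀ a b c a' b' c' : Fin 3, P a a' = true → P b b' = true → P c c' = true →
      P (m ![a, b, c]) (m ![a', b', c']) = true := by
    intro a b c a' b' c' h1 h2 h3
    refine hP 2 m hm _ _ ?_
    intro i; fin_cases i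
    exacts [h1, h2, h3]
  have two : ∀ v, bmu v 2 = true → v = 2 := by decide
  have hpm : ∀ a b c v, pm a b c = some v → m ![a, b, c] = v := by
    intro a b c v h
    unfold pm at h
    split_ifs at h with h1 h2 h3 h4
    · simp at h h1; subst h1; subst h; exact (hmm _ _).1
    · simp at h h2; subst h2; subst h; exact (hmm _ _).2
    · simp at h h3
      obtain ⟨⟨ha, hb⟩, hc⟩ := h3
      subst h; subst hc
      apply two
      have := hmu' a b 2 b b 2 (by simp [bmu, ha, hb]) (by simp [bmu]) rfl
      rwa [(hmm b 2).2] at this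
    · simp at h h4
      obtain ⟨⟨ha, hb⟩, hc⟩ := h4
      subst h; subst ha
      apply two
      have := hmu' 2 b c 2 b b rfl (by simp [bmu]) (by simp [bmu, hb, hc])
      rwa [(hmm b 2).1] at this
  unfold closedB
  simp only [List.all_eq_true, Bool.or_eq_true, Bool.not_eq_true']
  intro a _ a' _
  cases h1 : P a a'
  · simp
  right
  intro b _ b' _
  cases h2 : P b b'
  · simp
  right
  intro c _ c' _
  cases h3 : P c c'
  · simp
  right
  have := hP' a b c a' b' c' h1 h2 h3
  rcases e1 : pm a b c with _ | v
  · simp [okB]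
  rcases e2 : pm a' b' c' with _ | v'
  · simp [okB]
  rw [hpm _ _ _ _ e1, hpm _ _ _ _ e2] at this
  exact this

/-- `f` preserves every subset of `{0,1,2}` -/
def Cons {n : ℕ} (f : (Fin n → Fin 3) → Fin 3) : Prop := ∀ x, ∃ i, x i = f x

theorem cons_cut {n : ℕ} {f : (Fin n → Fin 3) → Fin 3} (hf : Cons f) {P K : BR}
    (hK : PresB f K) (e : P = cutB P K) : PresB f P := by
  intro x y h
  rw [e]
  have hd : ∀ a b, P a b = true → domB P a = true ∧ ranB P b = true := by
    clear e h hK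
    intro a b h
    fin_cases a <;> fin_cases b <;> simp_all [domB, ranB]
  have h1 : domB P (f x) = true := by
    obtain ⟨i, hi⟩ := hf x
    rw [← hi]; exact (hd _ _ (h i)).1
  have h2 : ranB P (f y) = true := by
    obtain ⟨i, hi⟩ := hf y
    rw [← hi]; exact (hd _ _ (h i)).2
  have h3 : K (f x) (f y) = true := by
    apply hK
    intro i
    have := h i
    rw [e] at this
    simp [cutB] at this
    exact this.2
  simp [cutB, h1, h2, h3]

theorem mem_clone (C : Ops (Fin 3)) (hC : IsClone C)
    (hmal : ∃ m ∈ C 2, ∀ x y : Fin 3, m ![y, x, x] = y ∧ m ![x, x, y] = y)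
    (hmaj : ∃ m ∈ C 2, ∀ x y : Fin 3,
      m ![x, x, y] = x ∧ m ![x, y, x] = x ∧ m ![y, x, x] = x)
    (hmu : InvB C bmu) {n : ℕ} (f : (Fin (n + 1) → Fin 3) → Fin 3)
    (hf : Cons f) (h1 : PresB f bmu) (h2 : InvB C brho → PresB f brho)
    (h3 : InvB C bpsi → PresB f bpsi) (h4 : InvB C bpsi' → PresB f bpsi')
    (h5 : InvB C biso → PresB f biso) (h6 : InvB C bflip → PresB f bflip) : f ∈ C n := by
  classical
  have inv : ∀ P, InvB C P → PresB f P := by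
    intro P hP
    have hg := class_B P (closed_of_inv C hmal hmu P hP)
    simp only [goodB, Bool.or_eq_true, List.any_eq_true, Bool.and_eq_true] at hg
    have heq : PresB f beqq := by
      intro x y h
      have : x = y := funext fun i => by simpa [beqq] using h i
      simp [beqq, this]
    rcases hg with ((hg | hg) | hg) | ⟨K, hK, ⟨K', hK', hKK⟩, hg⟩
    · exact cons_cut hf (fun _ _ _ => rfl) (eqB_eq hg)
    · exact cons_cut hf h1 (eqB_eq hg)
    · exact cons_cut hf heq (eqB_eq hg)
    · refine cons_cut hf ?_ (eqB_eq hg)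
      have hKi : InvB C K := by
        simp only [derB, List.mem_cons, List.not_mem_nil, or_false] at hK
        rcases hK with rfl | rfl | rfl | rfl
        · exact hP
        · exact hmu.comp hP
        · exact hP.comp hmu
        · exact hmu.comp (hP.comp hmu)
      have := eqB_eq hKK
      subst this
      simp only [candB, List.mem_cons, List.not_mem_nil, or_false] at hK'
      rcases hK' with rfl | rfl | rfl | rfl | rfl | rfl | rfl | rfl | rfl
      · exact h1
      · exact heq
      · exact h2 hKi
      · exact h3 hKi
      · exact h4 hKi
      · exact h5 hKi
      · exact h6 hKi
      · exact (h5 hKi.rev).rev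
      · exact (h6 hKi.rev).rev
  apply baker_pixley C hC hmaj
  intro x y
  have hP := inv (fun a b => decide (∃ g ∈ C n, g x = a ∧ g y = b)) ?_ x y ?_
  · simpa using hP
  · intro k h hh r s hrs
    simp only [decide_eq_true_eq] at hrs ⊢
    choose g hg hgr hgs using hrs
    refine ⟨_, hC.comp k n h g hh hg, ?_, ?_⟩
    · simp only [hgr]
    · simp only [hgs]
  · intro i
    simp only [decide_eq_true_eq]
    exact ⟨_, hC.proj n i, rfl, rfl⟩

theorem cons_of {n : ℕ} {f : (Fin n → Fin 3) → Fin 3}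
    (h : ∀ c : Fin 3, ∀ x, (∀ i, x i ≠ c) → f x ≠ c) : Cons f := by
  intro x
  by_contra hx
  push Not at hx
  exact h (f x) x hx rfl

theorem psi'_of_psi {n : ℕ} {f : (Fin n → Fin 3) → Fin 3} (hf : Cons f) (h : PresB f bpsi) :
    PresB f bpsi' := cons_cut hf h (eqB_eq (by decide))

theorem MinorLE.trans {A B D : Type} {P : Ops A} {Q : Ops B} {R : Ops D}
    (h1 : MinorLE P Q) (h2 : MinorLE Q R) : MinorLE P R := by
  obtain ⟨ξ, a, b⟩ := h1
  obtain ⟨η, c, d⟩ := h2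
  refine ⟨fun n f => η n (ξ n f), fun n f hf => c n _ (a n f hf), ?_⟩
  intro n r f σ hf
  show η r (ξ r (Minor f σ)) = _
  rw [b n r f σ hf, d n r _ σ (a n f hf)]

theorem MinorLE.of_subset {A : Type} {P Q : Ops A} (h : ∀ n f, f ∈ P n → f ∈ Q n) :
    MinorLE P Q := ⟨fun _ f => f, h, fun _ _ _ _ _ => rfl⟩

/-! ### Maps out of Boolean clones -/

def hh : Fin 3 → Fin 2 := ![0, 0, 1]
def kk : Fin 3 → Fin 2 := ![0, 1, 1]
def kk2 : Fin 3 → Fin 2 := ![1, 0, 1]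
def fl : Fin 2 → Fin 2 := ![1, 0]

def vI (a b : Fin 2) : Fin 3 := if a = 1 then 2 else if b = 0 then 0 else 1
def vII (a b : Fin 2) : Fin 3 := if a = 1 then 2 else if b = 0 then 1 else 0

def xiI (n : ℕ) (g : (Fin (n + 1) → Fin 2) → Fin 2) : (Fin (n + 1) → Fin 3) → Fin 3 :=
  fun x => vI (g (hh ∘ x)) (g (kk ∘ x))
def xiII (n : ℕ) (g : (Fin (n + 1) → Fin 2) → Fin 2) : (Fin (n + 1) → Fin 3) → Fin 3 :=
  fun x => vII (g (hh ∘ x)) (g (kk2 ∘ x))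

section bool
variable {n : ℕ} {g : (Fin (n + 1) → Fin 2) → Fin 2}

theorem val_const {c : Fin 2} (hc : g (fun _ => c) = c) {u : Fin 3 → Fin 2} {d : Fin 3 → Bool}
    {x : Fin (n + 1) → Fin 3} (hx : ∀ i, d (x i) = true)
    (hu : ∀ a, d a = true → u a = c) : g (u ∘ x) = c := by
  have : u ∘ x = fun _ => c := funext fun i => hu _ (hx i)
  rw [this, hc]

theorem val_eq {u v : Fin 3 → Fin 2} {L : BR}
    {x y : Fin (n + 1) → Fin 3} (hx : ∀ i, L (x i) (y i) = true)
    (hu : ∀ a b, L a b = true → u a = v b) : g (u ∘ x) = g (v ∘ y) := by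
  have : u ∘ x = v ∘ y := funext fun i => hu _ _ (hx i)
  rw [this]

theorem val_fl (hs : ∀ z, g (fl ∘ z) = fl (g z)) {u v : Fin 3 → Fin 2} {L : BR}
    {x y : Fin (n + 1) → Fin 3} (hx : ∀ i, L (x i) (y i) = true)
    (hu : ∀ a b, L a b = true → v b = fl (u a)) : g (v ∘ y) = fl (g (u ∘ x)) := by
  have : v ∘ y = fl ∘ (u ∘ x) := funext fun i => hu _ _ (hx i)
  rw [this, hs]

theorem xiI_cons (h0 : g (fun _ => 0) = 0) (h1 : g (fun _ => 1) = 1) : Cons (xiI n g) := by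
  apply cons_of
  intro c x hx
  have key : c = 0 ∨ c = 1 ∨ c = 2 := by clear * -; revert c; decide
  unfold xiI
  rcases key with rfl | rfl | rfl
  · have e : g (kk ∘ x) = 1 :=
      val_const h1 (d := fun a => a != 0) (fun i => by simpa using hx i) (by decide)
    rw [e]; generalize g (hh ∘ x) = a; revert a; decide
  · have e : g (kk ∘ x) = g (hh ∘ x) :=
      val_eq (L := fun a b => a != 1 && a == b) (fun i => by simpa using hx i) (by decide)
    rw [e]; generalize g (hh ∘ x) = a; revert a; decide
  · have e : g (hh ∘ x) = 0 :=
      val_const h0 (d := fun a => a != 2) (fun i => by simpa using hx i) (by decide)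
    rw [e]; generalize g (kk ∘ x) = a; revert a; decide

theorem xiII_cons (h0 : g (fun _ => 0) = 0) (h1 : g (fun _ => 1) = 1) : Cons (xiII n g) := by
  apply cons_of
  intro c x hx
  have key : c = 0 ∨ c = 1 ∨ c = 2 := by clear * -; revert c; decide
  unfold xiII
  rcases key with rfl | rfl | rfl
  · have e : g (kk2 ∘ x) = g (hh ∘ x) :=
      val_eq (L := fun a b => a != 0 && a == b) (fun i => by simpa using hx i) (by decide)
    rw [e]; generalize g (hh ∘ x) = a; revert a; decide
  · have e : g (kk2 ∘ x) = 1 :=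
      val_const h1 (d := fun a => a != 1) (fun i => by simpa using hx i) (by decide)
    rw [e]; generalize g (hh ∘ x) = a; revert a; decide
  · have e : g (hh ∘ x) = 0 :=
      val_const h0 (d := fun a => a != 2) (fun i => by simpa using hx i) (by decide)
    rw [e]; generalize g (kk2 ∘ x) = a; revert a; decide

theorem xiI_mu : PresB (xiI n g) bmu := by
  intro x y h
  unfold xiI
  rw [val_eq (g := g) (u := hh) (v := hh) h (by decide)]
  generalize g (hh ∘ y) = a; generalize g (kk ∘ x) = b; generalize g (kk ∘ y) = c
  revert a b c; decide

theorem xiII_mu : PresB (xiII n g) bmu := by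
  intro x y h
  unfold xiII
  rw [val_eq (g := g) (u := hh) (v := hh) h (by decide)]
  generalize g (hh ∘ y) = a; generalize g (kk2 ∘ x) = b; generalize g (kk2 ∘ y) = c
  revert a b c; decide

theorem left_const (h0 : g (fun _ => 0) = 0) {L : BR} {x y : Fin (n + 1) → Fin 3}
    (h : ∀ i, L (x i) (y i) = true) (hL : ∀ a b, L a b = true → (a != 2) = true) :
    g (hh ∘ x) = 0 :=
  val_const h0 (d := fun a => a != 2) (fun i => hL _ _ (h i)) (by decide)

theorem xiI_iso (h0 : g (fun _ => 0) = 0) : PresB (xiI n g) biso := by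
  intro x y h
  unfold xiI
  rw [left_const h0 h (by decide), val_eq (g := g) (u := kk) (v := hh) h (by decide)]
  generalize g (hh ∘ y) = a; generalize g (kk ∘ y) = c
  revert a c; decide

theorem xiII_flip (h0 : g (fun _ => 0) = 0) : PresB (xiII n g) bflip := by
  intro x y h
  unfold xiII
  rw [left_const h0 h (by decide), val_eq (g := g) (u := kk2) (v := hh) h (by decide)]
  generalize g (hh ∘ y) = a; generalize g (kk2 ∘ y) = c
  revert a c; decide

theorem xiI_rho (hs : ∀ z, g (fl ∘ z) = fl (g z)) : PresB (xiI n g) brho := by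
  intro x y h
  unfold xiI
  rw [val_fl hs (u := hh) (v := hh) h (by decide)]
  generalize g (hh ∘ x) = a; generalize g (kk ∘ x) = b; generalize g (kk ∘ y) = c
  revert a b c; decide

theorem xiI_psi' (h0 : g (fun _ => 0) = 0) (hs : ∀ z, g (fl ∘ z) = fl (g z)) :
    PresB (xiI n g) bpsi' := by
  intro x y h
  unfold xiI
  rw [left_const h0 h (by decide), left_const h0 (L := revB bpsi') (x := y) (y := x) h (by decide),
    val_fl hs (u := kk) (v := kk) h (by decide)]
  generalize g (kk ∘ x) = b
  revert b; decide

theorem xiI_flip (h0 : g (fun _ => 0) = 0) (hs : ∀ z, g (fl ∘ z) = fl (g z)) :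
    PresB (xiI n g) bflip := by
  intro x y h
  unfold xiI
  rw [left_const h0 h (by decide), val_fl hs (u := kk) (v := hh) h (by decide)]
  generalize g (kk ∘ x) = b; generalize g (kk ∘ y) = c
  revert b c; decide

end bool

theorem mem_I2 {n : ℕ} (g : (Fin (n + 1) → Fin 2) → Fin 2) :
    g ∈ CloneI2 n ↔ g (fun _ => 0) = 0 ∧ g (fun _ => 1) = 1 := by
  show _ ∧ _ ↔ _
  rw [pres_single, pres_single]

theorem pres_neq {n : ℕ} (g : (Fin (n + 1) → Fin 2) → Fin 2) :
    Preserves g neqRel ↔ ∀ z, g (fl ∘ z) = fl (g z) := by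
  have key : ∀ a b : Fin 2, a ≠ b ↔ b = fl a := by decide
  constructor
  · intro h z
    have := h (fun i => ![z i, fl (z i)]) (fun i => (key _ _).2 rfl)
    exact (key _ _).1 this
  · intro h r hr
    show _ ≠ _
    rw [key, ← h]
    have : (fun i => r i 1) = fl ∘ fun i => r i 0 := funext fun i => (key _ _).1 (hr i)
    rw [← this]

theorem mem_C2 {n : ℕ} (g : (Fin (n + 1) → Fin 2) → Fin 2) :
    g ∈ CloneC2 n ↔ (∀ z, g (fl ∘ z) = fl (g z)) ∧ g (fun _ => 0) = 0 ∧ g (fun _ => 1) = 1 := by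
  show _ ∧ _ ∧ _ ↔ _
  rw [pres_single, pres_single, pres_neq]

/-! ### Maps out of `ℳ₁` and `ℳ₀` -/

theorem mem_M1 {n : ℕ} (g : (Fin (n + 1) → Fin 3) → Fin 3) :
    g ∈ CloneM1 n ↔ PresB g bpsi ∧ PresB g bmu ∧ ∀ c : Fin 3, g (fun _ => c) = c := by
  show _ ∧ _ ∧ _ ↔ _
  rw [pres_psi, pres_mu]
  simp only [pres_single]

theorem pres01 {n : ℕ} {g : (Fin (n + 1) → Fin 3) → Fin 3} (hm : PresB g bmu)
    (h0 : g (fun _ => 0) = 0) (x : Fin (n + 1) → Fin 3) (hx : ∀ i, x i ≠ 2) : g x ≠ 2 := by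
  have := hm x (fun _ => 0) (fun i => by simp [bmu, hx i])
  rw [h0] at this
  simpa [bmu] using this

theorem mem_M0 {n : ℕ} (g : (Fin (n + 1) → Fin 3) → Fin 3) :
    g ∈ CloneM0 n ↔ PresB g bpsi ∧ PresB g brho ∧ PresB g bmu ∧
      ∀ c : Fin 3, g (fun _ => c) = c := by
  show _ ∧ _ ∧ _ ∧ _ ↔ _
  rw [pres_psi, pres_rho, pres_un]
  simp only [pres_single]
  constructor
  · rintro ⟨h1, h2, _, h4⟩
    refine ⟨h1, h2, ?_, h4⟩
    have := h2.comp h2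
    rwa [show compB brho brho = bmu from eqB_eq (by decide)] at this
  · rintro ⟨h1, h2, h3, h4⟩
    refine ⟨h1, h2, ?_, h4⟩
    have key : ∀ a : Fin 3, a ∈ ({0, 1} : Set (Fin 3)) ↔ a ≠ 2 := by
      intro a; fin_cases a <;> simp
    simp only [key]
    exact pres01 h3 (h4 0)

theorem stepB {n : ℕ} {g : (Fin (n + 1) → Fin 3) → Fin 3} {K : BR} (hK : PresB g K)
    (u v : Fin 3 → Fin 3) {L : BR} {x y : Fin (n + 1) → Fin 3}
    (h : ∀ i, L (x i) (y i) = true) (huv : ∀ a b, L a b = true → K (u a) (v b) = true) :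
    K (g (u ∘ x)) (g (v ∘ y)) = true := hK _ _ fun i => huv _ _ (h i)

theorem stepE {n : ℕ} {g : (Fin (n + 1) → Fin 3) → Fin 3}
    (u v : Fin 3 → Fin 3) {L : BR} {x y : Fin (n + 1) → Fin 3}
    (h : ∀ i, L (x i) (y i) = true) (huv : ∀ a b, L a b = true → u a = v b) :
    g (u ∘ x) = g (v ∘ y) := by
  have : u ∘ x = v ∘ y := funext fun i => huv _ _ (h i)
  rw [this]

theorem stepC {n : ℕ} {g : (Fin (n + 1) → Fin 3) → Fin 3} (c : Fin 3) (hc : g (fun _ => c) = c)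
    (u : Fin 3 → Fin 3) {L : BR} {x y : Fin (n + 1) → Fin 3}
    (h : ∀ i, L (x i) (y i) = true) (hu : ∀ a b, L a b = true → u a = c) :
    g (u ∘ x) = c := by
  have : u ∘ x = fun _ => c := funext fun i => hu _ _ (h i)
  rw [this, hc]

def vM (gx a b p q : Fin 3) : Fin 3 :=
  if gx = 2 then 2 else if a = b then a else
    if p = 2 ∧ q ≠ 2 then 1 else if q = 2 ∧ p ≠ 2 then 0 else gx

def xiM (n : ℕ) (g : (Fin (n + 1) → Fin 3) → Fin 3) : (Fin (n + 1) → Fin 3) → Fin 3 :=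
  fun x => vM (g (id ∘ x)) (g (![0, 1, 0] ∘ x)) (g (![0, 1, 1] ∘ x)) (g (![0, 2, 2] ∘ x))
    (g (![2, 0, 2] ∘ x))

def vZ (gx a b : Fin 3) : Fin 3 :=
  if gx = 2 then 2 else if (a == 2) = (b == 2) then (if a = 2 then 1 else 0) else gx

def xiZ (n : ℕ) (g : (Fin (n + 1) → Fin 3) → Fin 3) : (Fin (n + 1) → Fin 3) → Fin 3 :=
  fun x => vZ (g (id ∘ x)) (g (![0, 2, 0] ∘ x)) (g (![0, 2, 2] ∘ x))

section three
variable {n : ℕ} {g : (Fin (n + 1) → Fin 3) → Fin 3}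

theorem ne2 (hm : PresB g bmu) (h0 : g (fun _ => 0) = 0) (u : Fin 3 → Fin 3)
    (hu : ∀ a, u a ≠ 2) (x : Fin (n + 1) → Fin 3) : g (u ∘ x) ≠ 2 :=
  pres01 hm h0 _ fun i => hu (x i)

/-- the diagonal of the complement of `{c}` -/
def offd (c : Fin 3) : BR := fun a b => a != c && a == b

theorem xiM_cons (hm : PresB g bmu) (hc : ∀ c : Fin 3, g (fun _ => c) = c) : Cons (xiM n g) := by
  apply cons_of
  intro c x hx
  have hx' : ∀ i, offd c (x i) (x i) = true := fun i => by simpa [offd] using hx i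
  have key : c = 0 ∨ c = 1 ∨ c = 2 := by clear * -; revert c; decide
  have ha := ne2 hm (hc 0) ![0, 1, 0] (by decide) x
  have hb := ne2 hm (hc 0) ![0, 1, 1] (by decide) x
  unfold xiM
  rcases key with rfl | rfl | rfl
  · have e1 := stepC 1 (hc 1) ![0, 1, 1] hx' (by decide)
    have e2 := stepC 2 (hc 2) ![0, 2, 2] hx' (by decide)
    have e3 := stepB hm id ![2, 0, 2] hx' (by decide)
    rw [e1, e2]
    revert ha e3
    generalize g (id ∘ x) = a
    generalize g (![0, 1, 0] ∘ x) = b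
    generalize g (![2, 0, 2] ∘ x) = d
    revert a b d; decide
  · have e1 := stepC 0 (hc 0) ![0, 1, 0] hx' (by decide)
    have e2 := stepC 2 (hc 2) ![2, 0, 2] hx' (by decide)
    have e3 := stepB hm id ![0, 2, 2] hx' (by decide)
    rw [e1, e2]
    revert hb e3
    generalize g (id ∘ x) = a
    generalize g (![0, 1, 1] ∘ x) = b
    generalize g (![0, 2, 2] ∘ x) = d
    revert a b d; decide
  · have e1 : g (id ∘ x) ≠ 2 := pres01 hm (hc 0) _ hx
    revert ha hb e1
    generalize g (id ∘ x) = a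
    generalize g (![0, 1, 0] ∘ x) = b
    generalize g (![0, 1, 1] ∘ x) = b'
    generalize g (![0, 2, 2] ∘ x) = d
    generalize g (![2, 0, 2] ∘ x) = d'
    revert a b b' d d'; decide

theorem vM_two : ∀ a b c d e : Fin 3, b ≠ 2 → c ≠ 2 → bmu (vM a b c d e) a = true := by decide
theorem vZ_two : ∀ a b c : Fin 3, bmu (vZ a b c) a = true := by decide

theorem bmu_chain : ∀ a b c d : Fin 3, bmu a b = true → bmu c d = true → bmu b d = true →
    bmu a c = true := by decide
theorem brho_chain : ∀ a b c d : Fin 3, bmu a b = true → bmu c d = true → brho b d = true →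
    brho a c = true := by decide

theorem xiM_mu (hm : PresB g bmu) (hc : ∀ c : Fin 3, g (fun _ => c) = c) :
    PresB (xiM n g) bmu := by
  have key : ∀ x, bmu (xiM n g x) (g (id ∘ x)) = true := fun x =>
    vM_two _ _ _ _ _ (ne2 hm (hc 0) ![0, 1, 0] (by decide) x)
      (ne2 hm (hc 0) ![0, 1, 1] (by decide) x)
  intro x y h
  exact bmu_chain _ _ _ _ (key x) (key y) (hm _ _ h)

theorem xiM_psi (hp : PresB g bpsi) (hm : PresB g bmu) (hc : ∀ c : Fin 3, g (fun _ => c) = c) :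
    PresB (xiM n g) bpsi := by
  intro x y h
  have key : ∀ a b : Fin 3, bpsi a b = true ↔ b = ![1, 0, 2] a := by decide
  have ha := ne2 hm (hc 0) ![0, 1, 0] (by decide) x
  have hb := ne2 hm (hc 0) ![0, 1, 1] (by decide) x
  have e1 := (key _ _).1 (stepB hp id id h (by decide))
  have e2 := (key _ _).1 (stepB hp ![0, 1, 0] ![0, 1, 1] h (by decide))
  have e3 := (key _ _).1 (stepB hp ![0, 1, 1] ![0, 1, 0] h (by decide))
  have e4 : g (![0, 2, 2] ∘ y) = g (![2, 0, 2] ∘ x) :=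
    (stepE ![2, 0, 2] ![0, 2, 2] h (by decide)).symm
  have e5 : g (![2, 0, 2] ∘ y) = g (![0, 2, 2] ∘ x) :=
    (stepE ![0, 2, 2] ![2, 0, 2] h (by decide)).symm
  unfold xiM
  rw [e1, e2, e3, e4, e5]
  revert ha hb
  generalize g (id ∘ x) = a
  generalize g (![0, 1, 0] ∘ x) = b
  generalize g (![0, 1, 1] ∘ x) = b'
  generalize g (![0, 2, 2] ∘ x) = d
  generalize g (![2, 0, 2] ∘ x) = d'
  revert a b b' d d'; decide

theorem xiZ_cons (hr : PresB g brho) (hm : PresB g bmu) (hc : ∀ c : Fin 3, g (fun _ => c) = c) :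
    Cons (xiZ n g) := by
  apply cons_of
  intro c x hx
  have hx' : ∀ i, offd c (x i) (x i) = true := fun i => by simpa [offd] using hx i
  have key : c = 0 ∨ c = 1 ∨ c = 2 := by clear * -; revert c; decide
  unfold xiZ
  rcases key with rfl | rfl | rfl
  · have e2 := stepC 2 (hc 2) ![0, 2, 2] hx' (by decide)
    have e3 := stepB hr id ![0, 2, 0] hx' (by decide)
    rw [e2]
    revert e3
    generalize g (id ∘ x) = a
    generalize g (![0, 2, 0] ∘ x) = d
    revert a d; decide
  · have e1 := stepC 0 (hc 0) ![0, 2, 0] hx' (by decide)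
    have e3 := stepB hm id ![0, 2, 2] hx' (by decide)
    rw [e1]
    revert e3
    generalize g (id ∘ x) = a
    generalize g (![0, 2, 2] ∘ x) = d
    revert a d; decide
  · have e1 : g (id ∘ x) ≠ 2 := pres01 hm (hc 0) _ hx
    revert e1
    generalize g (id ∘ x) = a
    generalize g (![0, 2, 0] ∘ x) = d
    generalize g (![0, 2, 2] ∘ x) = d'
    revert a d d'; decide

theorem xiZ_mu (hm : PresB g bmu) : PresB (xiZ n g) bmu := fun _ _ h =>
  bmu_chain _ _ _ _ (vZ_two _ _ _) (vZ_two _ _ _) (hm _ _ h)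

theorem xiZ_rho (hm : PresB g brho) : PresB (xiZ n g) brho := fun _ _ h =>
  brho_chain _ _ _ _ (vZ_two _ _ _) (vZ_two _ _ _) (hm _ _ h)

theorem xiZ_psi (hp : PresB g bpsi) (hr : PresB g brho) : PresB (xiZ n g) bpsi := by
  intro x y h
  have e1 := stepB hp id id h (by decide)
  have e2 := stepB hr ![0, 2, 0] ![0, 2, 2] h (by decide)
  have e3 := stepB hr ![0, 2, 2] ![0, 2, 0] h (by decide)
  unfold xiZ
  revert e1 e2 e3
  generalize g (id ∘ x) = a
  generalize g (![0, 2, 0] ∘ x) = b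
  generalize g (![0, 2, 2] ∘ x) = d
  generalize g (id ∘ y) = a'
  generalize g (![0, 2, 0] ∘ y) = b'
  generalize g (![0, 2, 2] ∘ y) = d'
  revert a b d a' b' d'; decide +kernel

theorem ne2_left {L : BR} (hL : ∀ a b, L a b = true → a ≠ 2) {x y : Fin (n + 1) → Fin 3}
    (h : ∀ i, L (x i) (y i) = true) : ∀ i, offd 2 (x i) (x i) = true := fun i => by
  simpa [offd] using hL _ _ (h i)

theorem xiZ_iso (hm : PresB g bmu) (hc : ∀ c : Fin 3, g (fun _ => c) = c) :
    PresB (xiZ n g) biso := by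
  intro x y h
  have h' := ne2_left (by decide) h
  have e1 : g (id ∘ x) ≠ 2 := pres01 hm (hc 0) _ fun i => by simpa [offd] using h' i
  have e2 : g (![0, 2, 0] ∘ x) = g (![0, 2, 2] ∘ x) := stepE _ _ h' (by decide)
  have e3 := stepB hm ![0, 2, 0] id h (by decide)
  unfold xiZ
  rw [← e2]
  revert e1 e3
  generalize g (id ∘ x) = a
  generalize g (![0, 2, 0] ∘ x) = b
  generalize g (id ∘ y) = a'
  generalize g (![0, 2, 0] ∘ y) = b'
  generalize g (![0, 2, 2] ∘ y) = d'
  revert a b a' b' d'; decide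

theorem xiZ_flip (hr : PresB g brho) (hm : PresB g bmu) (hc : ∀ c : Fin 3, g (fun _ => c) = c) :
    PresB (xiZ n g) bflip := by
  intro x y h
  have h' := ne2_left (by decide) h
  have e1 : g (id ∘ x) ≠ 2 := pres01 hm (hc 0) _ fun i => by simpa [offd] using h' i
  have e2 : g (![0, 2, 0] ∘ x) = g (![0, 2, 2] ∘ x) := stepE _ _ h' (by decide)
  have e3 := stepB hr ![0, 2, 0] id h (by decide)
  unfold xiZ
  rw [← e2]
  revert e1 e3
  generalize g (id ∘ x) = a
  generalize g (![0, 2, 0] ∘ x) = b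
  generalize g (id ∘ y) = a'
  generalize g (![0, 2, 0] ∘ y) = b'
  generalize g (![0, 2, 2] ∘ y) = d'
  revert a b a' b' d'; decide

end three

/-! ### Maps into Boolean clones -/

def upB : Fin 2 → Fin 3 := ![0, 1]
def dnB : Fin 3 → Fin 2 := ![0, 1, 0]
def upQ : Fin 2 → Fin 3 := ![0, 2]

theorem fin2_const {n : ℕ} (f : (Fin (n + 1) → Fin 3) → Fin 3) (u : Fin 2 → Fin 3)
    (d : Fin 3 → Fin 2) (hid : ∀ a : Fin 3, f (fun _ => a) = a) (hd : ∀ c, d (u c) = c) (c : Fin 2) :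
    d (f (u ∘ fun _ => c)) = c := by
  have : (u ∘ fun _ : Fin (n + 1) => c) = fun _ => u c := rfl
  rw [this, hid, hd]

theorem le_I2 (C : Ops (Fin 3)) (hid : ∀ n, ∀ f ∈ C n, ∀ a : Fin 3, f (fun _ => a) = a) :
    MinorLE C CloneI2 := by
  refine ⟨fun n f x => dnB (f (upB ∘ x)), ?_, fun _ _ _ _ _ => rfl⟩
  intro n f hf
  rw [mem_I2]
  exact ⟨fin2_const f upB dnB (hid n f hf) (by decide) 0,
    fin2_const f upB dnB (hid n f hf) (by decide) 1⟩

theorem le_C2_psi (C : Ops (Fin 3)) (hid : ∀ n, ∀ f ∈ C n, ∀ a : Fin 3, f (fun _ => a) = a)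
    (h : InvB C bpsi') : MinorLE C CloneC2 := by
  refine ⟨fun n f x => dnB (f (upB ∘ x)), ?_, fun _ _ _ _ _ => rfl⟩
  intro n f hf
  rw [mem_C2]
  refine ⟨?_, fin2_const f upB dnB (hid n f hf) (by decide) 0,
    fin2_const f upB dnB (hid n f hf) (by decide) 1⟩
  intro z
  have key : ∀ c, bpsi' (upB c) (upB (fl c)) = true := by decide
  have := h n f hf (upB ∘ z) (upB ∘ fl ∘ z) (fun i => key (z i))
  show dnB (f (upB ∘ fl ∘ z)) = fl (dnB (f (upB ∘ z)))
  revert this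
  generalize f (upB ∘ z) = a
  generalize f (upB ∘ fl ∘ z) = b
  revert a b; decide

theorem le_C2_rho (C : Ops (Fin 3)) (hid : ∀ n, ∀ f ∈ C n, ∀ a : Fin 3, f (fun _ => a) = a)
    (h : InvB C brho) : MinorLE C CloneC2 := by
  refine ⟨fun n f x => hh (f (upQ ∘ x)), ?_, fun _ _ _ _ _ => rfl⟩
  intro n f hf
  rw [mem_C2]
  refine ⟨?_, fin2_const f upQ hh (hid n f hf) (by decide) 0,
    fin2_const f upQ hh (hid n f hf) (by decide) 1⟩
  intro z
  have key : ∀ c, brho (upQ c) (upQ (fl c)) = true := by decide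
  have := h n f hf (upQ ∘ z) (upQ ∘ fl ∘ z) (fun i => key (z i))
  show hh (f (upQ ∘ fl ∘ z)) = fl (hh (f (upQ ∘ z)))
  revert this
  generalize f (upQ ∘ z) = a
  generalize f (upQ ∘ fl ∘ z) = b
  revert a b; decide

theorem M0_le_M1 : MinorLE CloneM0 CloneM1 := by
  apply MinorLE.of_subset
  intro n f hf
  rw [mem_M0] at hf
  rw [mem_M1]
  exact ⟨hf.1, hf.2.2⟩

theorem C2_le_I2 : MinorLE CloneC2 CloneI2 := MinorLE.of_subset fun _ _ hf => hf.2

theorem psi'_of_inv {n : ℕ} {f : (Fin (n + 1) → Fin 3) → Fin 3} (hp : PresB f bpsi)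
    (hm : PresB f bmu) (h0 : f (fun _ => 0) = 0) : PresB f bpsi' := by
  intro x y h
  have h' : ∀ i, x i ≠ 2 ∧ bpsi (x i) (y i) = true := fun i => by
    have := h i
    revert this
    generalize x i = a; generalize y i = b
    revert a b; decide
  have e1 := pres01 hm h0 x fun i => (h' i).1
  have e2 := hp x y fun i => (h' i).2
  revert e1 e2
  generalize f x = a; generalize f y = b
  revert a b; decide

theorem M1_le_C2 : MinorLE CloneM1 CloneC2 := by
  apply le_C2_psi
  · intro n f hf
    exact ((mem_M1 f).1 hf).2.2
  · intro n f hf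
    obtain ⟨h1, h2, h3⟩ := (mem_M1 f).1 hf
    exact psi'_of_inv h1 h2 (h3 0)

/-! ### Non-existence of minion homomorphisms -/

theorem not_I2_le_C2 : ¬ MinorLE CloneI2 CloneC2 := by
  rintro ⟨ξ, h1, h2⟩
  let g : (Fin (1 + 1) → Fin 2) → Fin 2 := fun x => min (x 0) (x 1)
  have hg : g ∈ CloneI2 1 := by rw [mem_I2]; exact ⟨rfl, rfl⟩
  have e := h2 1 1 g ![1, 0] hg
  have e' : Minor g ![1, 0] = g := funext fun x => min_comm _ _
  rw [e'] at e
  have hs := ((mem_C2 _).1 (h1 1 g hg)).1 ![0, 1]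
  have e2 := congrFun e ![0, 1]
  have e3 : (![0, 1] ∘ ![1, 0] : Fin 2 → Fin 2) = fl ∘ ![0, 1] := by decide
  change _ = ξ 1 g (![0, 1] ∘ ![1, 0]) at e2
  rw [e3, hs] at e2
  revert e2
  generalize ξ 1 g ![0, 1] = a
  revert a; decide

def maj2 : (Fin (2 + 1) → Fin 2) → Fin 2 := fun x => if x 0 = x 1 then x 0 else x 2

theorem vec3 {A : Type} (x : Fin (2 + 1) → A) : x = ![x 0, x 1, x 2] := by
  funext i; fin_cases i <;> rfl

theorem not_C2_le_M1 : ¬ MinorLE CloneC2 CloneM1 := by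
  rintro ⟨ξ, h1, h2⟩
  have hg : maj2 ∈ CloneC2 2 := by rw [mem_C2]; exact ⟨by decide, rfl, rfl⟩
  obtain ⟨hp, hm, hc⟩ := (mem_M1 _).1 (h1 2 _ hg)
  -- symmetry in the first two variables
  have e1 : Minor maj2 ![1, 0, 2] = maj2 := by decide
  have s1 := congrFun (h2 2 2 maj2 ![1, 0, 2] hg) ![0, 1, 2]
  rw [e1] at s1
  -- majority
  have e2 : (Minor maj2 ![0, 0, 1] : (Fin (1 + 1) → Fin 2) → Fin 2) = Minor maj2 ![0, 0, 0] := by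
    decide
  have s2 := congrFun (h2 2 1 maj2 ![0, 0, 1] hg) ![0, 2]
  have s3 := congrFun (h2 2 1 maj2 ![0, 0, 0] hg) ![0, 2]
  rw [e2, s3] at s2
  change ξ 2 maj2 (![0, 2] ∘ ![0, 0, 0]) = ξ 2 maj2 (![0, 2] ∘ ![0, 0, 1]) at s2
  change _ = ξ 2 maj2 (![0, 1, 2] ∘ ![1, 0, 2]) at s1
  have k1 := hp ![0, 1, 2] (![0, 1, 2] ∘ ![1, 0, 2]) (by decide)
  have k2 := hm ![0, 1, 2] (![0, 2] ∘ ![0, 0, 1]) (by decide)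
  have k3 : (![0, 2] ∘ ![0, 0, 0] : Fin 3 → Fin 3) = fun _ => 0 := by decide
  rw [k3, hc] at s2
  rw [← s1] at k1
  rw [← s2] at k2
  revert k1 k2
  generalize ξ 2 maj2 ![0, 1, 2] = a
  revert a; decide

def tM (x : Fin (2 + 1) → Fin 3) : Fin 3 :=
  if x 0 = 2 ∨ x 1 = 2 ∨ x 2 = 2 then 2 else if x 0 = x 1 then x 0 else x 2
def sM (x : Fin (2 + 1) → Fin 3) : Fin 3 :=
  if x 0 = 2 ∨ x 1 = 2 ∨ x 2 = 2 then 2 else x 2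

theorem presB3 (f : (Fin (2 + 1) → Fin 3) → Fin 3) (P : BR)
    (h : ∀ a a', P a a' = true → ∀ b b', P b b' = true → ∀ c c', P c c' = true →
      P (f ![a, b, c]) (f ![a', b', c']) = true) : PresB f P := by
  intro x y hxy
  rw [vec3 x, vec3 y]
  exact h _ _ (hxy 0) _ _ (hxy 1) _ _ (hxy 2)

theorem tM_mem : tM ∈ CloneM1 2 := by
  rw [mem_M1]
  exact ⟨presB3 _ _ (by decide +kernel), presB3 _ _ (by decide +kernel), by decide⟩

theorem sM_mem : sM ∈ CloneM1 2 := by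
  rw [mem_M1]
  exact ⟨presB3 _ _ (by decide +kernel), presB3 _ _ (by decide +kernel), by decide⟩

theorem not_M1_le_M0 : ¬ MinorLE CloneM1 CloneM0 := by
  rintro ⟨ξ, h1, h2⟩
  obtain ⟨tp, tr, tm, -⟩ := (mem_M0 _).1 (h1 2 _ tM_mem)
  obtain ⟨sp, -, sm, -⟩ := (mem_M0 _).1 (h1 2 _ sM_mem)
  have e1 : Minor tM ![1, 0, 2] = tM := by
    funext x; rw [vec3 x]; generalize x 0 = a; generalize x 1 = b; generalize x 2 = c
    revert a b c; decide
  have e2 : Minor sM ![1, 0, 2] = sM := by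
    funext x; rw [vec3 x]; generalize x 0 = a; generalize x 1 = b; generalize x 2 = c
    revert a b c; decide
  have e3 : (Minor tM ![0, 0, 1] : (Fin (1 + 1) → Fin 3) → Fin 3) = Minor sM ![1, 1, 0] := by
    decide
  have a1 := congrFun (h2 2 2 tM ![1, 0, 2] tM_mem) ![0, 1, 2]
  have a2 := congrFun (h2 2 2 sM ![1, 0, 2] sM_mem) ![0, 1, 2]
  have a3 := congrFun (h2 2 1 tM ![0, 0, 1] tM_mem) ![2, 0]
  have a4 := congrFun (h2 2 1 sM ![1, 1, 0] sM_mem) ![2, 0]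
  rw [e1] at a1
  rw [e2] at a2
  rw [e3, a4] at a3
  change _ = ξ 2 tM (![0, 1, 2] ∘ ![1, 0, 2]) at a1
  change _ = ξ 2 sM (![0, 1, 2] ∘ ![1, 0, 2]) at a2
  change ξ 2 sM (![2, 0] ∘ ![1, 1, 0]) = ξ 2 tM (![2, 0] ∘ ![0, 0, 1]) at a3
  have k1 := tp ![0, 1, 2] (![0, 1, 2] ∘ ![1, 0, 2]) (by decide)
  have k2 := sp ![0, 1, 2] (![0, 1, 2] ∘ ![1, 0, 2]) (by decide)
  rw [← a1] at k1
  rw [← a2] at k2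
  have k3 := tr ![0, 1, 2] (![2, 0] ∘ ![0, 0, 1]) (by decide)
  have k4 := sm ![0, 1, 2] (![2, 0] ∘ ![1, 1, 0]) (by decide)
  rw [a3] at k4
  revert k1 k2 k3 k4
  generalize ξ 2 tM ![0, 1, 2] = a
  generalize ξ 2 sM ![0, 1, 2] = b
  generalize ξ 2 tM (![2, 0] ∘ ![0, 0, 1]) = c
  revert a b c; decide

/-- Classification of idempotent Mal'cev clones on `{0,1,2}` with a majority operation,
all of whose operations preserve `μ₂`, up to minor-equivalence; moreover
`ℳ₀ ≤ₘ ℳ₁ ≤ₘ 𝒞₂ ≤ₘ ℐ₂` and these four clones are pairwise not minor-equivalent. -/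
theorem stmt2 (C : Ops (Fin 3)) (hC : IsClone C)
    (hid : ∀ n, ∀ f ∈ C n, ∀ a : Fin 3, f (fun _ => a) = a)
    (hmal : ∃ m ∈ C 2, ∀ x y : Fin 3, m ![y, x, x] = y ∧ m ![x, x, y] = y)
    (hmaj : ∃ m ∈ C 2, ∀ x y : Fin 3,
      m ![x, x, y] = x ∧ m ![x, y, x] = x ∧ m ![y, x, x] = x)
    (hmu : InvariantUnder C mu2) :
    ((¬ InvariantUnder C psi2) → (MinorEquiv C CloneC2 ∨ MinorEquiv C CloneI2)) ∧
    (InvariantUnder C psi2 → ¬ InvariantUnder C rho2 → MinorEquiv C CloneM1) ∧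
    (InvariantUnder C psi2 → InvariantUnder C rho2 → MinorEquiv C CloneM0) ∧
    MinorLE CloneM0 CloneM1 ∧ MinorLE CloneM1 CloneC2 ∧ MinorLE CloneC2 CloneI2 ∧
    ¬ MinorEquiv CloneM0 CloneM1 ∧ ¬ MinorEquiv CloneM0 CloneC2 ∧
    ¬ MinorEquiv CloneM0 CloneI2 ∧ ¬ MinorEquiv CloneM1 CloneC2 ∧
    ¬ MinorEquiv CloneM1 CloneI2 ∧ ¬ MinorEquiv CloneC2 CloneI2 := by
  have hmu' : InvB C bmu := fun n f hf => (pres_mu f).1 (hmu n f hf)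
  have epsi : InvariantUnder C psi2 ↔ InvB C bpsi := by
    simp only [InvariantUnder, InvB, pres_psi]
  have erho : InvariantUnder C rho2 ↔ InvB C brho := by
    simp only [InvariantUnder, InvB, pres_rho]
  have mem := @mem_clone C hC hmal hmaj hmu'
  rw [epsi, erho]
  refine ⟨?_, ?_, ?_, M0_le_M1, M1_le_C2, C2_le_I2, ?_, ?_, ?_, ?_, ?_, ?_⟩
  · intro hpsi
    by_cases hd : InvB C bpsi' ∨ InvB C brho
    · left
      refine ⟨?_, xiI, ?_, fun _ _ _ _ _ => rfl⟩
      · rcases hd with h | h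
        · exact le_C2_psi C hid h
        · exact le_C2_rho C hid h
      · intro n g hg
        obtain ⟨hs, h0, h1⟩ := (mem_C2 g).1 hg
        exact mem _ (xiI_cons h0 h1) xiI_mu (fun _ => xiI_rho hs) (fun h => absurd h hpsi)
          (fun _ => xiI_psi' h0 hs) (fun _ => xiI_iso h0) (fun _ => xiI_flip h0 hs)
    · right
      push Not at hd
      refine ⟨le_I2 C hid, ?_⟩
      by_cases hf : InvB C bflip
      · have hi : ¬ InvB C biso := by
          intro hi
          apply hd.2
          have := hi.rev.comp hf
          rwa [show compB (revB biso) bflip = brho from eqB_eq (by decide)] at this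
        refine ⟨xiII, ?_, fun _ _ _ _ _ => rfl⟩
        intro n g hg
        obtain ⟨h0, h1⟩ := (mem_I2 g).1 hg
        exact mem _ (xiII_cons h0 h1) xiII_mu (fun h => absurd h hd.2) (fun h => absurd h hpsi)
          (fun h => absurd h hd.1) (fun h => absurd h hi) (fun _ => xiII_flip h0)
      · refine ⟨xiI, ?_, fun _ _ _ _ _ => rfl⟩
        intro n g hg
        obtain ⟨h0, h1⟩ := (mem_I2 g).1 hg
        exact mem _ (xiI_cons h0 h1) xiI_mu (fun h => absurd h hd.2) (fun h => absurd h hpsi)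
          (fun h => absurd h hd.1) (fun _ => xiI_iso h0) (fun h => absurd h hf)
  · intro hpsi hrho
    refine ⟨MinorLE.of_subset ?_, xiM, ?_, fun _ _ _ _ _ => rfl⟩
    · intro n f hf
      rw [mem_M1]
      exact ⟨hpsi n f hf, hmu' n f hf, hid n f hf⟩
    · intro n g hg
      obtain ⟨hp, hm, hc⟩ := (mem_M1 g).1 hg
      refine mem _ (xiM_cons hm hc) (xiM_mu hm hc) (fun h => absurd h hrho)
        (fun _ => xiM_psi hp hm hc) (fun _ => psi'_of_psi (xiM_cons hm hc) (xiM_psi hp hm hc))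
        (fun h => absurd ?_ hrho) (fun h => absurd ?_ hrho)
      · have := h.rev.comp (hpsi.comp h)
        rwa [show compB (revB biso) (compB bpsi biso) = brho from eqB_eq (by decide)] at this
      · have := h.rev.comp (hpsi.comp h)
        rwa [show compB (revB bflip) (compB bpsi bflip) = brho from eqB_eq (by decide)] at this
  · intro hpsi hrho
    refine ⟨MinorLE.of_subset ?_, xiZ, ?_, fun _ _ _ _ _ => rfl⟩
    · intro n f hf
      rw [mem_M0]
      exact ⟨hpsi n f hf, hrho n f hf, hmu' n f hf, hid n f hf⟩
    · intro n g hg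
      obtain ⟨hp, hr, hm, hc⟩ := (mem_M0 g).1 hg
      exact mem _ (xiZ_cons hr hm hc) (xiZ_mu hm) (fun _ => xiZ_rho hr)
        (fun _ => xiZ_psi hp hr) (fun _ => psi'_of_psi (xiZ_cons hr hm hc) (xiZ_psi hp hr))
        (fun _ => xiZ_iso hm hc) (fun _ => xiZ_flip hr hm hc)
  · exact fun h => not_M1_le_M0 h.2
  · exact fun h => not_C2_le_M1 (h.2.trans M0_le_M1)
  · exact fun h => not_I2_le_C2 ((h.2.trans M0_le_M1).trans M1_le_C2)
  · exact fun h => not_C2_le_M1 h.2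
  · exact fun h => not_I2_le_C2 (h.2.trans M1_le_C2)
  · exact fun h => not_I2_le_C2 h.2
end
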